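/- arXiv:0905.3697 — 3 statements merged into one kernel-verified Lean document; each statement's English description precedes it below -/
import Mathlib

section
/- There exist positive integers n and d, weights w_1,…,w_d ≥ 0 with ∑_{i=1}^d w_i = 1, and unitary n×n matrices U_1,…,U_d such that the resulting random unitary channel Φ satisfies S_min(Φ) + S_min(Φ̄) − S_min(Φ ⊗ Φ̄) > 9.5×10⁻⁶. -/
open scoped BigOperators ComplexOrder
open Matrix

/-- Von Neumann entropy of a (Hermitian) matrix, via its eigenvalues;
`Real.log 0 = 0` gives the convention `0 · log 0 = 0`. -/
noncomputable def vnEntropy {m : Type*} [Fintype m] [DecidableEq m] (ρ : Matrix m m ℂ) : ℝ :=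
  if h : ρ.IsHermitian then -∑ i, h.eigenvalues i * Real.log (h.eigenvalues i) else 0

/-- Minimal output entropy of a channel: infimum of output entropies over density matrices. -/
noncomputable def minOutEntropy {m k : Type*} [Fintype m] [DecidableEq m] [Fintype k]
    [DecidableEq k] (Ψ : Matrix m m ℂ → Matrix k k ℂ) : ℝ :=
  sInf {x : ℝ | ∃ ρ : Matrix m m ℂ, ρ.PosSemidef ∧ ρ.trace = 1 ∧ x = vnEntropy (Ψ ρ)}

/-- The random unitary channel `ρ ↦ ∑ i, w i • U i ρ (U i)ᴴ`. -/
noncomputable def ruChannel {n d : ℕ} (w : Fin d → ℝ) (U : Fin d → Matrix (Fin n) (Fin n) ℂ)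
    (ρ : Matrix (Fin n) (Fin n) ℂ) : Matrix (Fin n) (Fin n) ℂ :=
  ∑ i, (w i : ℂ) • (U i * ρ * (U i)ᴴ)

/-- The complex conjugate channel `ρ ↦ ∑ i, w i • conj (U i) ρ (U i)ᵀ`. -/
noncomputable def conjRuChannel {n d : ℕ} (w : Fin d → ℝ) (U : Fin d → Matrix (Fin n) (Fin n) ℂ)
    (ρ : Matrix (Fin n) (Fin n) ℂ) : Matrix (Fin n) (Fin n) ℂ :=
  ∑ i, (w i : ℂ) • ((U i).map star * ρ * (U i)ᵀ)

open Kronecker in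
/-- The product channel `Φ ⊗ Φ̄` acting on `n² × n²` matrices via Kronecker products. -/
noncomputable def prodChannel {n d : ℕ} (w : Fin d → ℝ) (U : Fin d → Matrix (Fin n) (Fin n) ℂ)
    (ρ : Matrix (Fin n × Fin n) (Fin n × Fin n) ℂ) :
    Matrix (Fin n × Fin n) (Fin n × Fin n) ℂ :=
  ∑ i, ∑ j, ((w i * w j : ℝ) : ℂ) •
    ((U i ⊗ₖ (U j).map star) * ρ * (U i ⊗ₖ (U j).map star)ᴴ)

open MeasureTheory in
/-- A linear automorphism that preserves a bounded open set preserves Haar measure. -/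
theorem measurePreserving_of_preimage_eq {F : Type*} [NormedAddCommGroup F] [NormedSpace ℝ F]
    [FiniteDimensional ℝ F] [MeasurableSpace F] [BorelSpace F] (μ : Measure F)
    [μ.IsAddHaarMeasure] (L : F ≃ₗ[ℝ] F) {B : Set F} (hB : IsOpen B) (hne : B.Nonempty)
    (hbd : Bornology.IsBounded B) (hL : L ⁻¹' B = B) : MeasurePreserving L μ μ := by
  have hc : Continuous L := (L : F →ₗ[ℝ] F).continuous_of_finiteDimensional
  refine ⟨hc.measurable, ?_⟩
  have h := Measure.map_linearMap_addHaar_eq_smul_addHaar μ (f := (L : F →ₗ[ℝ] F))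
    (LinearEquiv.isUnit_det' L).ne_zero
  have h2 : Measure.map L μ B = μ B := by
    rw [Measure.map_apply hc.measurable hB.measurableSet, hL]
  have h3 : Measure.map L μ = ENNReal.ofReal |(LinearMap.det (L : F →ₗ[ℝ] F))⁻¹| • μ := h
  rw [h3] at h2 ⊢
  have hpos : μ B ≠ 0 := (hB.measure_pos μ hne).ne'
  have hfin : μ B ≠ ⊤ := hbd.measure_lt_top.ne
  have h4 : ENNReal.ofReal |(LinearMap.det (L : F →ₗ[ℝ] F))⁻¹| = 1 := by
    rw [Measure.smul_apply, smul_eq_mul] at h2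
    exact (ENNReal.mul_eq_right hpos hfin).1 h2
  rw [h4, one_smul]

open MeasureTheory in
theorem exists_isMulRightInvariant_isProbabilityMeasure (G : Type*) [Group G] [TopologicalSpace G]
    [IsTopologicalGroup G] [CompactSpace G] [MeasurableSpace G] [BorelSpace G] :
    ∃ ν : Measure G, IsProbabilityMeasure ν ∧ ν.IsMulRightInvariant := by
  let m : Measure G := Measure.haarMeasure ⊤
  have hm : IsProbabilityMeasure m := ⟨Measure.haarMeasure_self (K₀ := ⊤)⟩
  refine ⟨m.inv, ⟨?_⟩, inferInstance⟩
  rw [Measure.inv_apply]; simp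

section Unitary

variable {E : Type*} [NormedAddCommGroup E] [InnerProductSpace ℂ E] [FiniteDimensional ℂ E]

theorem unitary_inner_map_map (u : unitary (E →L[ℂ] E)) (x y : E) :
    inner ℂ ((u : E →L[ℂ] E) x) ((u : E →L[ℂ] E) y) = inner ℂ x y :=
  (Unitary.linearIsometryEquiv u).inner_map_map x y

theorem unitary_norm_map (u : unitary (E →L[ℂ] E)) (x : E) : ‖(u : E →L[ℂ] E) x‖ = ‖x‖ :=
  (Unitary.linearIsometryEquiv u).norm_map x

instance compactSpace_unitary : CompactSpace (unitary (E →L[ℂ] E)) := by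
  suffices h : IsCompact (unitary (E →L[ℂ] E) : Set (E →L[ℂ] E)) from
    isCompact_iff_compactSpace.1 h
  refine Metric.isCompact_of_isClosed_isBounded isClosed_unitary ?_
  refine (Metric.isBounded_iff_subset_closedBall 0).2 ⟨1, fun u hu => ?_⟩
  rw [mem_closedBall_zero_iff]
  refine ContinuousLinearMap.opNorm_le_bound _ zero_le_one fun x => ?_
  rw [one_mul]
  exact (unitary_norm_map ⟨u, hu⟩ x).le

theorem exists_unitary_apply_eq {u v : E} (hu : ‖u‖ = 1) (hv : ‖v‖ = 1) :
    ∃ W : unitary (E →L[ℂ] E), (W : E →L[ℂ] E) u = v := by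
  have hpos : 0 < Module.finrank ℂ E := by
    have : Nontrivial E := ⟨u, 0, by rintro rfl; simp at hu⟩
    exact Module.finrank_pos
  let i₀ : Fin (Module.finrank ℂ E) := ⟨0, hpos⟩
  have key : ∀ w : E, ‖w‖ = 1 → ∃ b : OrthonormalBasis (Fin (Module.finrank ℂ E)) ℂ E,
      b i₀ = w := by
    intro w hw
    obtain ⟨b, hb⟩ := Orthonormal.exists_orthonormalBasis_extension_of_card_eq
      (𝕜 := ℂ) (E := E) (ι := Fin (Module.finrank ℂ E)) (by simp) (v := fun _ => w) (s := {i₀})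
      (by
        constructor
        · intro i; simpa using hw
        · intro i j hij; exact absurd (Subsingleton.elim i j) hij)
    exact ⟨b, hb i₀ rfl⟩
  obtain ⟨b, hb⟩ := key u hu
  obtain ⟨b', hb'⟩ := key v hv
  refine ⟨Unitary.linearIsometryEquiv.symm (b.equiv b' (Equiv.refl _)), ?_⟩
  rw [← hb, ← hb']
  simp

open MeasureTheory in
theorem measurePreserving_unitary [MeasurableSpace E] [BorelSpace E] (μ : Measure E)
    [μ.IsAddHaarMeasure] (u : unitary (E →L[ℂ] E)) :
    MeasurePreserving (fun x => (u : E →L[ℂ] E) x) μ μ := by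
  refine measurePreserving_of_preimage_eq μ
    ((Unitary.linearIsometryEquiv u).toLinearEquiv.restrictScalars ℝ)
    (B := Metric.ball 0 1) Metric.isOpen_ball ⟨0, by simp⟩ Metric.isBounded_ball ?_
  ext x
  simp

end Unitary

theorem Real.sq_Gamma_add_half_ge {s : ℝ} (hs : 1 / 2 < s) :
    (s - 1 / 2) * Real.Gamma s ^ 2 ≤ Real.Gamma (s + 1 / 2) ^ 2 := by
  have h := Real.Gamma_mul_add_mul_le_rpow_Gamma_mul_rpow_Gamma (s := s - 1 / 2) (t := s + 1 / 2)
    (a := 1 / 2) (b := 1 / 2) (by linarith) (by linarith) (by norm_num) (by norm_num) (by norm_num)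
  have e : (1 / 2 : ℝ) * (s - 1 / 2) + 1 / 2 * (s + 1 / 2) = s := by ring
  have h1 : 0 < Real.Gamma (s - 1 / 2) := Real.Gamma_pos_of_pos (by linarith)
  have h2 : 0 < Real.Gamma (s + 1 / 2) := Real.Gamma_pos_of_pos (by linarith)
  have h3 : Real.Gamma (s + 1 / 2) = (s - 1 / 2) * Real.Gamma (s - 1 / 2) := by
    rw [← Real.Gamma_add_one (by linarith)]; congr 1; ring
  rw [e, ← Real.sqrt_eq_rpow, ← Real.sqrt_eq_rpow] at h
  have h4 : Real.Gamma s ^ 2 ≤ Real.Gamma (s - 1 / 2) * Real.Gamma (s + 1 / 2) := by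
    calc Real.Gamma s ^ 2 ≤ (√(Real.Gamma (s - 1 / 2)) * √(Real.Gamma (s + 1 / 2))) ^ 2 := by
          have := (Real.Gamma_pos_of_pos (show 0 < s by linarith)).le
          gcongr
      _ = _ := by rw [mul_pow, Real.sq_sqrt h1.le, Real.sq_sqrt h2.le]
  calc (s - 1 / 2) * Real.Gamma s ^ 2
      ≤ (s - 1 / 2) * (Real.Gamma (s - 1 / 2) * Real.Gamma (s + 1 / 2)) := by
        have : 0 ≤ s - 1 / 2 := by linarith
        gcongr
    _ = Real.Gamma (s + 1 / 2) ^ 2 := by rw [← mul_assoc, ← h3]; ring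

section Radial

open MeasureTheory

variable {E : Type*} [NormedAddCommGroup E] [InnerProductSpace ℂ E] [FiniteDimensional ℂ E]
  [MeasurableSpace E] [BorelSpace E] [Nontrivial E] (μ : Measure E) [μ.IsAddHaarMeasure]

theorem integrable_norm_pow_mul_exp_neg_sq_norm (k : ℕ) :
    Integrable (fun v : E => ‖v‖ ^ k * Real.exp (-‖v‖ ^ 2)) μ := by
  rw [integrable_fun_norm_addHaar μ (f := fun y : ℝ => y ^ k * Real.exp (-y ^ 2))]
  have h := integrableOn_rpow_mul_exp_neg_rpow (p := 2)
    (s := ((Module.finrank ℝ E - 1 + k : ℕ) : ℝ))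
    (lt_of_lt_of_le (by norm_num) (Nat.cast_nonneg _)) two_pos
  refine h.congr_fun (fun y _ => ?_) measurableSet_Ioi
  simp only [Real.rpow_natCast, smul_eq_mul, pow_add, Real.rpow_ofNat, mul_assoc]

theorem exists_integral_norm_pow_mul_exp_neg_sq_norm :
    ∃ C : ℝ, 0 < C ∧ ∀ k : ℕ, ∫ v : E, ‖v‖ ^ k * Real.exp (-‖v‖ ^ 2) ∂μ =
      C * Real.Gamma (Module.finrank ℂ E + k / 2) := by
  have hn : 0 < Module.finrank ℂ E := Module.finrank_pos
  refine ⟨Module.finrank ℝ E * μ.real (Metric.ball (0 : E) 1) * (1 / 2), ?_, fun k => ?_⟩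
  · have h1 : 0 < μ.real (Metric.ball (0 : E) 1) :=
      ENNReal.toReal_pos (Metric.measure_ball_pos μ _ one_pos).ne' measure_ball_lt_top.ne
    have h2 : (0 : ℝ) < Module.finrank ℝ E := by
      rw [finrank_real_of_complex]; exact_mod_cast (by omega)
    positivity
  · rw [integral_fun_norm_addHaar μ (fun y : ℝ => y ^ k * Real.exp (-y ^ 2))]
    have h := integral_rpow_mul_exp_neg_rpow (p := 2)
      (q := ((Module.finrank ℝ E - 1 + k : ℕ) : ℝ)) two_pos
      (lt_of_lt_of_le (by norm_num) (Nat.cast_nonneg _))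
    have h' : ∫ y in Set.Ioi (0 : ℝ), y ^ (Module.finrank ℝ E - 1) • (y ^ k * Real.exp (-y ^ 2)) =
        1 / 2 * Real.Gamma ((((Module.finrank ℝ E - 1 + k : ℕ) : ℝ) + 1) / 2) := by
      rw [← h]
      refine setIntegral_congr_fun measurableSet_Ioi fun y _ => ?_
      simp only [Real.rpow_natCast, smul_eq_mul, pow_add, Real.rpow_ofNat, mul_assoc]
    rw [h']
    have e : (((Module.finrank ℝ E - 1 + k : ℕ) : ℝ) + 1) / 2 = Module.finrank ℂ E + k / 2 := by
      rw [finrank_real_of_complex]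
      have : ((2 * Module.finrank ℂ E - 1 + k : ℕ) : ℝ) + 1 = 2 * Module.finrank ℂ E + k := by
        exact_mod_cast (show 2 * Module.finrank ℂ E - 1 + k + 1 = _ by omega)
      rw [this]; ring
    rw [e]
    simp only [nsmul_eq_mul, smul_eq_mul]
    ring

theorem integral_exp_neg_sq_norm_pos : 0 < ∫ v : E, Real.exp (-‖v‖ ^ 2) ∂μ := by
  obtain ⟨C, hC, h⟩ := exists_integral_norm_pow_mul_exp_neg_sq_norm μ
  have h0 := h 0
  have hn : 0 < Module.finrank ℂ E := Module.finrank_pos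
  simp only [pow_zero, one_mul, Nat.cast_zero, zero_div, add_zero] at h0
  rw [h0]
  exact mul_pos hC (Real.Gamma_pos_of_pos (by exact_mod_cast hn))

theorem integral_sq_norm_mul_exp_neg_sq_norm :
    ∫ v : E, ‖v‖ ^ 2 * Real.exp (-‖v‖ ^ 2) ∂μ =
      Module.finrank ℂ E * ∫ v : E, Real.exp (-‖v‖ ^ 2) ∂μ := by
  obtain ⟨C, hC, h⟩ := exists_integral_norm_pow_mul_exp_neg_sq_norm μ
  have h0 := h 0
  have hn : 0 < Module.finrank ℂ E := Module.finrank_pos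
  simp only [pow_zero, one_mul, Nat.cast_zero, zero_div, add_zero] at h0
  rw [h0, h 2, Nat.cast_ofNat, div_self two_ne_zero, Real.Gamma_add_one (by exact_mod_cast hn.ne')]
  ring

theorem sq_integral_norm_mul_exp_neg_sq_norm_ge :
    (Module.finrank ℂ E - 1 / 2) * (∫ v : E, Real.exp (-‖v‖ ^ 2) ∂μ) ^ 2 ≤
      (∫ v : E, ‖v‖ * Real.exp (-‖v‖ ^ 2) ∂μ) ^ 2 := by
  obtain ⟨C, hC, h⟩ := exists_integral_norm_pow_mul_exp_neg_sq_norm μ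
  have h0 := h 0
  have h1 := h 1
  have hn : 1 ≤ Module.finrank ℂ E := Module.finrank_pos
  have hn' : (1 : ℝ) ≤ Module.finrank ℂ E := by exact_mod_cast hn
  simp only [pow_zero, one_mul, Nat.cast_zero, zero_div, add_zero, pow_one, Nat.cast_one] at h0 h1
  rw [h0, h1]
  have := Real.sq_Gamma_add_half_ge (s := Module.finrank ℂ E) (by linarith)
  nlinarith [mul_le_mul_of_nonneg_left this (sq_nonneg C)]

end Radial

/-- The real part of `∑ i j, Q i j ⟪g j, g i⟫`. -/
noncomputable def gramForm {ι E : Type*} [Fintype ι] [NormedAddCommGroup E]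
    [InnerProductSpace ℂ E] (Q : Matrix ι ι ℂ) (g : ι → E) : ℝ :=
  (∑ i, ∑ j, Q i j * inner ℂ (g j) (g i)).re

section GramForm

variable {ι E : Type*} [Fintype ι] [NormedAddCommGroup E] [InnerProductSpace ℂ E]

theorem inner_sum_smul_self (V : ι → ℂ) (g : ι → E) :
    ∑ i, ∑ j, V i * star (V j) * inner ℂ (g j) (g i) =
      ((‖∑ i, V i • g i‖ ^ 2 : ℝ) : ℂ) := by
  push_cast
  rw [← RCLike.ofReal_eq_complex_ofReal, ← inner_self_eq_norm_sq_to_K, sum_inner,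
    Finset.sum_comm]
  refine Finset.sum_congr rfl fun j _ => ?_
  rw [inner_sum]
  refine Finset.sum_congr rfl fun i _ => ?_
  rw [inner_smul_left, inner_smul_right]
  simp only [starRingEnd_apply]
  ring

variable [DecidableEq ι]

theorem Matrix.IsHermitian.apply_eq_sum_eigenvalues {Q : Matrix ι ι ℂ} (hQ : Q.IsHermitian)
    (i j : ι) : Q i j = ∑ k, (hQ.eigenvalues k : ℂ) *
      ((hQ.eigenvectorUnitary : Matrix ι ι ℂ) i k *
        star ((hQ.eigenvectorUnitary : Matrix ι ι ℂ) j k)) := by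
  conv_lhs => rw [hQ.spectral_theorem]
  rw [Unitary.conjStarAlgAut_apply, Matrix.mul_apply]
  refine Finset.sum_congr rfl fun k _ => ?_
  rw [Matrix.mul_diagonal, Matrix.star_apply, Function.comp_apply,
    RCLike.ofReal_eq_complex_ofReal]
  ring

theorem gramForm_eq_sum_eigenvalues {Q : Matrix ι ι ℂ} (hQ : Q.IsHermitian) (g : ι → E) :
    gramForm Q g = ∑ k, hQ.eigenvalues k *
      ‖∑ i, (hQ.eigenvectorUnitary : Matrix ι ι ℂ) i k • g i‖ ^ 2 := by
  have h : ∑ i, ∑ j, Q i j * inner ℂ (g j) (g i) = ((∑ k, hQ.eigenvalues k *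
      ‖∑ i, (hQ.eigenvectorUnitary : Matrix ι ι ℂ) i k • g i‖ ^ 2 : ℝ) : ℂ) := by
    simp only [Complex.ofReal_sum, Complex.ofReal_mul, ← inner_sum_smul_self]
    simp only [hQ.apply_eq_sum_eigenvalues, Finset.sum_mul, Finset.mul_sum]
    rw [Finset.sum_comm_cycle]
    refine Finset.sum_congr rfl fun k _ => Finset.sum_congr rfl fun i _ =>
      Finset.sum_congr rfl fun j _ => ?_
    ring
  rw [gramForm, h, Complex.ofReal_re]

/-- The unitary change of variables `g ↦ (k ↦ ∑ i, V i k • g i)`. -/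
noncomputable def unitaryMix (V : unitaryGroup ι ℂ) : (ι → E) ≃ₗ[ℝ] (ι → E) where
  toFun g k := ∑ i, (V : Matrix ι ι ℂ) i k • g i
  invFun h i := ∑ k, star ((V : Matrix ι ι ℂ) i k) • h k
  map_add' g g' := by ext k; simp [smul_add, Finset.sum_add_distrib]
  map_smul' c g := by
    ext k; simp only [Pi.smul_apply, RingHom.id_apply, Finset.smul_sum]
    exact Finset.sum_congr rfl fun i _ => smul_comm _ _ _
  left_inv g := by
    ext i
    simp only [Finset.smul_sum, smul_smul]
    rw [Finset.sum_comm]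
    simp only [← Finset.sum_smul]
    have h : ∀ j, ∑ k, star ((V : Matrix ι ι ℂ) i k) * (V : Matrix ι ι ℂ) j k =
        (1 : Matrix ι ι ℂ) j i := fun j => by
      rw [← Unitary.mul_star_self_of_mem V.2, Matrix.mul_apply]
      exact Finset.sum_congr rfl fun k _ => by rw [Matrix.star_apply, mul_comm]
    simp only [h, Matrix.one_apply, ite_smul, one_smul, zero_smul, Finset.sum_ite_eq',
      Finset.mem_univ, if_true]
  right_inv g := by
    ext i
    simp only [Finset.smul_sum, smul_smul]
    rw [Finset.sum_comm]
    simp only [← Finset.sum_smul]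
    have h : ∀ j, ∑ k, (V : Matrix ι ι ℂ) k i * star ((V : Matrix ι ι ℂ) k j) =
        (1 : Matrix ι ι ℂ) j i := fun j => by
      rw [← Unitary.star_mul_self_of_mem V.2, Matrix.mul_apply]
      exact Finset.sum_congr rfl fun k _ => by rw [Matrix.star_apply, mul_comm]
    simp only [h, Matrix.one_apply, ite_smul, one_smul, zero_smul, Finset.sum_ite_eq',
      Finset.mem_univ, if_true]

theorem sum_sq_norm_unitaryMix (V : unitaryGroup ι ℂ) (g : ι → E) :
    ∑ k, ‖unitaryMix V g k‖ ^ 2 = ∑ i, ‖g i‖ ^ 2 := by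
  have h : ((∑ k, ‖unitaryMix V g k‖ ^ 2 : ℝ) : ℂ) = ((∑ i, ‖g i‖ ^ 2 : ℝ) : ℂ) := by
    have hV : ∀ i j, ∑ k, (V : Matrix ι ι ℂ) i k * star ((V : Matrix ι ι ℂ) j k) =
        (1 : Matrix ι ι ℂ) i j := fun i j => by
      rw [← Unitary.mul_star_self_of_mem V.2, Matrix.mul_apply]
      exact Finset.sum_congr rfl fun k _ => by rw [Matrix.star_apply]
    have hg : ∀ k, unitaryMix V g k = ∑ i, (V : Matrix ι ι ℂ) i k • g i := fun _ => rfl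
    obtain ⟨W, hW⟩ : ∃ W : ι → ι → ℂ, ∀ i k, (V : Matrix ι ι ℂ) i k = W i k :=
      ⟨fun i k => (V : Matrix ι ι ℂ) i k, fun _ _ => rfl⟩
    simp only [hW] at hV hg
    rw [Complex.ofReal_sum, Complex.ofReal_sum]
    simp only [hg, ← inner_sum_smul_self]
    rw [← Finset.sum_comm_cycle]
    rw [Finset.sum_comm]
    simp only [← Finset.sum_mul, hV, Matrix.one_apply, ite_mul, one_mul, zero_mul,
      Finset.sum_ite_eq', Finset.mem_univ, if_true]
    refine Finset.sum_congr rfl fun i _ => ?_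
    simp
  exact_mod_cast h

open MeasureTheory

variable [FiniteDimensional ℂ E] [MeasurableSpace E] [BorelSpace E]

theorem measurePreserving_unitaryMix (μ : Measure E) [μ.IsAddHaarMeasure]
    (V : unitaryGroup ι ℂ) :
    MeasurePreserving (unitaryMix V : (ι → E) ≃ₗ[ℝ] (ι → E)) (Measure.pi fun _ => μ)
      (Measure.pi fun _ => μ) := by
  refine measurePreserving_of_preimage_eq _ _ (B := {g | ∑ i, ‖g i‖ ^ 2 < 1}) ?_ ?_ ?_ ?_
  · exact isOpen_lt (by fun_prop) continuous_const
  · exact ⟨0, by simp⟩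
  · refine (Metric.isBounded_iff_subset_closedBall 0).2 ⟨1, fun g hg => ?_⟩
    rw [mem_closedBall_zero_iff, pi_norm_le_iff_of_nonneg zero_le_one]
    intro i
    have h := Finset.single_le_sum (f := fun i => ‖g i‖ ^ 2) (fun i _ => sq_nonneg _)
      (Finset.mem_univ i)
    have hg' : ∑ i, ‖g i‖ ^ 2 < 1 := hg
    have h1 : ‖g i‖ ^ 2 ≤ 1 := h.trans hg'.le
    exact (sq_le_one_iff₀ (norm_nonneg _)).1 h1
  · ext g
    simp [sum_sq_norm_unitaryMix]

theorem integral_exp_neg_mul_sq_norm (μ : Measure E) [μ.IsAddHaarMeasure] {q : ℝ} (hq : 0 < q) :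
    ∫ v, Real.exp (-(q * ‖v‖ ^ 2)) ∂μ =
      (q⁻¹) ^ Module.finrank ℂ E * ∫ v, Real.exp (-‖v‖ ^ 2) ∂μ := by
  have h := Measure.integral_comp_smul μ (fun v : E => Real.exp (-‖v‖ ^ 2)) (√q)
  simp only [norm_smul, mul_pow, Real.norm_eq_abs, sq_abs, Real.sq_sqrt hq.le] at h
  rw [h, finrank_real_of_complex, pow_mul, Real.sq_sqrt hq.le, smul_eq_mul, inv_pow,
    abs_of_pos (by positivity)]

variable [Nontrivial E]

theorem integrable_exp_neg_mul_sq_norm (μ : Measure E) [μ.IsAddHaarMeasure] {q : ℝ} (hq : 0 < q) :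
    Integrable (fun v => Real.exp (-(q * ‖v‖ ^ 2))) μ := by
  have h := (integrable_norm_pow_mul_exp_neg_sq_norm μ 0).comp_smul
    (Real.sqrt_pos.2 hq).ne'
  simpa [norm_smul, mul_pow, Real.sq_sqrt hq.le] using h

/-- The Gaussian integral of a positive definite form on a power of `E`. -/
theorem integral_exp_neg_gramForm (μ : Measure E) [μ.IsAddHaarMeasure] {Q : Matrix ι ι ℂ}
    (hQ : Q.IsHermitian) (hpos : ∀ k, 0 < hQ.eigenvalues k) :
    Integrable (fun g : ι → E => Real.exp (-gramForm Q g)) (Measure.pi fun _ => μ) ∧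
    ∫ g : ι → E, Real.exp (-gramForm Q g) ∂(Measure.pi fun _ => μ) =
      (∏ k, (hQ.eigenvalues k)⁻¹) ^ Module.finrank ℂ E *
        (∫ v, Real.exp (-‖v‖ ^ 2) ∂μ) ^ Fintype.card ι := by
  have hmp := measurePreserving_unitaryMix μ hQ.eigenvectorUnitary
  let f : (ι → E) → ℝ := fun h => ∏ k, Real.exp (-(hQ.eigenvalues k * ‖h k‖ ^ 2))
  have hf : (fun g : ι → E => Real.exp (-gramForm Q g)) =
      f ∘ unitaryMix hQ.eigenvectorUnitary := by
    ext g
    simp only [f, Function.comp_apply, ← Real.exp_sum, Finset.sum_neg_distrib]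
    rw [gramForm_eq_sum_eigenvalues hQ]
    rfl
  have h_int : Integrable f (Measure.pi fun _ => μ) :=
    Integrable.fintype_prod (f := fun k v => Real.exp (-(hQ.eigenvalues k * ‖v‖ ^ 2)))
      fun k => integrable_exp_neg_mul_sq_norm μ (hpos k)
  constructor
  · rw [hf]
    exact hmp.integrable_comp_of_integrable h_int
  · rw [hf]
    have h1 : ∫ g, f (unitaryMix hQ.eigenvectorUnitary g) ∂(Measure.pi fun _ => μ) =
        ∫ g, f g ∂(Measure.pi fun _ => μ) := by
      conv_rhs => rw [← hmp.map_eq]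
      rw [integral_map hmp.measurable.aemeasurable]
      rw [hmp.map_eq]
      exact h_int.aestronglyMeasurable
    refine h1.trans ?_
    have h2 := integral_fintype_prod_eq_prod (𝕜 := ℝ) (μ := fun _ : ι => μ)
      (fun k v => Real.exp (-(hQ.eigenvalues k * ‖v‖ ^ 2)))
    refine h2.trans ?_
    simp only [integral_exp_neg_mul_sq_norm μ (hpos _), Finset.prod_mul_distrib,
      Finset.prod_const, Finset.prod_pow, Finset.card_univ]

end GramForm

section GramFormAlgebra

variable {ι E : Type*} [Fintype ι] [NormedAddCommGroup E] [InnerProductSpace ℂ E]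

theorem gramForm_eq_sum (Q : Matrix ι ι ℂ) (g : ι → E) :
    gramForm Q g = ∑ i, ∑ j, (Q i j * inner ℂ (g j) (g i)).re := by
  simp [gramForm]

theorem gramForm_smul (Q : Matrix ι ι ℂ) (r : ι → ℝ) (v : ι → E) :
    gramForm Q (fun i => (r i : ℂ) • v i) =
      ∑ i, ∑ j, (Q i j * inner ℂ (v j) (v i)).re * (r i * r j) := by
  rw [gramForm_eq_sum]
  refine Finset.sum_congr rfl fun i _ => Finset.sum_congr rfl fun j _ => ?_
  rw [inner_smul_left, inner_smul_right, Complex.conj_ofReal, ← Complex.re_mul_ofReal]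
  congr 1
  push_cast
  ring

theorem continuous_gramForm (Q : Matrix ι ι ℂ) : Continuous (gramForm (E := E) Q) := by
  unfold gramForm
  fun_prop

end GramFormAlgebra

section GaussianMoments

open MeasureTheory

variable {ι E : Type*} [Fintype ι] [DecidableEq ι] [NormedAddCommGroup E] [InnerProductSpace ℂ E]
  [FiniteDimensional ℂ E] [MeasurableSpace E] [BorelSpace E] [Nontrivial E]
  (μ : Measure E) [μ.IsAddHaarMeasure]

/-- The squared normalized first radial moment of the Gaussian weight. -/
noncomputable def radialConst : ℝ :=
  ((∫ v, ‖v‖ * Real.exp (-‖v‖ ^ 2) ∂μ) / ∫ v, Real.exp (-‖v‖ ^ 2) ∂μ) ^ 2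

theorem radialConst_ge : (Module.finrank ℂ E : ℝ) - 1 / 2 ≤ radialConst μ := by
  rw [radialConst, div_pow, le_div_iff₀ (pow_pos (integral_exp_neg_sq_norm_pos μ) 2)]
  exact sq_integral_norm_mul_exp_neg_sq_norm_ge μ

theorem integral_prod_exp_mul_norm_mul_norm (i j : ι) :
    Integrable (fun g : ι → E => (∏ k, Real.exp (-‖g k‖ ^ 2)) * (‖g i‖ * ‖g j‖))
      (Measure.pi fun _ => μ) ∧
    ∫ g : ι → E, (∏ k, Real.exp (-‖g k‖ ^ 2)) * (‖g i‖ * ‖g j‖) ∂(Measure.pi fun _ => μ) =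
      (if i = j then (Module.finrank ℂ E : ℝ) else radialConst μ) *
        (∫ v, Real.exp (-‖v‖ ^ 2) ∂μ) ^ Fintype.card ι := by
  have hZ := integral_exp_neg_sq_norm_pos μ
  have he : (fun g : ι → E => (∏ k, Real.exp (-‖g k‖ ^ 2)) * (‖g i‖ * ‖g j‖)) =
      fun g => ∏ k, (‖g k‖ ^ ((if k = i then 1 else 0) + if k = j then 1 else 0) *
        Real.exp (-‖g k‖ ^ 2)) := by
    ext g
    rw [Finset.prod_mul_distrib, mul_comm]
    congr 1
    simp only [pow_add, Finset.prod_mul_distrib, pow_ite, pow_one, pow_zero,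
      Finset.prod_ite_eq', Finset.mem_univ, if_true]
  rw [he]
  constructor
  · exact Integrable.fintype_prod (f := fun k v =>
      ‖v‖ ^ ((if k = i then 1 else 0) + if k = j then 1 else 0) * Real.exp (-‖v‖ ^ 2))
      fun k => integrable_norm_pow_mul_exp_neg_sq_norm μ _
  · rw [integral_fintype_prod_eq_prod (𝕜 := ℝ) (μ := fun _ : ι => μ)
      (fun k v => ‖v‖ ^ ((if k = i then 1 else 0) + if k = j then 1 else 0) *
        Real.exp (-‖v‖ ^ 2))]
    have key : ∀ k, ∫ v : E, ‖v‖ ^ ((if k = i then 1 else 0) + if k = j then 1 else 0) *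
        Real.exp (-‖v‖ ^ 2) ∂μ = (if i = j then (if k = i then (Module.finrank ℂ E : ℝ) else 1)
          else (if k = i then (∫ v, ‖v‖ * Real.exp (-‖v‖ ^ 2) ∂μ) /
              ∫ v, Real.exp (-‖v‖ ^ 2) ∂μ else 1) *
            (if k = j then (∫ v, ‖v‖ * Real.exp (-‖v‖ ^ 2) ∂μ) /
              ∫ v, Real.exp (-‖v‖ ^ 2) ∂μ else 1)) * ∫ v, Real.exp (-‖v‖ ^ 2) ∂μ := by
      intro k
      by_cases hij : i = j
      · subst hij
        by_cases hk : k = i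
        · simp [hk, integral_sq_norm_mul_exp_neg_sq_norm μ]
        · simp [hk]
      · by_cases hk : k = i
        · subst hk
          simp [hij, div_mul_cancel₀ _ hZ.ne']
        · by_cases hk' : k = j
          · subst hk'
            simp [hk, hij, div_mul_cancel₀ _ hZ.ne']
          · simp [hk, hk', hij]
    simp only [key]
    rw [Finset.prod_mul_distrib, Finset.prod_const, Finset.card_univ]
    congr 1
    by_cases hij : i = j
    · simp [hij]
    · simp only [hij, if_false, Finset.prod_mul_distrib, Finset.prod_ite_eq', Finset.mem_univ,
        if_true, radialConst]
      rw [sq]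

theorem ofReal_integral_le_lintegral {α : Type*} [MeasurableSpace α] {m : Measure α} {f : α → ℝ}
    (hf : Integrable f m) : ENNReal.ofReal (∫ x, f x ∂m) ≤ ∫⁻ x, ENNReal.ofReal (f x) ∂m := by
  rw [integral_eq_lintegral_pos_part_sub_lintegral_neg_part hf]
  refine ENNReal.ofReal_le_of_le_toReal ?_
  exact sub_le_self _ ENNReal.toReal_nonneg

/-- Jensen's inequality for the Gaussian weight and a quadratic form in the radii. -/
theorem le_lintegral_exp_neg_radial_form (b : ι → ι → ℝ) :
    ENNReal.ofReal ((∫ v, Real.exp (-‖v‖ ^ 2) ∂μ) ^ Fintype.card ι *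
        Real.exp (∑ i, ∑ j, ((if i = j then 1 else 0) - b i j) *
          (if i = j then (Module.finrank ℂ E : ℝ) else radialConst μ))) ≤
      ∫⁻ g : ι → E, ENNReal.ofReal (Real.exp (-∑ i, ∑ j, b i j * (‖g i‖ * ‖g j‖)))
        ∂(Measure.pi fun _ => μ) := by
  set Z := ∫ v, Real.exp (-‖v‖ ^ 2) ∂μ with hZdef
  set a := ∑ i, ∑ j, ((if i = j then 1 else 0) - b i j) *
          (if i = j then (Module.finrank ℂ E : ℝ) else radialConst μ) with ha
  let W : (ι → E) → ℝ := fun g => ∏ k, Real.exp (-‖g k‖ ^ 2)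
  let q : (ι → E) → ℝ := fun g => ∑ i, ∑ j, ((if i = j then 1 else 0) - b i j) *
    (‖g i‖ * ‖g j‖)
  have hW : Integrable W (Measure.pi fun _ => μ) :=
    Integrable.fintype_prod (f := fun _ v => Real.exp (-‖v‖ ^ 2))
      fun k => by simpa using integrable_norm_pow_mul_exp_neg_sq_norm μ 0
  have hWi : ∫ g, W g ∂(Measure.pi fun _ => μ) = Z ^ Fintype.card ι := by
    have := integral_fintype_prod_eq_prod (𝕜 := ℝ) (μ := fun _ : ι => μ)
      (fun _ v => Real.exp (-‖v‖ ^ 2))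
    simpa [W] using this
  have hWq : (fun g => W g * q g) = fun g => ∑ i, ∑ j, ((if i = j then 1 else 0) - b i j) *
      ((∏ k, Real.exp (-‖g k‖ ^ 2)) * (‖g i‖ * ‖g j‖)) := by
    ext g
    simp only [W, q, Finset.mul_sum]
    exact Finset.sum_congr rfl fun i _ => Finset.sum_congr rfl fun j _ => by ring
  have h_int : Integrable (fun g => W g * q g) (Measure.pi fun _ => μ) := by
    rw [hWq]
    exact integrable_finsetSum _ fun i _ => integrable_finsetSum _ fun j _ =>
      (integral_prod_exp_mul_norm_mul_norm μ i j).1.const_mul _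
  have hval : ∫ g, W g * q g ∂(Measure.pi fun _ => μ) = a * Z ^ Fintype.card ι := by
    rw [hWq, integral_finsetSum _ fun i _ => integrable_finsetSum _ fun j _ =>
      (integral_prod_exp_mul_norm_mul_norm μ i j).1.const_mul _]
    rw [ha, Finset.sum_mul]
    refine Finset.sum_congr rfl fun i _ => ?_
    rw [integral_finsetSum _ fun j _ =>
      (integral_prod_exp_mul_norm_mul_norm μ i j).1.const_mul _, Finset.sum_mul]
    refine Finset.sum_congr rfl fun j _ => ?_
    rw [integral_const_mul, (integral_prod_exp_mul_norm_mul_norm μ i j).2, mul_assoc]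
  let T : (ι → E) → ℝ := fun g => Real.exp a * ((1 - a) * W g + W g * q g)
  have hT : Integrable T (Measure.pi fun _ => μ) := ((hW.const_mul _).add h_int).const_mul _
  have hTv : ∫ g, T g ∂(Measure.pi fun _ => μ) = Z ^ Fintype.card ι * Real.exp a := by
    simp only [T]
    rw [integral_const_mul, integral_add (hW.const_mul _) h_int, integral_const_mul, hWi, hval]
    ring
  rw [← hTv]
  refine (ofReal_integral_le_lintegral hT).trans (lintegral_mono fun g => ?_)
  refine ENNReal.ofReal_le_ofReal ?_
  have hWexp : W g = Real.exp (-∑ i, ‖g i‖ ^ 2) := by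
    simp only [W, ← Real.exp_sum, Finset.sum_neg_distrib]
  have hq : q g = ∑ i, ‖g i‖ ^ 2 - ∑ i, ∑ j, b i j * (‖g i‖ * ‖g j‖) := by
    simp only [q, sub_mul, Finset.sum_sub_distrib, ite_mul, one_mul, zero_mul,
      Finset.sum_ite_eq, Finset.mem_univ, if_true, sq]
  have hrhs : Real.exp (-∑ i, ∑ j, b i j * (‖g i‖ * ‖g j‖)) =
      W g * Real.exp a * Real.exp (q g - a) := by
    rw [hWexp, hq, ← Real.exp_add, ← Real.exp_add]; congr 1; ring
  rw [hrhs]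
  have h1 := Real.add_one_le_exp (q g - a)
  have h2 : 0 ≤ W g * Real.exp a := by rw [hWexp]; positivity
  calc T g = W g * Real.exp a * (q g - a + 1) := by simp only [T]; ring
    _ ≤ _ := mul_le_mul_of_nonneg_left h1 h2

end GaussianMoments

section HaarAverage

open MeasureTheory

variable {ι E : Type*} [Fintype ι] [NormedAddCommGroup E] [InnerProductSpace ℂ E]
  [FiniteDimensional ℂ E] [MeasurableSpace E] [BorelSpace E]
  (μ : Measure E) [μ.IsAddHaarMeasure]
  [MeasurableSpace (ι → unitary (E →L[ℂ] E))] [BorelSpace (ι → unitary (E →L[ℂ] E))]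
  (ν : Measure (ι → unitary (E →L[ℂ] E))) [IsProbabilityMeasure ν] [ν.IsMulRightInvariant]

/-- Integrating a function of a Gaussian tuple is the same as integrating over the radii and
over independent Haar rotations of one fixed unit vector. -/
theorem lintegral_eq_lintegral_lintegral_unitary {F : (ι → E) → ENNReal} (hF : Continuous F)
    {φ : E} (hφ : ‖φ‖ = 1) :
    ∫⁻ g, F g ∂(Measure.pi fun _ => μ) = ∫⁻ U : ι → unitary (E →L[ℂ] E),
      ∫⁻ g : ι → E, F (fun i => (‖g i‖ : ℂ) • (U i : E →L[ℂ] E) φ) ∂(Measure.pi fun _ => μ) ∂ν := by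
  have h1 : ∀ U : ι → unitary (E →L[ℂ] E), ∫⁻ g : ι → E, F (fun i => (U i : E →L[ℂ] E) (g i))
      ∂(Measure.pi fun _ => μ) = ∫⁻ g, F g ∂(Measure.pi fun _ => μ) := fun U =>
    (measurePreserving_pi (fun _ => μ) (fun _ => μ)
      fun i => measurePreserving_unitary μ (U i)).lintegral_comp hF.measurable
  have hc1 : Continuous fun p : (ι → unitary (E →L[ℂ] E)) × (ι → E) =>
      F (fun i => (p.1 i : E →L[ℂ] E) (p.2 i)) :=
    hF.comp (continuous_pi fun i => by fun_prop)
  have hc2 : Continuous fun p : (ι → unitary (E →L[ℂ] E)) × (ι → E) =>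
      F (fun i => (‖p.2 i‖ : ℂ) • (p.1 i : E →L[ℂ] E) φ) :=
    hF.comp (continuous_pi fun i => by fun_prop)
  calc ∫⁻ g, F g ∂(Measure.pi fun _ => μ)
      = ∫⁻ U : ι → unitary (E →L[ℂ] E), ∫⁻ g : ι → E, F (fun i => (U i : E →L[ℂ] E) (g i))
          ∂(Measure.pi fun _ => μ) ∂ν := by simp [h1]
    _ = ∫⁻ g : ι → E, ∫⁻ U : ι → unitary (E →L[ℂ] E), F (fun i => (U i : E →L[ℂ] E) (g i)) ∂ν
          ∂(Measure.pi fun _ => μ) := lintegral_lintegral_swap hc1.measurable.aemeasurable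
    _ = ∫⁻ g : ι → E, ∫⁻ U : ι → unitary (E →L[ℂ] E),
          F (fun i => (‖g i‖ : ℂ) • (U i : E →L[ℂ] E) φ) ∂ν ∂(Measure.pi fun _ => μ) := by
        refine lintegral_congr fun g => ?_
        have hW : ∀ i, ∃ W : unitary (E →L[ℂ] E), (‖g i‖ : ℂ) • (W : E →L[ℂ] E) φ = g i := by
          intro i
          by_cases hg : g i = 0
          · exact ⟨1, by simp [hg]⟩
          · obtain ⟨W, hW⟩ := exists_unitary_apply_eq (u := φ) (v := (‖g i‖ : ℂ)⁻¹ • g i) hφ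
              (by simp [norm_smul, inv_mul_cancel₀ (norm_ne_zero_iff.2 hg)])
            refine ⟨W, ?_⟩
            rw [hW, smul_smul, mul_inv_cancel₀ (by simpa using hg), one_smul]
        choose W hW using hW
        rw [← lintegral_mul_right_eq_self
          (fun U : ι → unitary (E →L[ℂ] E) => F (fun i => (‖g i‖ : ℂ) • (U i : E →L[ℂ] E) φ)) W]
        refine lintegral_congr fun U => congrArg F (funext fun i => ?_)
        conv_lhs => rw [← hW i]
        simp
    _ = _ := (lintegral_lintegral_swap hc2.measurable.aemeasurable).symm

variable [DecidableEq ι] [Nontrivial E]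

theorem one_le_inv_mul_exp {q : ℝ} (hq : 0 < q) : 1 ≤ q⁻¹ * Real.exp (q - 1) := by
  rw [inv_mul_eq_div, one_le_div hq]
  linarith [Real.add_one_le_exp (q - 1)]

variable {Q : Matrix ι ι ℂ}

theorem Matrix.IsHermitian.sum_re_diag_eq (hQ : Q.IsHermitian) :
    ∑ i, (Q i i).re = ∑ k, hQ.eigenvalues k := by
  have h := congrArg Complex.re hQ.trace_eq_sum_eigenvalues
  simpa [Matrix.trace] using h

theorem lintegral_exp_gramForm_unit_le (hQ : Q.IsHermitian) (hpos : ∀ k, 0 < hQ.eigenvalues k)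
    {φ : E} (hφ : ‖φ‖ = 1) :
    ∫⁻ U : ι → unitary (E →L[ℂ] E), ENNReal.ofReal (Real.exp (radialConst μ *
        gramForm (Matrix.diagonal (fun i => Q i i) - Q) fun i => (U i : E →L[ℂ] E) φ)) ∂ν ≤
      ENNReal.ofReal ((∏ k, ((hQ.eigenvalues k)⁻¹ * Real.exp (hQ.eigenvalues k - 1))) ^
        Module.finrank ℂ E) := by
  set n := Module.finrank ℂ E with hn
  set Z := ∫ v, Real.exp (-‖v‖ ^ 2) ∂μ with hZdef
  have hZ : 0 < Z := integral_exp_neg_sq_norm_pos μ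
  have hF : Continuous fun g : ι → E => ENNReal.ofReal (Real.exp (-gramForm Q g)) :=
    ENNReal.continuous_ofReal.comp (Real.continuous_exp.comp (continuous_gramForm Q).neg)
  obtain ⟨h_int, hval⟩ := integral_exp_neg_gramForm (E := E) μ hQ hpos
  have hK := lintegral_eq_lintegral_lintegral_unitary μ ν hF hφ
  rw [← ofReal_integral_eq_lintegral_ofReal h_int
    (Filter.Eventually.of_forall fun g => (Real.exp_pos _).le), hval] at hK
  have hexp : ∀ U : ι → unitary (E →L[ℂ] E),
      ∑ i, ∑ j, ((if i = j then 1 else 0) - (Q i j * inner ℂ ((U j : E →L[ℂ] E) φ)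
        ((U i : E →L[ℂ] E) φ)).re) * (if i = j then (n : ℝ) else radialConst μ) =
      n * ∑ k, (1 - hQ.eigenvalues k) + radialConst μ *
        gramForm (Matrix.diagonal (fun i => Q i i) - Q) fun i => (U i : E →L[ℂ] E) φ := by
    intro U
    have hd : ∀ i, (Q i i * inner ℂ ((U i : E →L[ℂ] E) φ) ((U i : E →L[ℂ] E) φ)).re =
        (Q i i).re := by
      intro i
      rw [unitary_inner_map_map, inner_self_eq_norm_sq_to_K, hφ]
      simp
    have e1 : gramForm (Matrix.diagonal (fun i => Q i i) - Q) (fun i => (U i : E →L[ℂ] E) φ) =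
        ∑ i, ∑ j, (if i = j then 0 else -(Q i j * inner ℂ ((U j : E →L[ℂ] E) φ)
        ((U i : E →L[ℂ] E) φ)).re) := by
      rw [gramForm_eq_sum]
      refine Finset.sum_congr rfl fun i _ => Finset.sum_congr rfl fun j _ => ?_
      by_cases hij : i = j
      · subst hij; simp
      · simp [hij]
    rw [e1, Finset.sum_sub_distrib, ← hQ.sum_re_diag_eq, ← Finset.sum_sub_distrib,
      Finset.mul_sum, Finset.mul_sum, ← Finset.sum_add_distrib]
    refine Finset.sum_congr rfl fun i _ => ?_
    have e2 : (n : ℝ) * (1 - (Q i i).re) =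
        ∑ j, if i = j then (n : ℝ) * (1 - (Q i j).re) else 0 := by simp
    rw [e2, Finset.mul_sum, ← Finset.sum_add_distrib]
    refine Finset.sum_congr rfl fun j _ => ?_
    by_cases hij : i = j
    · subst hij; rw [hd]; simp; ring
    · simp [hij]; ring
  have hlow : ∀ U : ι → unitary (E →L[ℂ] E), ENNReal.ofReal (Z ^ Fintype.card ι *
        Real.exp (n * ∑ k, (1 - hQ.eigenvalues k))) * ENNReal.ofReal (Real.exp (radialConst μ *
        gramForm (Matrix.diagonal (fun i => Q i i) - Q) fun i => (U i : E →L[ℂ] E) φ)) ≤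
      ∫⁻ g : ι → E, ENNReal.ofReal (Real.exp (-gramForm Q fun i =>
        (‖g i‖ : ℂ) • (U i : E →L[ℂ] E) φ)) ∂(Measure.pi fun _ => μ) := by
    intro U
    have h := le_lintegral_exp_neg_radial_form (ι := ι) μ fun i j =>
      (Q i j * inner ℂ ((U j : E →L[ℂ] E) φ) ((U i : E →L[ℂ] E) φ)).re
    rw [hexp, Real.exp_add, ← mul_assoc, ENNReal.ofReal_mul (by positivity)] at h
    refine h.trans_eq (lintegral_congr fun g => ?_)
    rw [gramForm_smul]
  have h2 := lintegral_mono (μ := ν) hlow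
  rw [← hK, lintegral_const_mul' _ _ ENNReal.ofReal_ne_top] at h2
  have hA : 0 < Z ^ Fintype.card ι * Real.exp (n * ∑ k, (1 - hQ.eigenvalues k)) := by positivity
  have h3 : (∏ k, (hQ.eigenvalues k)⁻¹) ^ n * Z ^ Fintype.card ι =
      Z ^ Fintype.card ι * Real.exp (n * ∑ k, (1 - hQ.eigenvalues k)) *
        (∏ k, ((hQ.eigenvalues k)⁻¹ * Real.exp (hQ.eigenvalues k - 1))) ^ n := by
    rw [Finset.prod_mul_distrib, mul_pow, ← Real.exp_sum, ← Real.exp_nat_mul]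
    have : Real.exp (n * ∑ k, (1 - hQ.eigenvalues k)) *
        Real.exp (n * ∑ k, (hQ.eigenvalues k - 1)) = 1 := by
      rw [← Real.exp_add, ← mul_add, ← Finset.sum_add_distrib]; simp
    linear_combination (-(∏ k, (hQ.eigenvalues k)⁻¹) ^ n * Z ^ Fintype.card ι) * this
  rw [h3, ENNReal.ofReal_mul hA.le] at h2
  exact (ENNReal.mul_le_mul_iff_right (by simpa using hA) ENNReal.ofReal_ne_top).1 h2

theorem lintegral_exp_gramForm_le (hQ : Q.IsHermitian) (hpos : ∀ k, 0 < hQ.eigenvalues k)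
    {φ : E} (hφ : ‖φ‖ ≤ 1) :
    ∫⁻ U : ι → unitary (E →L[ℂ] E), ENNReal.ofReal (Real.exp (radialConst μ *
        gramForm (Matrix.diagonal (fun i => Q i i) - Q) fun i => (U i : E →L[ℂ] E) φ)) ∂ν ≤
      ENNReal.ofReal ((∏ k, ((hQ.eigenvalues k)⁻¹ * Real.exp (hQ.eigenvalues k - 1))) ^
        Module.finrank ℂ E) := by
  obtain ⟨u, hu, hφu⟩ : ∃ u : E, ‖u‖ = 1 ∧ φ = (‖φ‖ : ℂ) • u := by
    by_cases h0 : φ = 0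
    · obtain ⟨u, hu⟩ := exists_norm_eq E zero_le_one
      exact ⟨u, hu, by simp [h0]⟩
    · refine ⟨(‖φ‖ : ℂ)⁻¹ • φ, ?_, ?_⟩
      · simp [norm_smul, inv_mul_cancel₀ (norm_ne_zero_iff.2 h0)]
      · rw [smul_smul, mul_inv_cancel₀ (by simpa using h0), one_smul]
  set M := (∏ k, ((hQ.eigenvalues k)⁻¹ * Real.exp (hQ.eigenvalues k - 1))) ^ Module.finrank ℂ E
  have hM : 1 ≤ M := by
    refine one_le_pow₀ ?_
    simpa using Finset.prod_le_prod (s := Finset.univ) (f := fun _ => (1 : ℝ))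
      (fun _ _ => zero_le_one) fun k _ => one_le_inv_mul_exp (hpos k)
  set s := ‖φ‖ ^ 2
  have hs0 : 0 ≤ s := sq_nonneg _
  have hs1 : s ≤ 1 := pow_le_one₀ (norm_nonneg _) hφ
  have hpt : ∀ U : ι → unitary (E →L[ℂ] E), ENNReal.ofReal (Real.exp (radialConst μ *
        gramForm (Matrix.diagonal (fun i => Q i i) - Q) fun i => (U i : E →L[ℂ] E) φ)) ≤
      ENNReal.ofReal (1 - s) + ENNReal.ofReal s * ENNReal.ofReal (Real.exp (radialConst μ *
        gramForm (Matrix.diagonal (fun i => Q i i) - Q) fun i => (U i : E →L[ℂ] E) u)) := by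
    intro U
    rw [← ENNReal.ofReal_mul hs0, ← ENNReal.ofReal_add (by linarith) (by positivity)]
    refine ENNReal.ofReal_le_ofReal ?_
    have h := gramForm_smul (Matrix.diagonal (fun i => Q i i) - Q) (fun _ => ‖φ‖)
      fun i => (U i : E →L[ℂ] E) u
    simp only [← map_smul, ← hφu, ← Finset.sum_mul, ← gramForm_eq_sum] at h
    rw [h, show radialConst μ * (gramForm (Matrix.diagonal (fun i => Q i i) - Q)
      (fun i => (U i : E →L[ℂ] E) u) * (‖φ‖ * ‖φ‖)) = (1 - s) • 0 + s • (radialConst μ *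
        gramForm (Matrix.diagonal (fun i => Q i i) - Q) fun i => (U i : E →L[ℂ] E) u) by
      simp only [smul_eq_mul, s]; ring]
    refine (convexOn_exp.2 trivial trivial (by linarith) hs0 (by ring)).trans_eq ?_
    simp
  refine (lintegral_mono hpt).trans ?_
  rw [lintegral_add_left measurable_const, lintegral_const, measure_univ, mul_one,
    lintegral_const_mul' _ _ ENNReal.ofReal_ne_top]
  refine (add_le_add le_rfl (mul_le_mul_right
    (lintegral_exp_gramForm_unit_le μ ν hQ hpos hu) _)).trans ?_
  rw [← ENNReal.ofReal_mul hs0, ← ENNReal.ofReal_add (by linarith) (by positivity)]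
  refine ENNReal.ofReal_le_ofReal ?_
  nlinarith

end HaarAverage

section BallAverage

open MeasureTheory

variable {E : Type*} [NormedAddCommGroup E] [InnerProductSpace ℂ E]
  [FiniteDimensional ℂ E] [MeasurableSpace E] [BorelSpace E]
  (μ : Measure E) [μ.IsAddHaarMeasure]

theorem measurePreserving_unitary_restrict_closedBall (u : unitary (E →L[ℂ] E)) :
    MeasurePreserving (fun x => (u : E →L[ℂ] E) x) (μ.restrict (Metric.closedBall 0 1))
      (μ.restrict (Metric.closedBall 0 1)) := by
  have h := (measurePreserving_unitary μ u).restrict_preimage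
    (Metric.isClosed_closedBall (x := (0 : E)) (ε := 1)).measurableSet
  have e : (fun x => (u : E →L[ℂ] E) x) ⁻¹' Metric.closedBall 0 1 = Metric.closedBall 0 1 := by
    ext x; simp [unitary_norm_map]
  rwa [e] at h

theorem Continuous.integrable_restrict_closedBall {f : E → ℝ} (hf : Continuous f) :
    Integrable f (μ.restrict (Metric.closedBall 0 1)) :=
  have : ProperSpace E := FiniteDimensional.proper ℂ E
  hf.continuousOn.integrableOn_compact (isCompact_closedBall _ _)

theorem integral_closedBall_comp_unitary (u : unitary (E →L[ℂ] E)) {f : E → ℝ}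
    (hf : Continuous f) :
    ∫ x in Metric.closedBall 0 1, f ((u : E →L[ℂ] E) x) ∂μ =
      ∫ x in Metric.closedBall 0 1, f x ∂μ := by
  have h := measurePreserving_unitary_restrict_closedBall μ u
  conv_rhs => rw [← h.map_eq]
  rw [integral_map h.measurable.aemeasurable hf.aestronglyMeasurable]

theorem integral_closedBall_sq_norm_inner_le {u : E} (hu : ‖u‖ = 1) :
    ∫ x in Metric.closedBall 0 1, ‖inner ℂ u x‖ ^ 2 ∂μ ≤
      μ.real (Metric.closedBall 0 1) / Module.finrank ℂ E := by
  have : Nontrivial E := ⟨u, 0, by rintro rfl; simp at hu⟩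
  have hn : (0 : ℝ) < Module.finrank ℂ E := by exact_mod_cast Module.finrank_pos
  let b := stdOrthonormalBasis ℂ E
  have hk : ∀ k, ∫ x in Metric.closedBall 0 1, ‖inner ℂ (b k) x‖ ^ 2 ∂μ =
      ∫ x in Metric.closedBall 0 1, ‖inner ℂ u x‖ ^ 2 ∂μ := by
    intro k
    obtain ⟨W, hW⟩ := exists_unitary_apply_eq (b.norm_eq_one k) hu
    rw [← integral_closedBall_comp_unitary μ W (f := fun x => ‖inner ℂ u x‖ ^ 2) (by fun_prop)]
    simp only [← hW, unitary_inner_map_map]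
  have hs : ∑ k, ∫ x in Metric.closedBall 0 1, ‖inner ℂ (b k) x‖ ^ 2 ∂μ =
      ∫ x in Metric.closedBall 0 1, ‖x‖ ^ 2 ∂μ := by
    rw [← integral_finsetSum _ fun k _ =>
      Continuous.integrable_restrict_closedBall μ (by fun_prop)]
    simp only [b.sum_sq_norm_inner_right]
  have hle : ∫ x in Metric.closedBall 0 1, ‖x‖ ^ 2 ∂μ ≤ μ.real (Metric.closedBall 0 1) := by
    have h := setIntegral_mono_on (f := fun x : E => ‖x‖ ^ 2) (g := fun _ => (1 : ℝ))
      (μ := μ) (s := Metric.closedBall 0 1)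
      (Continuous.integrable_restrict_closedBall μ (by fun_prop))
      (Continuous.integrable_restrict_closedBall μ (by fun_prop))
      Metric.isClosed_closedBall.measurableSet
      (fun x hx => pow_le_one₀ (norm_nonneg _) (by simpa using hx))
    simpa using h
  rw [le_div_iff₀ hn]
  simp only [hk, Finset.sum_const, Finset.card_univ, Fintype.card_fin, nsmul_eq_mul] at hs
  linarith

theorem integral_closedBall_le_of_sq {f : E → ℝ} (hf : Continuous f) {a r : ℝ} (hr : 0 < r)
    (h : ∫ x in Metric.closedBall 0 1, f x ^ 2 ∂μ ≤ a * r * μ.real (Metric.closedBall 0 1)) :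
    ∫ x in Metric.closedBall 0 1, f x ∂μ ≤ (r + a) / 2 * μ.real (Metric.closedBall 0 1) := by
  have hI := Continuous.integrable_restrict_closedBall μ (f := fun x => f x ^ 2) (by fun_prop)
  have hmono : ∫ x in Metric.closedBall 0 1, f x ∂μ ≤
      ∫ x in Metric.closedBall 0 1, (r / 2 + (2 * r)⁻¹ * f x ^ 2) ∂μ := by
    refine integral_mono (Continuous.integrable_restrict_closedBall μ hf)
      (Continuous.integrable_restrict_closedBall μ (by fun_prop)) fun x => ?_
    have : r / 2 + (2 * r)⁻¹ * f x ^ 2 - f x = (2 * r)⁻¹ * (f x - r) ^ 2 := by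
      field_simp; ring
    have h2 : 0 ≤ (2 * r)⁻¹ * (f x - r) ^ 2 := by positivity
    show f x ≤ r / 2 + (2 * r)⁻¹ * f x ^ 2
    linarith
  refine hmono.trans ?_
  rw [integral_add (Continuous.integrable_restrict_closedBall μ continuous_const)
    (hI.const_mul _), integral_const_mul]
  have h3 := mul_le_mul_of_nonneg_left h (show (0 : ℝ) ≤ (2 * r)⁻¹ by positivity)
  have h4 : (2 * r)⁻¹ * (a * r * μ.real (Metric.closedBall 0 1)) =
    a / 2 * μ.real (Metric.closedBall 0 1) := by field_simp
  rw [h4] at h3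
  simp only [integral_const, smul_eq_mul, measureReal_restrict_apply_univ]
  linarith

theorem integral_closedBall_norm_inner_le {u : E} (hu : ‖u‖ = 1) (W : unitary (E →L[ℂ] E)) :
    ∫ x in Metric.closedBall 0 1, ‖inner ℂ u ((W : E →L[ℂ] E) x)‖ ∂μ ≤
      (√(Module.finrank ℂ E))⁻¹ * μ.real (Metric.closedBall 0 1) := by
  have : Nontrivial E := ⟨u, 0, by rintro rfl; simp at hu⟩
  have hn : (0 : ℝ) < Module.finrank ℂ E := by exact_mod_cast Module.finrank_pos
  rw [integral_closedBall_comp_unitary μ W (f := fun x => ‖inner ℂ u x‖) (by fun_prop)]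
  have hr : 0 < (√(Module.finrank ℂ E : ℝ))⁻¹ := by positivity
  have h := integral_closedBall_le_of_sq μ (f := fun x => ‖inner ℂ u x‖) (by fun_prop)
    (a := (√(Module.finrank ℂ E : ℝ))⁻¹) hr (by
      refine (integral_closedBall_sq_norm_inner_le μ hu).trans_eq ?_
      rw [← mul_inv, Real.mul_self_sqrt hn.le]; ring)
  refine h.trans_eq ?_
  ring

theorem le_lintegral_exp_of_le_integral {α : Type*} [MeasurableSpace α] {m : Measure α}
    [IsFiniteMeasure m] {h : α → ℝ} (hi : Integrable h m) {a : ℝ}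
    (ha : a * m.real Set.univ ≤ ∫ x, h x ∂m) :
    ENNReal.ofReal (m.real Set.univ * Real.exp a) ≤
      ∫⁻ x, ENNReal.ofReal (Real.exp (h x)) ∂m := by
  have hT : Integrable (fun x => Real.exp a * ((1 - a) + h x)) m :=
    ((integrable_const _).add hi).const_mul _
  have h1 : m.real Set.univ * Real.exp a ≤ ∫ x, Real.exp a * ((1 - a) + h x) ∂m := by
    rw [integral_const_mul, integral_add (integrable_const _) hi, integral_const, smul_eq_mul,
      mul_comm]
    refine mul_le_mul_of_nonneg_left ?_ (Real.exp_pos a).le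
    linarith
  refine (ENNReal.ofReal_le_ofReal h1).trans ((ofReal_integral_le_lintegral hT).trans
    (lintegral_mono fun x => ENNReal.ofReal_le_ofReal ?_))
  have h2 := mul_le_mul_of_nonneg_left (Real.add_one_le_exp (h x - a)) (Real.exp_pos a).le
  rw [← Real.exp_add] at h2
  calc _ = Real.exp a * (h x - a + 1) := by ring
    _ ≤ _ := h2
    _ = _ := by congr 1; ring

theorem lintegral_comp_smul_add (f : E → ENNReal) (hf : Measurable f) (ψ : E) :
    ∫⁻ η, f ((√2 : ℝ)⁻¹ • (ψ + η)) ∂μ = 2 ^ Module.finrank ℂ E * ∫⁻ φ, f φ ∂μ := by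
  rw [lintegral_add_left_eq_self (μ := μ) (fun η => f ((√2 : ℝ)⁻¹ • η)) ψ]
  have h := Measure.map_addHaar_smul μ (r := (√2 : ℝ)⁻¹) (by positivity)
  rw [← lintegral_map hf (measurable_const_smul _), h, lintegral_smul_measure]
  congr 1
  rw [finrank_real_of_complex, pow_mul, inv_pow, Real.sq_sqrt zero_le_two, inv_pow, inv_inv,
    abs_of_pos (by positivity), ENNReal.ofReal_pow zero_le_two]
  simp

end BallAverage

theorem gramForm_smul_add_ge {ι E : Type*} [Fintype ι] [NormedAddCommGroup E]
    [InnerProductSpace ℂ E] [FiniteDimensional ℂ E]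
    (Y : Matrix ι ι ℂ) (U : ι → unitary (E →L[ℂ] E)) (ψ η : E) :
    (gramForm Y (fun i => (U i : E →L[ℂ] E) ψ) - ∑ i, ∑ j, ‖Y i j‖ *
      (‖inner ℂ ((U j : E →L[ℂ] E) η) ((U i : E →L[ℂ] E) η)‖ +
        ‖inner ℂ ((U j : E →L[ℂ] E) ψ) ((U i : E →L[ℂ] E) η)‖ +
        ‖inner ℂ ((U i : E →L[ℂ] E) ψ) ((U j : E →L[ℂ] E) η)‖)) / 2 ≤
      gramForm Y (fun i => (U i : E →L[ℂ] E) ((√2 : ℝ)⁻¹ • (ψ + η))) := by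
  have h := gramForm_smul Y (fun _ => (√2 : ℝ)⁻¹) fun i => (U i : E →L[ℂ] E) (ψ + η)
  have e : ∀ i, (U i : E →L[ℂ] E) ((√2 : ℝ)⁻¹ • (ψ + η)) =
      (((√2 : ℝ)⁻¹ : ℝ) : ℂ) • (U i : E →L[ℂ] E) (ψ + η) := fun i => by
    rw [← map_smul]; rfl
  simp only [e]
  rw [h, gramForm_eq_sum, ← Finset.sum_sub_distrib, Finset.sum_div]
  refine Finset.sum_le_sum fun i _ => ?_
  rw [← Finset.sum_sub_distrib, Finset.sum_div]
  refine Finset.sum_le_sum fun j _ => ?_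
  rw [← mul_inv, Real.mul_self_sqrt zero_le_two, ← div_eq_mul_inv]
  refine div_le_div_of_nonneg_right ?_ zero_le_two
  set a := (U j : E →L[ℂ] E) ψ
  set b := (U j : E →L[ℂ] E) η with hb
  set a' := (U i : E →L[ℂ] E) ψ
  set b' := (U i : E →L[ℂ] E) η
  have e2 : Y i j * inner ℂ ((U j : E →L[ℂ] E) (ψ + η)) ((U i : E →L[ℂ] E) (ψ + η)) =
      Y i j * inner ℂ a a' + Y i j * (inner ℂ b b' + inner ℂ a b' + inner ℂ b a') := by
    rw [map_add, map_add, inner_add_left, inner_add_right, inner_add_right]; ring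
  rw [e2, Complex.add_re]
  have h3 : -(‖Y i j‖ * (‖inner ℂ b b'‖ + ‖inner ℂ a b'‖ + ‖inner ℂ a' b‖)) ≤
      (Y i j * (inner ℂ b b' + inner ℂ a b' + inner ℂ b a')).re := by
    refine (neg_le_neg ?_).trans (neg_le_of_abs_le (Complex.abs_re_le_norm _))
    rw [norm_mul, norm_inner_symm a' b]
    exact mul_le_mul_of_nonneg_left (norm_add₃_le) (norm_nonneg _)
  linarith

section BallLowerBound

open MeasureTheory

variable {ι E : Type*} [Fintype ι] [NormedAddCommGroup E] [InnerProductSpace ℂ E]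
  [FiniteDimensional ℂ E] [MeasurableSpace E] [BorelSpace E]
  (μ : Measure E) [μ.IsAddHaarMeasure]

theorem le_lintegral_closedBall_exp_gramForm (Y : Matrix ι ι ℂ) (U : ι → unitary (E →L[ℂ] E))
    {ψ : E} (hψ : ‖ψ‖ = 1) {c D : ℝ} (hc : 0 ≤ c)
    (hD : ∀ i j, Y i j ≠ 0 → ∫ η in Metric.closedBall 0 1,
      ‖inner ℂ ((U j : E →L[ℂ] E) η) ((U i : E →L[ℂ] E) η)‖ ∂μ ≤
        D * μ.real (Metric.closedBall 0 1)) :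
    ENNReal.ofReal (μ.real (Metric.closedBall (0 : E) 1) * Real.exp (c / 2 *
        (gramForm Y (fun i => (U i : E →L[ℂ] E) ψ) -
          (∑ i, ∑ j, ‖Y i j‖) * (D + 2 * (√(Module.finrank ℂ E))⁻¹)))) ≤
      2 * 2 ^ Module.finrank ℂ E * ∫⁻ φ in Metric.closedBall 0 1, ENNReal.ofReal (Real.exp (c *
        gramForm Y fun i => (U i : E →L[ℂ] E) φ)) ∂μ := by
  have : ProperSpace E := FiniteDimensional.proper ℂ E
  set r := (√(Module.finrank ℂ E : ℝ))⁻¹ with hr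
  set vol := μ.real (Metric.closedBall (0 : E) 1) with hvol
  let t : ι → ι → E → ℝ := fun i j η =>
    ‖inner ℂ ((U j : E →L[ℂ] E) η) ((U i : E →L[ℂ] E) η)‖ +
        ‖inner ℂ ((U j : E →L[ℂ] E) ψ) ((U i : E →L[ℂ] E) η)‖ +
        ‖inner ℂ ((U i : E →L[ℂ] E) ψ) ((U j : E →L[ℂ] E) η)‖
  let h : E → ℝ := fun η => c / 2 * (gramForm Y (fun i => (U i : E →L[ℂ] E) ψ) -
    ∑ i, ∑ j, ‖Y i j‖ * t i j η)
  have htc : ∀ i j, Continuous (t i j) := fun i j => by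
    simp only [t]; fun_prop
  have hti : ∀ i j, Integrable (t i j) (μ.restrict (Metric.closedBall 0 1)) := fun i j =>
    Continuous.integrable_restrict_closedBall μ (htc i j)
  have hhi : Integrable h (μ.restrict (Metric.closedBall 0 1)) :=
    Continuous.integrable_restrict_closedBall μ (by simp only [h]; fun_prop)
  have htb : ∀ i j, ‖Y i j‖ * ∫ η in Metric.closedBall 0 1, t i j η ∂μ ≤
      ‖Y i j‖ * ((D + 2 * r) * vol) := by
    intro i j
    by_cases hY : Y i j = 0
    · simp [hY]
    refine mul_le_mul_of_nonneg_left ?_ (norm_nonneg _)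
    have i1 := Continuous.integrable_restrict_closedBall μ
      (f := fun η => ‖inner ℂ ((U j : E →L[ℂ] E) η) ((U i : E →L[ℂ] E) η)‖) (by fun_prop)
    have i2 := Continuous.integrable_restrict_closedBall μ
      (f := fun η => ‖inner ℂ ((U j : E →L[ℂ] E) ψ) ((U i : E →L[ℂ] E) η)‖) (by fun_prop)
    have i3 := Continuous.integrable_restrict_closedBall μ
      (f := fun η => ‖inner ℂ ((U i : E →L[ℂ] E) ψ) ((U j : E →L[ℂ] E) η)‖) (by fun_prop)
    have i12 := Continuous.integrable_restrict_closedBall μ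
      (f := fun η => ‖inner ℂ ((U j : E →L[ℂ] E) η) ((U i : E →L[ℂ] E) η)‖ +
        ‖inner ℂ ((U j : E →L[ℂ] E) ψ) ((U i : E →L[ℂ] E) η)‖) (by fun_prop)
    simp only [t]
    rw [integral_add i12 i3, integral_add i1 i2]
    have b1 := hD i j hY
    have b2 := integral_closedBall_norm_inner_le μ
      (u := (U j : E →L[ℂ] E) ψ) (by rw [unitary_norm_map, hψ]) (U i)
    have b3 := integral_closedBall_norm_inner_le μ
      (u := (U i : E →L[ℂ] E) ψ) (by rw [unitary_norm_map, hψ]) (U j)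
    linarith
  have hfin : IsFiniteMeasure (μ.restrict (Metric.closedBall (0 : E) 1)) :=
    isFiniteMeasure_restrict.2 measure_closedBall_lt_top.ne
  have hJ := le_lintegral_exp_of_le_integral hhi (a := c / 2 *
        (gramForm Y (fun i => (U i : E →L[ℂ] E) ψ) - (∑ i, ∑ j, ‖Y i j‖) * (D + 2 * r))) (by
    simp only [h]
    rw [measureReal_restrict_apply_univ, ← hvol, integral_const_mul, integral_sub
      (integrable_const _) (integrable_finsetSum _ fun i _ => integrable_finsetSum _ fun j _ =>
        (hti i j).const_mul _), integral_finsetSum _ fun i _ => integrable_finsetSum _ fun j _ =>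
        (hti i j).const_mul _]
    simp only [integral_const, smul_eq_mul, measureReal_restrict_apply_univ, ← hvol]
    rw [mul_assoc]
    refine mul_le_mul_of_nonneg_left ?_ (by positivity)
    rw [sub_mul, mul_comm vol]
    refine sub_le_sub_left ?_ _
    rw [mul_assoc, Finset.sum_mul]
    refine Finset.sum_le_sum fun i _ => ?_
    rw [integral_finsetSum _ fun j _ => (hti i j).const_mul _, Finset.sum_mul]
    refine Finset.sum_le_sum fun j _ => ?_
    rw [integral_const_mul]
    exact htb i j)
  rw [measureReal_restrict_apply_univ] at hJ
  refine hJ.trans ?_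
  let F : E → ENNReal := fun φ => ENNReal.ofReal (Real.exp (c *
    gramForm Y fun i => (U i : E →L[ℂ] E) φ))
  have hF : Continuous F := ENNReal.continuous_ofReal.comp (Real.continuous_exp.comp
    (continuous_const.mul ((continuous_gramForm Y).comp (by fun_prop))))
  let f : E → ENNReal := (Metric.closedBall 0 1).indicator F
  have hf : Measurable f := hF.measurable.indicator Metric.isClosed_closedBall.measurableSet
  have hhalf : ∀ η ∈ Metric.closedBall (0 : E) 1, RCLike.re (inner ℂ ψ η) ≤ 0 →
      ENNReal.ofReal (Real.exp (h η)) ≤ f ((√2 : ℝ)⁻¹ • (ψ + η)) := by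
    intro η hη hre
    have hmem : (√2 : ℝ)⁻¹ • (ψ + η) ∈ Metric.closedBall (0 : E) 1 := by
      rw [mem_closedBall_zero_iff] at hη ⊢
      rw [norm_smul, Real.norm_eq_abs, abs_of_pos (by positivity), inv_mul_le_iff₀ (by positivity),
        mul_one]
      refine Real.le_sqrt_of_sq_le ?_
      rw [norm_add_sq (𝕜 := ℂ), hψ]
      have : ‖η‖ ^ 2 ≤ 1 := pow_le_one₀ (norm_nonneg _) hη
      linarith
    simp only [f]
    rw [Set.indicator_of_mem hmem]
    refine ENNReal.ofReal_le_ofReal (Real.exp_le_exp.2 ?_)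
    have h1 := mul_le_mul_of_nonneg_left (gramForm_smul_add_ge Y U ψ η) hc
    refine le_trans (le_of_eq ?_) h1
    simp only [h, t]; ring
  have hneg : ∀ η, h (-η) = h η := fun η => by simp [h, t]
  have hpt : ∀ η ∈ Metric.closedBall (0 : E) 1, ENNReal.ofReal (Real.exp (h η)) ≤
      f ((√2 : ℝ)⁻¹ • (ψ + η)) + f ((√2 : ℝ)⁻¹ • (ψ + -η)) := by
    intro η hη
    rcases le_total (RCLike.re (inner ℂ ψ η)) 0 with hre | hre
    · exact (hhalf η hη hre).trans le_self_add
    · have := hhalf (-η) (by simpa using hη) (by simpa using hre)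
      rw [hneg] at this
      exact this.trans le_add_self
  have hm1 : Measurable fun η => f ((√2 : ℝ)⁻¹ • (ψ + η)) := hf.comp (by fun_prop)
  have h_int : ∫⁻ φ, f φ ∂μ = ∫⁻ φ in Metric.closedBall 0 1, F φ ∂μ :=
    lintegral_indicator Metric.isClosed_closedBall.measurableSet _
  calc ∫⁻ η in Metric.closedBall 0 1, ENNReal.ofReal (Real.exp (h η)) ∂μ
      ≤ ∫⁻ η in Metric.closedBall 0 1,
          (f ((√2 : ℝ)⁻¹ • (ψ + η)) + f ((√2 : ℝ)⁻¹ • (ψ + -η))) ∂μ :=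
        setLIntegral_mono' Metric.isClosed_closedBall.measurableSet hpt
    _ ≤ ∫⁻ η, (f ((√2 : ℝ)⁻¹ • (ψ + η)) + f ((√2 : ℝ)⁻¹ • (ψ + -η))) ∂μ :=
        setLIntegral_le_lintegral _ _
    _ = _ := by
        rw [lintegral_add_left hm1, lintegral_comp_smul_add μ f hf,
          lintegral_neg_eq_self (μ := μ) (fun η => f ((√2 : ℝ)⁻¹ • (ψ + η))),
          lintegral_comp_smul_add μ f hf, h_int]
        ring

end BallLowerBound

section ChooseUnitaries

open MeasureTheory

variable {ι E : Type*} [DecidableEq ι] [NormedAddCommGroup E] [InnerProductSpace ℂ E]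
  [FiniteDimensional ℂ E]
  [MeasurableSpace (ι → unitary (E →L[ℂ] E))] [BorelSpace (ι → unitary (E →L[ℂ] E))]

theorem finrank_mul_lintegral_sq_norm_inner_le (ν : Measure (ι → unitary (E →L[ℂ] E)))
    [IsProbabilityMeasure ν] [ν.IsMulRightInvariant] {i j : ι} (hij : i ≠ j) {η : E}
    (hη : ‖η‖ ≤ 1) :
    (Module.finrank ℂ E : ENNReal) * ∫⁻ U : ι → unitary (E →L[ℂ] E), ENNReal.ofReal
      (‖inner ℂ ((U j : E →L[ℂ] E) η) ((U i : E →L[ℂ] E) η)‖ ^ 2) ∂ν ≤ 1 := by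
  by_cases h0 : η = 0
  · simp [h0]
  let b := stdOrthonormalBasis ℂ E
  have hη0 : (‖η‖ : ℂ) ≠ 0 := by simpa using h0
  have hk : ∀ k, ∫⁻ U : ι → unitary (E →L[ℂ] E), ENNReal.ofReal
          (‖inner ℂ ((U j : E →L[ℂ] E) ((‖η‖ : ℂ) • b k)) ((U i : E →L[ℂ] E) η)‖ ^ 2) ∂ν =
      ∫⁻ U : ι → unitary (E →L[ℂ] E), ENNReal.ofReal
      (‖inner ℂ ((U j : E →L[ℂ] E) η) ((U i : E →L[ℂ] E) η)‖ ^ 2) ∂ν := by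
    intro k
    obtain ⟨W, hW⟩ := exists_unitary_apply_eq (u := (‖η‖ : ℂ)⁻¹ • η) (v := b k)
      (by simp [norm_smul, inv_mul_cancel₀ (norm_ne_zero_iff.2 h0)]) (b.norm_eq_one k)
    have hW' : (W : E →L[ℂ] E) η = (‖η‖ : ℂ) • b k := by
      rw [← hW, map_smul, smul_smul, mul_inv_cancel₀ hη0, one_smul]
    rw [← lintegral_mul_right_eq_self (fun U : ι → unitary (E →L[ℂ] E) => ENNReal.ofReal
      (‖inner ℂ ((U j : E →L[ℂ] E) η) ((U i : E →L[ℂ] E) η)‖ ^ 2)) (Pi.mulSingle j W)]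
    refine lintegral_congr fun U => ?_
    simp [Pi.mulSingle_eq_of_ne hij, hW']
  calc (Module.finrank ℂ E : ENNReal) * ∫⁻ U : ι → unitary (E →L[ℂ] E), ENNReal.ofReal
          (‖inner ℂ ((U j : E →L[ℂ] E) η) ((U i : E →L[ℂ] E) η)‖ ^ 2) ∂ν
      = ∑ k, ∫⁻ U : ι → unitary (E →L[ℂ] E), ENNReal.ofReal
          (‖inner ℂ ((U j : E →L[ℂ] E) ((‖η‖ : ℂ) • b k)) ((U i : E →L[ℂ] E) η)‖ ^ 2) ∂ν := by
        simp only [hk, Finset.sum_const, Finset.card_univ, Fintype.card_fin, nsmul_eq_mul]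
    _ = ∫⁻ U : ι → unitary (E →L[ℂ] E), (∑ k, ENNReal.ofReal
          (‖inner ℂ ((U j : E →L[ℂ] E) ((‖η‖ : ℂ) • b k)) ((U i : E →L[ℂ] E) η)‖ ^ 2)) ∂ν := by
        refine (lintegral_finsetSum _ fun k _ => ?_).symm
        exact (ENNReal.continuous_ofReal.comp (by fun_prop)).measurable
    _ ≤ ∫⁻ _ : ι → unitary (E →L[ℂ] E), 1 ∂ν := by
        refine lintegral_mono fun U => ?_
        rw [← ENNReal.ofReal_sum_of_nonneg fun k _ => by positivity, ← ENNReal.ofReal_one]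
        refine ENNReal.ofReal_le_ofReal ?_
        have h1 : ∑ k, ‖inner ℂ ((U j : E →L[ℂ] E) (b k)) ((U i : E →L[ℂ] E) η)‖ ^ 2 =
            ‖η‖ ^ 2 := by
          rw [← unitary_norm_map (U i) η]
          exact (b.map (Unitary.linearIsometryEquiv (U j))).sum_sq_norm_inner_right _
        simp only [map_smul, inner_smul_left, norm_mul, mul_pow, ← Finset.mul_sum, h1]
        have h2 : ‖η‖ ^ 2 ≤ 1 := pow_le_one₀ (norm_nonneg _) hη
        simp only [RCLike.norm_conj, Complex.norm_real, norm_norm]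
        nlinarith [sq_nonneg ‖η‖]
    _ = 1 := by simp

variable [Fintype ι] [MeasurableSpace E] [BorelSpace E] (μ : Measure E) [μ.IsAddHaarMeasure]

theorem finrank_mul_lintegral_closedBall_sq_norm_inner_le
    (ν : Measure (ι → unitary (E →L[ℂ] E)))
    [IsProbabilityMeasure ν] [ν.IsMulRightInvariant] {i j : ι} (hij : i ≠ j) :
    ∫⁻ U : ι → unitary (E →L[ℂ] E), Module.finrank ℂ E *
      ∫⁻ η in Metric.closedBall 0 1, ENNReal.ofReal
      (‖inner ℂ ((U j : E →L[ℂ] E) η) ((U i : E →L[ℂ] E) η)‖ ^ 2) ∂μ ∂ν ≤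
      μ (Metric.closedBall 0 1) := by
  have hc : Continuous fun p : (ι → unitary (E →L[ℂ] E)) × E => ENNReal.ofReal
      (‖inner ℂ ((p.1 j : E →L[ℂ] E) p.2) ((p.1 i : E →L[ℂ] E) p.2)‖ ^ 2) :=
    ENNReal.continuous_ofReal.comp (by fun_prop)
  rw [lintegral_const_mul' _ _ (ENNReal.natCast_ne_top _), lintegral_lintegral_swap
    hc.measurable.aemeasurable, ← lintegral_const_mul' _ _
      (ENNReal.natCast_ne_top _)]
  refine (setLIntegral_mono' Metric.isClosed_closedBall.measurableSet fun η hη =>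
    finrank_mul_lintegral_sq_norm_inner_le ν hij (by simpa using hη)).trans ?_
  simp

variable [Nontrivial E]

theorem lintegral_closedBall_exp_gramForm_le (ν : Measure (ι → unitary (E →L[ℂ] E)))
    [IsProbabilityMeasure ν] [ν.IsMulRightInvariant] {Q : Matrix ι ι ℂ} (hQ : Q.IsHermitian)
    (hpos : ∀ k, 0 < hQ.eigenvalues k) :
    ∫⁻ U : ι → unitary (E →L[ℂ] E), ∫⁻ φ in Metric.closedBall 0 1,
      ENNReal.ofReal (Real.exp (radialConst μ *
        gramForm (Matrix.diagonal (fun i => Q i i) - Q) fun i => (U i : E →L[ℂ] E) φ)) ∂μ ∂ν ≤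
      ENNReal.ofReal ((∏ k, ((hQ.eigenvalues k)⁻¹ * Real.exp (hQ.eigenvalues k - 1))) ^
        Module.finrank ℂ E) * μ (Metric.closedBall 0 1) := by
  have hc : Continuous fun p : (ι → unitary (E →L[ℂ] E)) × E =>
      ENNReal.ofReal (Real.exp (radialConst μ *
        gramForm (Matrix.diagonal (fun i => Q i i) - Q) fun i => (p.1 i : E →L[ℂ] E) p.2)) :=
    ENNReal.continuous_ofReal.comp (Real.continuous_exp.comp
      (continuous_const.mul ((continuous_gramForm _).comp (by fun_prop))))
  rw [lintegral_lintegral_swap hc.measurable.aemeasurable]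
  refine (setLIntegral_mono' Metric.isClosed_closedBall.measurableSet fun φ hφ =>
    lintegral_exp_gramForm_le μ ν hQ hpos (by simpa using hφ)).trans ?_
  simp

theorem exists_unitaries_forall_exp_gramForm_le [Nonempty ι] {κ : Type*} [Fintype κ]
    (Q : κ → Matrix ι ι ℂ)
    (hQ : ∀ a, (Q a).IsHermitian) (hpos : ∀ a k, 0 < (hQ a).eigenvalues k) :
    ∃ U : ι → unitary (E →L[ℂ] E), ∀ a, ∀ ψ : E, ‖ψ‖ = 1 →
      Real.exp (radialConst μ / 2 *
        (gramForm (Matrix.diagonal (fun i => Q a i i) - Q a) (fun i => (U i : E →L[ℂ] E) ψ) -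
          (∑ i, ∑ j, ‖(Matrix.diagonal (fun i => Q a i i) - Q a) i j‖) *
            (((1 + (Fintype.card κ + Fintype.card ι ^ 2)) / 2 + 2) *
              (√(Module.finrank ℂ E))⁻¹))) ≤
      2 * 2 ^ Module.finrank ℂ E * (∏ k, (((hQ a).eigenvalues k)⁻¹ *
        Real.exp ((hQ a).eigenvalues k - 1))) ^ Module.finrank ℂ E *
          (Fintype.card κ + Fintype.card ι ^ 2) := by
  obtain ⟨ν, hν, hν'⟩ := exists_isMulRightInvariant_isProbabilityMeasure
    (ι → unitary (E →L[ℂ] E))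
  have : ProperSpace E := FiniteDimensional.proper ℂ E
  have hn : (0 : ℝ) < Module.finrank ℂ E := by exact_mod_cast Module.finrank_pos
  set n := Module.finrank ℂ E with hndef
  set B := Metric.closedBall (0 : E) 1 with hB
  have hvol0 : μ B ≠ 0 := (Metric.measure_closedBall_pos μ _ one_pos).ne'
  have hvolt : μ B ≠ ⊤ := measure_closedBall_lt_top.ne
  have hvol : 0 < μ.real B := ENNReal.toReal_pos hvol0 hvolt
  have hofvol : ENNReal.ofReal (μ.real B) = μ B := ENNReal.ofReal_toReal hvolt
  let M : κ → ℝ := fun a =>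
    (∏ k, (((hQ a).eigenvalues k)⁻¹ * Real.exp ((hQ a).eigenvalues k - 1))) ^ n
  have hM : ∀ a, 0 < M a := fun a => pow_pos (Finset.prod_pos fun k _ =>
    mul_pos (inv_pos.2 (hpos a k)) (Real.exp_pos _)) _
  let J : κ → (ι → unitary (E →L[ℂ] E)) → ENNReal := fun a U => ∫⁻ φ in B,
      ENNReal.ofReal (Real.exp (radialConst μ *
        gramForm (Matrix.diagonal (fun i => Q a i i) - Q a) fun i => (U i : E →L[ℂ] E) φ)) ∂μ
  have hJm : ∀ a, Measurable (J a) := by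
    intro a
    have hc : Continuous fun p : (ι → unitary (E →L[ℂ] E)) × E =>
        ENNReal.ofReal (Real.exp (radialConst μ *
          gramForm (Matrix.diagonal (fun i => Q a i i) - Q a)
            fun i => (p.1 i : E →L[ℂ] E) p.2)) :=
      ENNReal.continuous_ofReal.comp (Real.continuous_exp.comp
        (continuous_const.mul ((continuous_gramForm _).comp (by fun_prop))))
    exact hc.measurable.lintegral_prod_right'
  let K : ι → ι → (ι → unitary (E →L[ℂ] E)) → ENNReal := fun i j U => if i = j then 0 else
    n * ∫⁻ η in B, ENNReal.ofReal
      (‖inner ℂ ((U j : E →L[ℂ] E) η) ((U i : E →L[ℂ] E) η)‖ ^ 2) ∂μ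
  have hKm : ∀ i j, Measurable (K i j) := by
    intro i j
    by_cases hij : i = j
    · simp only [K, hij, if_true]; exact measurable_const
    · simp only [K, hij, if_false]
      have hc : Continuous fun p : (ι → unitary (E →L[ℂ] E)) × E => ENNReal.ofReal
          (‖inner ℂ ((p.1 j : E →L[ℂ] E) p.2) ((p.1 i : E →L[ℂ] E) p.2)‖ ^ 2) :=
        ENNReal.continuous_ofReal.comp (by fun_prop)
      exact hc.measurable.lintegral_prod_right'.const_mul _
  have hKi : ∀ i j, ∫⁻ U, K i j U ∂ν ≤ μ B := by
    intro i j
    by_cases hij : i = j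
    · simp [K, hij]
    · simp only [K, hij, if_false]
      exact finrank_mul_lintegral_closedBall_sq_norm_inner_le μ ν hij
  have hJi : ∀ a, ∫⁻ U, (ENNReal.ofReal (M a))⁻¹ * J a U ∂ν ≤ μ B := by
    intro a
    have h0 : ENNReal.ofReal (M a) ≠ 0 := by simpa using hM a
    rw [lintegral_const_mul _ (hJm a)]
    refine (mul_le_mul_right (lintegral_closedBall_exp_gramForm_le μ ν (hQ a) (hpos a)) _).trans ?_
    rw [← mul_assoc, ENNReal.inv_mul_cancel h0 ENNReal.ofReal_ne_top, one_mul]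
  have hf1 : Measurable fun U => ∑ a, (ENNReal.ofReal (M a))⁻¹ * J a U :=
    Finset.measurable_fun_sum _ fun a _ => (hJm a).const_mul _
  have hf2 : Measurable fun U => ∑ i, ∑ j, K i j U :=
    Finset.measurable_fun_sum _ fun i _ => Finset.measurable_fun_sum _ fun j _ => hKm i j
  obtain ⟨U, hU⟩ := exists_le_lintegral (μ := ν)
    (f := fun U => ∑ a, (ENNReal.ofReal (M a))⁻¹ * J a U + ∑ i, ∑ j, K i j U)
    (hf1.add hf2).aemeasurable
  set R : ℝ := Fintype.card κ + Fintype.card ι ^ 2 with hR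
  have hR0 : 0 < R := by
    have : (0 : ℝ) < Fintype.card ι := by exact_mod_cast Fintype.card_pos
    positivity
  have hU' : ∑ a, (ENNReal.ofReal (M a))⁻¹ * J a U + ∑ i, ∑ j, K i j U ≤
      ENNReal.ofReal (R * μ.real B) := by
    refine hU.trans ?_
    rw [lintegral_add_left hf1, lintegral_finsetSum _ fun a _ => (hJm a).const_mul _,
      lintegral_finsetSum _ fun i _ => Finset.measurable_fun_sum _ fun j _ => hKm i j]
    simp only [lintegral_finsetSum _ fun j _ => hKm _ j]
    refine (add_le_add (Finset.sum_le_sum fun a _ => hJi a)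
      (Finset.sum_le_sum fun i _ => Finset.sum_le_sum fun j _ => hKi i j)).trans_eq ?_
    rw [ENNReal.ofReal_mul hR0.le, hofvol, hR, ENNReal.ofReal_add (by positivity) (by positivity),
      ENNReal.ofReal_natCast, ENNReal.ofReal_pow (by positivity), ENNReal.ofReal_natCast]
    simp only [Finset.sum_const, Finset.card_univ, nsmul_eq_mul]
    ring
  have hJU : ∀ a, J a U ≤ ENNReal.ofReal (M a * R * μ.real B) := by
    intro a
    have h0 : ENNReal.ofReal (M a) ≠ 0 := by simpa using hM a
    have h1 := (Finset.single_le_sum (f := fun a => (ENNReal.ofReal (M a))⁻¹ * J a U)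
      (fun _ _ => zero_le) (Finset.mem_univ a)).trans (le_self_add.trans hU')
    rw [mul_assoc, ENNReal.ofReal_mul (hM a).le]
    rwa [ENNReal.inv_mul_le_iff h0 ENNReal.ofReal_ne_top] at h1
  have hKU : ∀ i j, K i j U ≤ ENNReal.ofReal (R * μ.real B) := by
    intro i j
    exact (Finset.single_le_sum (f := fun j => K i j U) (fun _ _ => zero_le)
      (Finset.mem_univ j)).trans ((Finset.single_le_sum (f := fun i => ∑ j, K i j U)
        (fun _ _ => zero_le) (Finset.mem_univ i)).trans (le_add_self.trans hU'))
  refine ⟨U, fun a ψ hψ => ?_⟩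
  have hDU : ∀ i j, i ≠ j → ∫ η in B,
      ‖inner ℂ ((U j : E →L[ℂ] E) η) ((U i : E →L[ℂ] E) η)‖ ∂μ ≤
        (((√n)⁻¹ + R * (√n)⁻¹) / 2) * μ.real B := by
    intro i j hij
    refine integral_closedBall_le_of_sq μ (by fun_prop) (by positivity) ?_
    have h := hKU i j
    simp only [K, hij, if_false] at h
    rw [← ofReal_integral_eq_lintegral_ofReal
      (Continuous.integrable_restrict_closedBall μ (by fun_prop))
      (Filter.Eventually.of_forall fun _ => by positivity), ← ENNReal.ofReal_natCast,
      ← ENNReal.ofReal_mul (by positivity), ENNReal.ofReal_le_ofReal_iff (by positivity)] at h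
    rw [mul_assoc R, ← mul_inv, Real.mul_self_sqrt hn.le, mul_assoc, mul_left_comm,
      inv_mul_eq_div, le_div_iff₀ hn]
    linarith
  have hmain := le_lintegral_closedBall_exp_gramForm μ
    (Matrix.diagonal (fun i => Q a i i) - Q a) U hψ (c := radialConst μ) (sq_nonneg _)
    (D := ((√n)⁻¹ + R * (√n)⁻¹) / 2) (fun i j hY => hDU i j (by rintro rfl; simp at hY))
  have h2 : (2 : ENNReal) * 2 ^ n = ENNReal.ofReal (2 * 2 ^ n) := by
    rw [ENNReal.ofReal_mul zero_le_two, ENNReal.ofReal_pow zero_le_two, ENNReal.ofReal_ofNat]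
  have h3 := hmain.trans (mul_le_mul_right (hJU a) _)
  rw [h2, ← ENNReal.ofReal_mul (by positivity), ENNReal.ofReal_le_ofReal_iff
    (by have := hM a; positivity), mul_comm] at h3
  have h4 := le_of_mul_le_mul_right (h3.trans_eq (by ring : _ = 2 * 2 ^ n * M a * R * μ.real B))
    hvol
  refine le_trans (le_of_eq ?_) h4
  congr 4
  ring

end ChooseUnitaries

section LargeDimension

open MeasureTheory Filter Topology

theorem tendsto_add_mul_div_sub_half (A L S K : ℝ) :
    Tendsto (fun n : ℕ => S * (K * (√(n : ℝ))⁻¹) / 2 + (A + n * L) / ((n : ℝ) - 1 / 2)) atTop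
      (𝓝 L) := by
  have hn : Tendsto (fun n : ℕ => (n : ℝ)) atTop atTop := tendsto_natCast_atTop_atTop
  have h1 : Tendsto (fun n : ℕ => (√(n : ℝ))⁻¹) atTop (𝓝 0) :=
    tendsto_inv_atTop_zero.comp (Real.tendsto_sqrt_atTop.comp hn)
  have h2 : Tendsto (fun n : ℕ => ((n : ℝ) - 1 / 2)⁻¹) atTop (𝓝 0) :=
    tendsto_inv_atTop_zero.comp (by
      simpa [sub_eq_add_neg] using tendsto_atTop_add_const_right _ (-(1 / 2) : ℝ) hn)
  have h3 := ((h1.const_mul (S * K / 2)).add (h2.const_mul (A + L / 2))).add_const L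
  simp only [mul_zero, zero_add] at h3
  refine h3.congr' ?_
  filter_upwards [eventually_ge_atTop 1] with n hn1
  have : (n : ℝ) - 1 / 2 ≠ 0 := by
    have : (1 : ℝ) ≤ n := by exact_mod_cast hn1
    intro h; linarith
  rw [div_eq_mul_inv (_ + _)]
  linear_combination (-L) * mul_inv_cancel₀ this

/-- In large dimension, unitaries can be chosen so that finitely many Gram forms are
simultaneously bounded on all unit vectors. -/
theorem exists_unitaries_forall_gramForm_le {ι κ : Type*} [Fintype ι] [DecidableEq ι] [Nonempty ι]
    [Fintype κ] (Q : κ → Matrix ι ι ℂ) (hQ : ∀ a, (Q a).IsHermitian)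
    (hpos : ∀ a k, 0 < (hQ a).eigenvalues k) {δ : ℝ} (hδ : 0 < δ) :
    ∃ n : ℕ, 0 < n ∧ ∃ U : ι → unitary (EuclideanSpace ℂ (Fin n) →L[ℂ] EuclideanSpace ℂ (Fin n)),
      ∀ a, ∀ ψ : EuclideanSpace ℂ (Fin n), ‖ψ‖ = 1 →
        gramForm (Matrix.diagonal (fun i => Q a i i) - Q a) (fun i => (U i :
          EuclideanSpace ℂ (Fin n) →L[ℂ] EuclideanSpace ℂ (Fin n)) ψ) / 2 ≤
        Real.log 2 + ∑ k, ((hQ a).eigenvalues k - 1 - Real.log ((hQ a).eigenvalues k)) + δ := by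
  set R : ℝ := Fintype.card κ + Fintype.card ι ^ 2 with hR
  set K : ℝ := (1 + R) / 2 + 2 with hK
  set S : κ → ℝ := fun a => ∑ i, ∑ j, ‖(Matrix.diagonal (fun i => Q a i i) - Q a) i j‖
  set L : κ → ℝ := fun a => Real.log 2 +
    ∑ k, ((hQ a).eigenvalues k - 1 - Real.log ((hQ a).eigenvalues k)) with hL
  have hR1 : 1 ≤ R := by
    have h1 : (1 : ℝ) ≤ Fintype.card ι := by exact_mod_cast Fintype.card_pos (α := ι)
    have h2 : (0 : ℝ) ≤ Fintype.card κ := by positivity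
    nlinarith
  have hL0 : ∀ a, 0 ≤ L a := fun a => add_nonneg (Real.log_nonneg (by norm_num))
    (Finset.sum_nonneg fun k _ => by linarith [Real.log_le_sub_one_of_pos (hpos a k)])
  have hA : 0 ≤ Real.log (2 * R) := Real.log_nonneg (by linarith)
  have hev : ∀ᶠ n : ℕ in atTop, ∀ a,
      S a * (K * (√(n : ℝ))⁻¹) / 2 + (Real.log (2 * R) + n * L a) / ((n : ℝ) - 1 / 2) < L a + δ :=
    eventually_all.2 fun a => (tendsto_add_mul_div_sub_half _ _ _ _).eventually_lt_const
      (by linarith)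
  obtain ⟨n, hn, hn1⟩ := (hev.and (eventually_ge_atTop 1)).exists
  refine ⟨n, hn1, ?_⟩
  have : Nonempty (Fin n) := ⟨⟨0, hn1⟩⟩
  let _ : MeasurableSpace (ι → unitary (EuclideanSpace ℂ (Fin n) →L[ℂ] EuclideanSpace ℂ (Fin n))) :=
    borel _
  have : BorelSpace (ι → unitary (EuclideanSpace ℂ (Fin n) →L[ℂ] EuclideanSpace ℂ (Fin n))) :=
    ⟨rfl⟩
  obtain ⟨U, hU⟩ := exists_unitaries_forall_exp_gramForm_le
    (volume : Measure (EuclideanSpace ℂ (Fin n))) Q hQ hpos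
  refine ⟨U, fun a ψ hψ => ?_⟩
  have h := hU a ψ hψ
  have hc := radialConst_ge (volume : Measure (EuclideanSpace ℂ (Fin n)))
  rw [finrank_euclideanSpace_fin] at h hc
  set c := radialConst (volume : Measure (EuclideanSpace ℂ (Fin n)))
  set Z := gramForm (Matrix.diagonal (fun i => Q a i i) - Q a) (fun i => (U i :
          EuclideanSpace ℂ (Fin n) →L[ℂ] EuclideanSpace ℂ (Fin n)) ψ)
  have hprod : ∏ k, (((hQ a).eigenvalues k)⁻¹ * Real.exp ((hQ a).eigenvalues k - 1)) =
      Real.exp (∑ k, ((hQ a).eigenvalues k - 1 - Real.log ((hQ a).eigenvalues k))) := by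
    rw [Real.exp_sum]
    refine Finset.prod_congr rfl fun k _ => ?_
    rw [Real.exp_sub _ (Real.log _), Real.exp_log (hpos a k)]
    ring
  have hrhs : 2 * 2 ^ n * (∏ k, (((hQ a).eigenvalues k)⁻¹ *
      Real.exp ((hQ a).eigenvalues k - 1))) ^ n * R = Real.exp (Real.log (2 * R) + n * L a) := by
    rw [Real.exp_add, Real.exp_log (by linarith), Real.exp_nat_mul, hL, Real.exp_add,
      Real.exp_log (by norm_num), hprod, mul_pow]
    ring
  rw [hrhs, Real.exp_le_exp] at h
  have hn1' : (1 : ℝ) ≤ n := by exact_mod_cast hn1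
  have hfin := (hn a).le
  set e := S a * (K * (√(n : ℝ))⁻¹)
  have hdiv : (Z - e) / 2 ≤ (Real.log (2 * R) + n * L a) / ((n : ℝ) - 1 / 2) := by
    rw [le_div_iff₀ (by linarith)]
    rcases le_total (Z - e) 0 with hz | hz
    · have := mul_nonneg (by linarith : (0 : ℝ) ≤ n) (hL0 a)
      nlinarith
    · have h' : c / 2 * (Z - e) ≤ Real.log (2 * R) + n * L a := h
      nlinarith
  linarith

end LargeDimension

section DeterminantBound

open Filter Topology

theorem isClosed_setOf_posSemidef (ι : Type*) : IsClosed {G : Matrix ι ι ℂ | G.PosSemidef} := by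
  refine IsClosed.and (isClosed_eq (by fun_prop) continuous_id) ?_
  simp only [Finsupp.sum, Set.ofPred_forall]
  exact isClosed_iInter fun x => isClosed_le continuous_const (by fun_prop)

theorem isCompact_setOf_posSemidef_diag_one (ι : Type*) : IsCompact
    {G : Matrix ι ι ℂ | G.PosSemidef ∧ (∀ i, G i i = 1) ∧ ∀ i j, ‖G i j‖ ≤ 1} := by
  have hc : IsCompact {G : Matrix ι ι ℂ | ∀ i j, G i j ∈ Metric.closedBall (0 : ℂ) 1} := by
    have h : {G : ι → ι → ℂ | ∀ i j, G i j ∈ Metric.closedBall (0 : ℂ) 1} =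
        Set.univ.pi fun _ => Set.univ.pi fun _ => Metric.closedBall (0 : ℂ) 1 := by
      ext G
      simp [Set.mem_pi]
    have h' := isCompact_univ_pi fun _ : ι => isCompact_univ_pi fun _ : ι =>
      isCompact_closedBall (0 : ℂ) 1
    rw [← h] at h'
    exact h'
  refine hc.of_isClosed_subset ?_ fun G hG i j => by simpa using hG.2.2 i j
  refine (isClosed_setOf_posSemidef ι).and (IsClosed.and ?_ ?_)
  · simp only [Set.ofPred_forall]
    exact isClosed_iInter fun i => isClosed_eq (by fun_prop) continuous_const
  · simp only [Set.ofPred_forall]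
    exact isClosed_iInter fun i => isClosed_iInter fun j =>
      isClosed_le (by fun_prop) continuous_const

theorem gramForm_eq_re_trace {ι E : Type*} [NormedAddCommGroup E] [InnerProductSpace ℂ E]
    [Fintype ι] (Q : Matrix ι ι ℂ) (g : ι → E) : gramForm Q g = ((Q * gram ℂ g).trace).re := by
  simp [gramForm, Matrix.trace, Matrix.mul_apply, gram_apply]

theorem Matrix.PosSemidef.posDef_half_one_add {ι : Type*} [DecidableEq ι] {G : Matrix ι ι ℂ} (hG : G.PosSemidef) :
    ((1 / 2 : ℂ) • (1 + G)).PosDef :=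
  (Matrix.PosDef.one.add_posSemidef hG).smul (by norm_num)

variable {ι : Type*} [Fintype ι] [DecidableEq ι]

theorem Matrix.PosDef.sum_log_eigenvalues {P : Matrix ι ι ℂ} (hP : P.PosDef) :
    ∑ k, Real.log (hP.1.eigenvalues k) = Real.log P.det.re := by
  have h : P.det = ((∏ k, hP.1.eigenvalues k : ℝ) : ℂ) := by
    rw [hP.1.det_eq_prod_eigenvalues]; push_cast; rfl
  rw [h, Complex.ofReal_re, Real.log_prod fun k _ => ne_of_gt (hP.eigenvalues_pos k)]

/-- Optimality of `Q = ((1 + G) / 2)⁻¹` in the Legendre-type bound for `-log det ((1 + G) / 2)`. -/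
theorem neg_log_det_half_one_add_eq {G : Matrix ι ι ℂ} (hG : G.PosSemidef) (hdiag : ∀ i, G i i = 1)
    {Q : Matrix ι ι ℂ} (hQ : Q.PosDef) (hQG : Q = ((1 / 2 : ℂ) • (1 + G))⁻¹) :
    -Real.log (((1 / 2 : ℂ) • (1 + G)).det).re =
      (((Matrix.diagonal (fun i => Q i i) - Q) * G).trace).re / 2 -
        ∑ k, (hQ.1.eigenvalues k - 1 - Real.log (hQ.1.eigenvalues k)) := by
  have hP := hG.posDef_half_one_add
  set P := (1 / 2 : ℂ) • (1 + G) with hPdef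
  have hdet : IsUnit P.det := (Matrix.isUnit_iff_isUnit_det P).1 hP.isUnit
  have h1 : Q * G = (2 : ℂ) • 1 - Q := by
    have hGP : G = (2 : ℂ) • P - 1 := by
      rw [hPdef, smul_smul]; norm_num
    have : Q * P = 1 := by rw [hQG, Matrix.nonsing_inv_mul _ hdet]
    rw [hGP, mul_sub, mul_one, Matrix.mul_smul, this]
  have h2 : (Matrix.diagonal (fun i => Q i i) * G).trace = Q.trace := by
    simp [Matrix.trace, Matrix.diagonal_mul, hdiag]
  have h3 : Real.log Q.det.re = -Real.log P.det.re := by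
    have him : (P.det.re : ℂ) = P.det := by
      have := hP.det_pos
      rw [Complex.lt_def] at this
      exact Complex.ext (by simp) (by simpa using this.2)
    rw [hQG, Matrix.det_nonsing_inv, Ring.inverse_eq_inv', ← him, ← Complex.ofReal_inv,
      Complex.ofReal_re, Complex.ofReal_re, Real.log_inv]
  have h4 : Q.trace.re = ∑ k, hQ.1.eigenvalues k := by
    rw [← hQ.1.sum_re_diag_eq]; simp [Matrix.trace]
  simp only [Finset.sum_sub_distrib, hQ.sum_log_eigenvalues, ← h4, h3]
  rw [sub_mul, h1, Matrix.trace_sub, h2, Matrix.trace_sub, Matrix.trace_smul, Matrix.trace_one]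
  simp
  ring

/-- For large dimension there are unitaries such that every Gram matrix of the images of a unit
vector has `-log det ((1 + G) / 2)` bounded almost by `log 2`. -/
theorem exists_unitaries_neg_log_det_gram_le (ι : Type*) [Fintype ι] [DecidableEq ι] [Nonempty ι]
    {δ : ℝ} (hδ : 0 < δ) :
    ∃ n : ℕ, 0 < n ∧ ∃ U : ι → unitary (EuclideanSpace ℂ (Fin n) →L[ℂ] EuclideanSpace ℂ (Fin n)),
      ∀ ψ : EuclideanSpace ℂ (Fin n), ‖ψ‖ = 1 →
        -Real.log (((1 / 2 : ℂ) • (1 + gram ℂ fun i => (U i :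
          EuclideanSpace ℂ (Fin n) →L[ℂ] EuclideanSpace ℂ (Fin n)) ψ)).det).re ≤
        Real.log 2 + δ := by
  set C := {G : Matrix ι ι ℂ | G.PosSemidef ∧ (∀ i, G i i = 1) ∧ ∀ i j, ‖G i j‖ ≤ 1}
  let f : Matrix ι ι ℂ → ℝ := fun G => -Real.log (((1 / 2 : ℂ) • (1 + G)).det).re
  let q : Matrix ι ι ℂ → Matrix ι ι ℂ := fun G => ((1 / 2 : ℂ) • (1 + G))⁻¹
  let T : Matrix ι ι ℂ → Matrix ι ι ℂ → ℝ := fun G₀ G =>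
    (((Matrix.diagonal (fun i => q G₀ i i) - q G₀) * G).trace).re / 2
  have hq : ∀ G ∈ C, (q G).PosDef := fun G hG => hG.1.posDef_half_one_add.inv
  have hnhds : ∀ G₀ ∈ C, {G | f G < f G₀ + δ / 3 ∧ T G₀ G₀ - δ / 3 < T G₀ G} ∈ 𝓝 G₀ := by
    intro G₀ hG₀
    refine Filter.inter_mem ?_ ?_
    · have hpos : 0 < (((1 / 2 : ℂ) • (1 + G₀)).det).re :=
        (Complex.lt_def.1 hG₀.1.posDef_half_one_add.det_pos).1
      have hc : ContinuousAt f G₀ := by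
        have hd : Continuous fun G : Matrix ι ι ℂ => (((1 / 2 : ℂ) • (1 + G)).det).re := by
          fun_prop
        exact (hd.continuousAt.log hpos.ne').neg
      exact hc.eventually_lt_const (by linarith)
    · have hc : Continuous (T G₀) := by
        simp only [T]
        fun_prop
      exact hc.continuousAt.eventually_const_lt (by linarith)
  obtain ⟨t, ht⟩ := (isCompact_setOf_posSemidef_diag_one ι).elim_nhds_subcover' _ hnhds
  obtain ⟨n, hn, U, hU⟩ := exists_unitaries_forall_gramForm_le (κ := t) (fun a => q a.1.1)
    (fun a => (hq a.1.1 a.1.2).1) (fun a k => (hq a.1.1 a.1.2).eigenvalues_pos k)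
    (δ := δ / 3) (by linarith)
  refine ⟨n, hn, U, fun ψ hψ => ?_⟩
  set g : ι → EuclideanSpace ℂ (Fin n) := fun i => (U i :
    EuclideanSpace ℂ (Fin n) →L[ℂ] EuclideanSpace ℂ (Fin n)) ψ
  have hg : ∀ i, ‖g i‖ = 1 := fun i => by rw [unitary_norm_map, hψ]
  have hGC : gram ℂ g ∈ C := by
    refine ⟨posSemidef_gram _ _, fun i => ?_, fun i j => ?_⟩
    · rw [gram_apply, inner_self_eq_norm_sq_to_K, hg]; simp
    · rw [gram_apply]
      simpa [hg] using norm_inner_le_norm (𝕜 := ℂ) (g i) (g j)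
  obtain ⟨G₀, hG₀t, h1, h2⟩ := Set.mem_iUnion₂.1 (ht hGC)
  have h3 := hU ⟨G₀, hG₀t⟩ ψ hψ
  have h4 := neg_log_det_half_one_add_eq G₀.2.1 G₀.2.2.1 (hq G₀.1 G₀.2) rfl
  rw [gramForm_eq_re_trace] at h3
  change f (gram ℂ g) ≤ _
  change f G₀.1 = T G₀.1 G₀.1 - _ at h4
  change T G₀.1 (gram ℂ g) ≤ _ at h3
  linarith

end DeterminantBound

section ScalarInequalities

theorem Real.log_one_add_le_pade {w : ℝ} (hw : -1 < w) :
    Real.log (1 + w) ≤ w * (6 + w) / (6 + 4 * w) := by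
  let f : ℝ → ℝ := fun w => w * (6 + w) / (6 + 4 * w) - Real.log (1 + w)
  have hd : ∀ x : ℝ, -1 < x → HasDerivAt f (4 * x ^ 3 / ((1 + x) * (6 + 4 * x) ^ 2)) x := by
    intro x hx
    have h1 : (6 + 4 * x) ≠ 0 := by linarith
    have h2 : (1 + x) ≠ 0 := by linarith
    have hlog : HasDerivAt (fun w : ℝ => Real.log (1 + w)) (1 / (1 + x)) x :=
      ((hasDerivAt_id x).const_add 1).log h2
    have hnum : HasDerivAt (fun w : ℝ => w * (6 + w)) (1 * (6 + x) + x * 1) x :=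
      (hasDerivAt_id x).mul ((hasDerivAt_id x).const_add 6)
    have hden : HasDerivAt (fun w : ℝ => 6 + 4 * w) (4 * 1) x :=
      ((hasDerivAt_id x).const_mul 4).const_add 6
    refine ((hnum.div hden h1).sub hlog).congr_deriv ?_
    have h3 : 3 + x * 2 ≠ 0 := by linarith
    rw [show 6 + 4 * x = 2 * (3 + x * 2) by ring]
    field_simp
    ring
  have hf0 : f 0 = 0 := by simp [f]
  suffices h : 0 ≤ f w by
    simp only [f] at h
    linarith
  rcases le_total 0 w with h0 | h0
  · have hmono : MonotoneOn f (Set.Ici 0) := by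
      refine monotoneOn_of_hasDerivWithinAt_nonneg (convex_Ici 0) (fun x hx =>
        (hd x (by linarith [Set.mem_Ici.1 hx])).continuousAt.continuousWithinAt) (fun x hx =>
        (hd x ?_).hasDerivWithinAt) fun x hx => ?_
      all_goals rw [interior_Ici] at hx; have hx' : 0 < x := hx
      · linarith
      · positivity
    simpa [hf0] using hmono Set.self_mem_Ici h0 h0
  · have hanti : AntitoneOn f (Set.Icc w 0) := by
      refine antitoneOn_of_hasDerivWithinAt_nonpos (convex_Icc w 0) (fun x hx =>
        (hd x (by linarith [hx.1])).continuousAt.continuousWithinAt) (fun x hx =>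
        (hd x ?_).hasDerivWithinAt) fun x hx => ?_
      all_goals rw [interior_Icc] at hx; have hx' := hx.1
      · linarith
      · refine div_nonpos_of_nonpos_of_nonneg ?_ ?_
        · nlinarith [hx.2, sq_nonneg x]
        · exact mul_nonneg (by linarith) (sq_nonneg _)
    simpa [hf0] using hanti (Set.left_mem_Icc.2 h0) (Set.right_mem_Icc.2 h0) h0

theorem mul_log_sub_add_one_le {t : ℝ} (h0 : 0 ≤ t) (h5 : t ≤ 5) :
    t * Real.log t - t + 1 ≤ 6 * ((t - 1) / 2 - Real.log ((1 + t) / 2)) := by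
  have h1 : Real.log ((1 + t) / 2) ≤ (t - 1) / 2 * (6 + (t - 1) / 2) / (6 + 4 * ((t - 1) / 2)) := by
    have := Real.log_one_add_le_pade (w := (t - 1) / 2) (by linarith)
    rwa [show 1 + (t - 1) / 2 = (1 + t) / 2 by ring] at this
  have h2 : t * Real.log t ≤ t * ((t - 1) * (6 + (t - 1)) / (6 + 4 * (t - 1))) := by
    rcases h0.eq_or_lt with h | h
    · simp [← h]
    · have := Real.log_one_add_le_pade (w := t - 1) (by linarith)
      rw [add_sub_cancel] at this
      exact mul_le_mul_of_nonneg_left this h0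
  have e1 : t * ((t - 1) * (6 + (t - 1)) / (6 + 4 * (t - 1))) - t + 1 =
      (t - 1) ^ 2 * ((t + 2) / (2 + 4 * t)) := by
    have : 1 + 2 * t ≠ 0 := by linarith
    rw [show 6 + 4 * (t - 1) = 2 * (1 + 2 * t) by ring, show 2 + 4 * t = 2 * (1 + 2 * t) by ring]
    field_simp
    ring
  have e2 : 6 * ((t - 1) / 2 - (t - 1) / 2 * (6 + (t - 1) / 2) / (6 + 4 * ((t - 1) / 2))) =
      (t - 1) ^ 2 * (9 / (4 * (t + 2))) := by
    have : t + 2 ≠ 0 := by linarith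
    rw [show 6 + 4 * ((t - 1) / 2) = 2 * (t + 2) by ring]
    field_simp
    ring
  have h3 : (t + 2) / (2 + 4 * t) ≤ 9 / (4 * (t + 2)) := by
    rw [div_le_div_iff₀ (by linarith) (by linarith)]
    nlinarith
  nlinarith [mul_le_mul_of_nonneg_left h3 (sq_nonneg (t - 1))]

theorem two_sub_log_three_le {t : ℝ} (h5 : 5 ≤ t) :
    2 - Real.log 3 ≤ (t - 1) / 2 - Real.log ((1 + t) / 2) := by
  have h := Real.log_le_sub_one_of_pos (x := (1 + t) / 2 / 3) (by linarith)
  rw [Real.log_div (by linarith) (by norm_num)] at h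
  linarith

end ScalarInequalities

section SpectralBound

variable {ι : Type*} [Fintype ι] [DecidableEq ι]

theorem Matrix.IsHermitian.det_half_one_add {G : Matrix ι ι ℂ} (hG : G.IsHermitian) :
    ((1 / 2 : ℂ) • (1 + G)).det = ((∏ k, ((1 + hG.eigenvalues k) / 2) : ℝ) : ℂ) := by
  have h1 : (1 / 2 : ℂ) • (1 + G) = (-1 / 2 : ℂ) • (Matrix.scalar ι (-1 : ℂ) - G) := by
    ext i j
    by_cases h : i = j
    · subst h; simp; ring
    · simp [h]; ring
  rw [h1, Matrix.det_smul, ← Matrix.eval_charpoly, hG.charpoly_eq, Polynomial.eval_prod,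
    ← Finset.card_univ, ← Finset.prod_const, ← Finset.prod_mul_distrib]
  push_cast
  refine Finset.prod_congr rfl fun k _ => ?_
  simp
  ring

/-- A lower bound on `det ((1 + G) / 2)` bounds the relative entropy of the spectrum of a
correlation matrix `G`. -/
theorem Matrix.PosSemidef.sum_mul_log_eigenvalues_le {G : Matrix ι ι ℂ} (hG : G.PosSemidef)
    (hdiag : ∀ i, G i i = 1) {c : ℝ} (hc : c < 2 - Real.log 3)
    (h : -Real.log (((1 / 2 : ℂ) • (1 + G)).det).re ≤ c) :
    ∑ k, hG.1.eigenvalues k * Real.log (hG.1.eigenvalues k) ≤ 6 * c := by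
  have hev := hG.eigenvalues_nonneg
  set e := hG.1.eigenvalues with he
  have hsum : ∑ k, (e k - 1) = 0 := by
    rw [Finset.sum_sub_distrib, ← hG.1.sum_re_diag_eq]
    simp [hdiag]
  have hk0 : ∀ k, 0 ≤ (e k - 1) / 2 - Real.log ((1 + e k) / 2) := fun k => by
    linarith [Real.log_le_sub_one_of_pos (x := (1 + e k) / 2) (by linarith [hev k])]
  have hk : ∑ k, ((e k - 1) / 2 - Real.log ((1 + e k) / 2)) ≤ c := by
    rw [hG.1.det_half_one_add, Complex.ofReal_re,
      Real.log_prod fun k _ => by linarith [hev k]] at h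
    rw [Finset.sum_sub_distrib, ← Finset.sum_div, hsum]
    linarith
  have h5 : ∀ k, e k ≤ 5 := by
    intro k
    by_contra! hlt
    linarith [two_sub_log_three_le hlt.le,
      Finset.single_le_sum (fun k _ => hk0 k) (Finset.mem_univ k)]
  calc ∑ k, e k * Real.log (e k) = ∑ k, (e k * Real.log (e k) - e k + 1) + ∑ k, (e k - 1) := by
        rw [← Finset.sum_add_distrib]
        exact Finset.sum_congr rfl fun k _ => by ring
    _ ≤ ∑ k, 6 * ((e k - 1) / 2 - Real.log ((1 + e k) / 2)) := by
        rw [hsum, add_zero]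
        exact Finset.sum_le_sum fun k _ => mul_log_sub_add_one_le (hev k) (h5 k)
    _ ≤ 6 * c := by
        rw [← Finset.mul_sum]
        linarith

end SpectralBound

section ColumnEntropy

variable {r s : Type*} [Fintype r] [Fintype s] [DecidableEq r]

/-- If `C Cᴴ` is the diagonal matrix of `e`, then the columns of `e ^ (-1/2) C` have norm at most
one. -/
theorem Matrix.sum_norm_sq_div_le_one {C : Matrix r s ℂ} {e : r → ℝ}
    (hC : C * Cᴴ = Matrix.diagonal fun k => (e k : ℂ)) (m : s) :
    ∑ k, ‖C k m‖ ^ 2 / e k ≤ 1 := by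
  set D : Matrix r r ℂ := Matrix.diagonal fun k => ((e k)⁻¹ : ℂ) with hD
  set M := Cᴴ * D * C with hM
  have hMH : Mᴴ = M := by
    have : Dᴴ = D := by simp [hD, Matrix.diagonal_conjTranspose, Pi.star_def]
    simp [hM, Matrix.conjTranspose_mul, this, Matrix.mul_assoc]
  have hDD : D * (Matrix.diagonal fun k => (e k : ℂ)) * D = D := by
    simp only [hD, Matrix.diagonal_mul_diagonal]
    congr 1
    ext k
    by_cases h : (e k : ℂ) = 0
    · simp [h]
    · field_simp
  have hMM : M * Mᴴ = M := by
    rw [hMH, hM]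
    calc Cᴴ * D * C * (Cᴴ * D * C) = Cᴴ * (D * (C * Cᴴ) * D) * C := by
          simp only [Matrix.mul_assoc]
      _ = _ := by rw [hC, hDD]
  set c := ∑ k, ‖C k m‖ ^ 2 / e k with hc
  have hMc : M m m = (c : ℂ) := by
    rw [hM, Matrix.mul_apply, hc]
    push_cast
    refine Finset.sum_congr rfl fun k _ => ?_
    have : (‖C k m‖ ^ 2 : ℂ) = star (C k m) * C k m := by
      rw [← Complex.conj_mul', starRingEnd_apply]
    rw [this, hD, Matrix.mul_diagonal, Matrix.conjTranspose_apply]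
    ring
  have hle : c ^ 2 ≤ c := by
    have h := congrFun (congrFun hMM m) m
    rw [Matrix.mul_apply, hMc] at h
    have h2 : ((∑ j, ‖M m j‖ ^ 2 : ℝ) : ℂ) = c := by
      rw [← h]
      push_cast
      refine Finset.sum_congr rfl fun j _ => ?_
      rw [Matrix.conjTranspose_apply, ← Complex.mul_conj', starRingEnd_apply]
    have h3 : ∑ j, ‖M m j‖ ^ 2 = c := by exact_mod_cast h2
    have h4 := Finset.single_le_sum (f := fun j => ‖M m j‖ ^ 2) (fun j _ => sq_nonneg _)
      (Finset.mem_univ m)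
    simp only [h3, hMc, Complex.norm_real, Real.norm_eq_abs, sq_abs] at h4
    exact h4
  nlinarith

/-- A rectangular Peierls inequality: the squared column norms of `B` are less ordered than the
spectrum of `B Bᴴ`. -/
theorem Matrix.IsHermitian.sum_col_mul_log_le {A : Matrix r r ℂ} (hA : A.IsHermitian)
    {B : Matrix r s ℂ} (hAB : B * Bᴴ = A) :
    ∑ m, (∑ k, ‖B k m‖ ^ 2) * Real.log (∑ k, ‖B k m‖ ^ 2) ≤
      ∑ k, hA.eigenvalues k * Real.log (hA.eigenvalues k) := by
  set V : Matrix r r ℂ := (hA.eigenvectorUnitary : Matrix r r ℂ) with hV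
  set e := hA.eigenvalues with he
  set C := Vᴴ * B with hCdef
  have hVV : V * Vᴴ = 1 := Unitary.coe_mul_star_self hA.eigenvectorUnitary
  have hVV' : Vᴴ * V = 1 := Unitary.coe_star_mul_self hA.eigenvectorUnitary
  have hC : C * Cᴴ = Matrix.diagonal fun k => (e k : ℂ) := by
    have h := hA.spectral_theorem
    rw [Unitary.conjStarAlgAut_apply] at h
    calc C * Cᴴ = Vᴴ * (B * Bᴴ) * V := by
          simp [hCdef, Matrix.conjTranspose_mul, Matrix.mul_assoc]
      _ = Vᴴ * A * V := by rw [hAB]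
      _ = (Vᴴ * V) * (Matrix.diagonal fun k => (e k : ℂ)) * (Vᴴ * V) := by
          conv_lhs => rw [h]
          simp only [Matrix.mul_assoc]
          rfl
      _ = _ := by rw [hVV', one_mul, mul_one]
  have hnorm : ∀ x : ℂ, ((‖x‖ ^ 2 : ℝ) : ℂ) = star x * x := fun x => by
    push_cast
    rw [← Complex.conj_mul', starRingEnd_apply]
  have hrow : ∀ k, ∑ m, ‖C k m‖ ^ 2 = e k := by
    intro k
    have h := congrFun (congrFun hC k) k
    rw [Matrix.mul_apply, Matrix.diagonal_apply_eq] at h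
    have : ((∑ m, ‖C k m‖ ^ 2 : ℝ) : ℂ) = e k := by
      rw [← h, Complex.ofReal_sum]
      exact Finset.sum_congr rfl fun m _ => by rw [hnorm, Matrix.conjTranspose_apply, mul_comm]
    exact_mod_cast this
  have hcol : ∀ m, ∑ k, ‖B k m‖ ^ 2 = ∑ k, ‖C k m‖ ^ 2 := by
    intro m
    have h : Cᴴ * C = Bᴴ * B := by
      calc Cᴴ * C = Bᴴ * (V * Vᴴ) * B := by
            simp [hCdef, Matrix.conjTranspose_mul, Matrix.mul_assoc]
        _ = _ := by rw [hVV, Matrix.mul_one]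
    have h' := congrFun (congrFun h m) m
    simp only [Matrix.mul_apply, Matrix.conjTranspose_apply, ← hnorm, ← Complex.ofReal_sum] at h'
    exact_mod_cast h'.symm
  simp only [hcol]
  set a : s → ℝ := fun m => ∑ k, ‖C k m‖ ^ 2 with ha
  have ha0 : ∀ m, 0 ≤ a m := fun m => Finset.sum_nonneg fun k _ => sq_nonneg _
  have hterm : ∀ k m, ‖C k m‖ ^ 2 * Real.log (a m) - ‖C k m‖ ^ 2 * Real.log (e k) ≤
      a m * (‖C k m‖ ^ 2 / e k) - ‖C k m‖ ^ 2 := by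
    intro k m
    by_cases h0 : ‖C k m‖ ^ 2 = 0
    · simp [h0]
    have hz : 0 < ‖C k m‖ ^ 2 := lt_of_le_of_ne (sq_nonneg _) (Ne.symm h0)
    have ham : 0 < a m := hz.trans_le
      (Finset.single_le_sum (f := fun k => ‖C k m‖ ^ 2) (fun k _ => sq_nonneg _)
        (Finset.mem_univ k))
    have hek : 0 < e k := by
      rw [← hrow k]
      exact hz.trans_le (Finset.single_le_sum (f := fun m => ‖C k m‖ ^ 2)
        (fun k _ => sq_nonneg _) (Finset.mem_univ m))
    have h := Real.log_le_sub_one_of_pos (div_pos ham hek)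
    rw [Real.log_div ham.ne' hek.ne'] at h
    calc _ = ‖C k m‖ ^ 2 * (Real.log (a m) - Real.log (e k)) := by ring
      _ ≤ ‖C k m‖ ^ 2 * (a m / e k - 1) := mul_le_mul_of_nonneg_left h hz.le
      _ = _ := by ring
  have hsum := Finset.sum_le_sum fun m (_ : m ∈ Finset.univ) =>
    Finset.sum_le_sum fun k (_ : k ∈ Finset.univ) => hterm k m
  have h1 : ∑ m, ∑ k, (‖C k m‖ ^ 2 * Real.log (a m) - ‖C k m‖ ^ 2 * Real.log (e k)) =
      ∑ m, a m * Real.log (a m) - ∑ k, e k * Real.log (e k) := by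
    simp only [Finset.sum_sub_distrib, ← Finset.sum_mul]
    rw [Finset.sum_comm]
    simp only [← Finset.sum_mul, hrow]
    rfl
  have h2 : ∑ m, ∑ k, (a m * (‖C k m‖ ^ 2 / e k) - ‖C k m‖ ^ 2) ≤ 0 := by
    refine Finset.sum_nonpos fun m _ => ?_
    rw [Finset.sum_sub_distrib, ← Finset.mul_sum]
    have := mul_le_mul_of_nonneg_left (Matrix.sum_norm_sq_div_le_one hC m) (ha0 m)
    simp only [ha] at this ⊢
    linarith
  rw [h1] at hsum
  linarith

end ColumnEntropy

section OutputEntropyLowerBound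

theorem Matrix.IsHermitian.conjTranspose_eigenvectorUnitary_mul_mul {r : Type*} [Fintype r]
    [DecidableEq r] {A : Matrix r r ℂ} (hA : A.IsHermitian) :
    (hA.eigenvectorUnitary : Matrix r r ℂ)ᴴ * A * (hA.eigenvectorUnitary : Matrix r r ℂ) =
      Matrix.diagonal fun k => (hA.eigenvalues k : ℂ) := by
  have h := hA.conjStarAlgAut_star_eigenvectorUnitary
  rw [Unitary.conjStarAlgAut_star_apply] at h
  exact h

theorem Complex.ofReal_norm_sq (x : ℂ) : ((‖x‖ ^ 2 : ℝ) : ℂ) = x * star x := by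
  push_cast
  rw [← Complex.mul_conj', starRingEnd_apply]

theorem Matrix.sum_norm_sq_col_eq_one {r : Type*} [Fintype r] [DecidableEq r] {N : Matrix r r ℂ}
    (hN : N ∈ Matrix.unitaryGroup r ℂ) (m : r) : ∑ k, ‖N k m‖ ^ 2 = 1 := by
  have h := congrFun (congrFun (Matrix.mem_unitaryGroup_iff'.1 hN) m) m
  rw [Matrix.mul_apply, Matrix.one_apply_eq] at h
  have h' : ((∑ k, ‖N k m‖ ^ 2 : ℝ) : ℂ) = 1 := by
    rw [← h, Complex.ofReal_sum]
    exact Finset.sum_congr rfl fun k _ => by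
      rw [Complex.ofReal_norm_sq, Matrix.star_apply, mul_comm]
  exact_mod_cast h'

theorem Matrix.mul_diagonal_mul_conjTranspose_apply_self {r : Type*} [Fintype r] [DecidableEq r]
    (N : Matrix r r ℂ) (p : r → ℝ) (k : r) :
    (N * (Matrix.diagonal fun m => (p m : ℂ)) * Nᴴ) k k =
      ((∑ m, p m * ‖N k m‖ ^ 2 : ℝ) : ℂ) := by
  rw [Matrix.mul_apply, Complex.ofReal_sum]
  refine Finset.sum_congr rfl fun m _ => ?_
  rw [Matrix.mul_diagonal, Matrix.conjTranspose_apply, Complex.ofReal_mul, Complex.ofReal_norm_sq]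
  ring

variable {n d : ℕ} {U : Fin d → Matrix (Fin n) (Fin n) ℂ}

theorem sum_mul_log_sum_norm_sq_le {K : ℝ}
    (hK : ∀ ψ : EuclideanSpace ℂ (Fin n), ‖ψ‖ = 1 → ∑ a,
      (isHermitian_gram ℂ fun i => WithLp.toLp 2 (U i *ᵥ ψ.ofLp)).eigenvalues a *
        Real.log ((isHermitian_gram ℂ fun i => WithLp.toLp 2 (U i *ᵥ ψ.ofLp)).eigenvalues a) ≤ K)
    {V W : Matrix (Fin n) (Fin n) ℂ} (hV : V ∈ Matrix.unitaryGroup (Fin n) ℂ)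
    (hW : W ∈ Matrix.unitaryGroup (Fin n) ℂ) (m : Fin n) :
    ∑ k, (∑ i, ‖(Vᴴ * U i * W) k m‖ ^ 2) * Real.log (∑ i, ‖(Vᴴ * U i * W) k m‖ ^ 2) ≤ K := by
  have hψ : ‖(WithLp.toLp 2 (fun k => W k m) : EuclideanSpace ℂ (Fin n))‖ = 1 := by
    rw [EuclideanSpace.norm_eq]
    simpa using Matrix.sum_norm_sq_col_eq_one hW m
  refine le_trans ?_ (hK _ hψ)
  have h := Matrix.IsHermitian.sum_col_mul_log_le
    (isHermitian_gram ℂ fun i => WithLp.toLp 2 (U i *ᵥ fun k => W k m))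
    (B := Matrix.of fun i k => star ((Vᴴ * U i * W) k m)) ?_
  · simpa using h
  ext i j
  have h1 : (Vᴴ * U i * W)ᴴ * (Vᴴ * U j * W) = (U i * W)ᴴ * (U j * W) := by
    have hVV : V * Vᴴ = 1 := Matrix.mem_unitaryGroup_iff.1 hV
    calc (Vᴴ * U i * W)ᴴ * (Vᴴ * U j * W) = (U i * W)ᴴ * (V * Vᴴ) * (U j * W) := by
          simp [Matrix.conjTranspose_mul, Matrix.mul_assoc]
      _ = _ := by rw [hVV, Matrix.mul_one]
  have h2 := congrFun (congrFun h1 m) m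
  rw [Matrix.mul_apply, Matrix.mul_apply] at h2
  rw [gram_apply, EuclideanSpace.inner_toLp_toLp, Matrix.mul_apply, dotProduct]
  simp only [Matrix.conjTranspose_apply, Matrix.of_apply, star_star] at h2 ⊢
  rw [h2]
  refine Finset.sum_congr rfl fun k _ => ?_
  rw [mul_comm]
  rfl

theorem vnEntropy_ruChannel_ge (hd : 0 < d) (hU : ∀ i, U i ∈ Matrix.unitaryGroup (Fin n) ℂ) {K : ℝ}
    (hK : ∀ ψ : EuclideanSpace ℂ (Fin n), ‖ψ‖ = 1 → ∑ a,
      (isHermitian_gram ℂ fun i => WithLp.toLp 2 (U i *ᵥ ψ.ofLp)).eigenvalues a *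
        Real.log ((isHermitian_gram ℂ fun i => WithLp.toLp 2 (U i *ᵥ ψ.ofLp)).eigenvalues a) ≤ K)
    {ρ : Matrix (Fin n) (Fin n) ℂ} (hρ : ρ.PosSemidef) (htr : ρ.trace = 1) :
    Real.log d - K / d ≤ vnEntropy (ruChannel (fun _ => (d : ℝ)⁻¹) U ρ) := by
  have hσ : (ruChannel (fun _ => (d : ℝ)⁻¹) U ρ).IsHermitian := by
    unfold ruChannel
    rw [Matrix.IsHermitian, Matrix.conjTranspose_sum]
    refine Finset.sum_congr rfl fun i _ => ?_
    have := (hρ.mul_mul_conjTranspose_same (U i)).1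
    rw [Matrix.conjTranspose_smul, this, Complex.star_def,
      Complex.conj_ofReal]
  rw [vnEntropy, dif_pos hσ]
  set σ := ruChannel (fun _ => (d : ℝ)⁻¹) U ρ with hσdef
  set V : Matrix (Fin n) (Fin n) ℂ := (hσ.eigenvectorUnitary : Matrix (Fin n) (Fin n) ℂ)
  set W : Matrix (Fin n) (Fin n) ℂ := (hρ.1.eigenvectorUnitary : Matrix (Fin n) (Fin n) ℂ)
  set p := hρ.1.eigenvalues
  have hV : V ∈ Matrix.unitaryGroup (Fin n) ℂ := hσ.eigenvectorUnitary.2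
  have hW : W ∈ Matrix.unitaryGroup (Fin n) ℂ := hρ.1.eigenvectorUnitary.2
  have hWW : W * Wᴴ = 1 := Matrix.mem_unitaryGroup_iff.1 hW
  have hd' : (0 : ℝ) < d := by exact_mod_cast hd
  let x : Fin n → Fin n → ℝ := fun k m => ∑ i, ‖(Vᴴ * U i * W) k m‖ ^ 2
  have hx0 : ∀ k m, 0 ≤ x k m := fun k m => Finset.sum_nonneg fun i _ => sq_nonneg _
  have hxsum : ∀ m, ∑ k, x k m = d := by
    intro m
    simp only [x]
    rw [Finset.sum_comm]
    have : ∀ i, ∑ k, ‖(Vᴴ * U i * W) k m‖ ^ 2 = 1 := fun i =>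
      Matrix.sum_norm_sq_col_eq_one
        (mul_mem (mul_mem (Unitary.star_mem hV) (hU i)) hW) m
    simp [this]
  have hp0 : ∀ m, 0 ≤ p m := hρ.eigenvalues_nonneg
  have hp1 : ∑ m, p m = 1 := by
    rw [← hρ.1.sum_re_diag_eq]
    simpa [Matrix.trace] using congrArg Complex.re htr
  have hdiag : Vᴴ * σ * V = ∑ i, ((d : ℝ)⁻¹ : ℂ) •
      ((Vᴴ * U i * W) * (Matrix.diagonal fun m => (p m : ℂ)) * (Vᴴ * U i * W)ᴴ) := by
    rw [hσdef, ruChannel, Finset.mul_sum, Finset.sum_mul]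
    refine Finset.sum_congr rfl fun i _ => ?_
    rw [Matrix.mul_smul, Matrix.smul_mul, ← hρ.1.conjTranspose_eigenvectorUnitary_mul_mul]
    push_cast
    congr 1
    calc Vᴴ * (U i * ρ * (U i)ᴴ) * V
        = Vᴴ * U i * (W * Wᴴ) * ρ * (W * Wᴴ) * (U i)ᴴ * V := by
          rw [hWW]; simp [Matrix.mul_assoc]
      _ = _ := by simp [Matrix.conjTranspose_mul, Matrix.mul_assoc, W]
  have hev : ∀ k, hσ.eigenvalues k = ∑ m, p m • (x k m / d) := by
    intro k
    have h := congrFun (congrFun hσ.conjTranspose_eigenvectorUnitary_mul_mul k) k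
    rw [Matrix.diagonal_apply_eq] at h
    have h' : (hσ.eigenvalues k : ℂ) = ((∑ m, p m • (x k m / d) : ℝ) : ℂ) := by
      rw [← h, hdiag, Matrix.sum_apply]
      simp only [Matrix.smul_apply, Matrix.mul_diagonal_mul_conjTranspose_apply_self, smul_eq_mul]
      rw [← Finset.mul_sum, ← Complex.ofReal_sum, ← Complex.ofReal_inv, ← Complex.ofReal_mul,
        Finset.sum_comm, Finset.mul_sum]
      simp only [x, ← Finset.mul_sum]
      rw [Finset.mul_sum]
      congr 1
      exact Finset.sum_congr rfl fun m _ => by ring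
    exact_mod_cast h'
  have hconv : ∀ k, hσ.eigenvalues k * Real.log (hσ.eigenvalues k) ≤
      ∑ m, p m * (x k m / d * Real.log (x k m / d)) := by
    intro k
    rw [hev k]
    exact Real.convexOn_mul_log.map_sum_le (fun m _ => hp0 m) hp1
      fun m _ => div_nonneg (hx0 k m) hd'.le
  have hscale : ∀ k m, x k m / d * Real.log (x k m / d) =
      (x k m * Real.log (x k m)) / d - x k m * (Real.log d / d) := by
    intro k m
    rcases eq_or_ne (x k m) 0 with h | h
    · simp [h]
    · rw [Real.log_div h hd'.ne']
      ring
  have hm : ∀ m, ∑ k, x k m / d * Real.log (x k m / d) ≤ K / d - Real.log d := by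
    intro m
    simp only [hscale, Finset.sum_sub_distrib, ← Finset.sum_div, ← Finset.sum_mul, hxsum]
    rw [mul_div_cancel₀ _ hd'.ne']
    have := sum_mul_log_sum_norm_sq_le hK hV hW m
    gcongr
  have hfin : ∑ k, hσ.eigenvalues k * Real.log (hσ.eigenvalues k) ≤ K / d - Real.log d := by
    calc _ ≤ ∑ k, ∑ m, p m * (x k m / d * Real.log (x k m / d)) :=
          Finset.sum_le_sum fun k _ => hconv k
      _ = ∑ m, p m * ∑ k, x k m / d * Real.log (x k m / d) := by
          rw [Finset.sum_comm]
          simp only [Finset.mul_sum]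
      _ ≤ ∑ m, p m * (K / d - Real.log d) :=
          Finset.sum_le_sum fun m _ => mul_le_mul_of_nonneg_left (hm m) (hp0 m)
      _ = _ := by rw [← Finset.sum_mul, hp1, one_mul]
  linarith

end OutputEntropyLowerBound

section MinOutputEntropy

theorem vnEntropy_transpose {m : Type*} [Fintype m] [DecidableEq m] (A : Matrix m m ℂ) :
    vnEntropy Aᵀ = vnEntropy A := by
  by_cases h : A.IsHermitian
  · have h' : Aᵀ.IsHermitian := h.transpose
    rw [vnEntropy, vnEntropy, dif_pos h, dif_pos h',
      (h'.eigenvalues_eq_eigenvalues_iff h).2 A.charpoly_transpose]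
  · have h' : ¬ Aᵀ.IsHermitian := fun h' => h (by simpa using h'.transpose)
    rw [vnEntropy, vnEntropy, dif_neg h, dif_neg h']

theorem vnEntropy_nonneg {m : Type*} [Fintype m] [DecidableEq m] {σ : Matrix m m ℂ}
    (hσ : σ.PosSemidef) (htr : σ.trace = 1) : 0 ≤ vnEntropy σ := by
  rw [vnEntropy, dif_pos hσ.1, ← Finset.sum_neg_distrib]
  have h1 : ∑ k, hσ.1.eigenvalues k = 1 := by
    rw [← hσ.1.sum_re_diag_eq]
    simpa [Matrix.trace] using congrArg Complex.re htr
  refine Finset.sum_nonneg fun k _ => neg_nonneg.2 ?_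
  refine Real.mul_log_nonpos (hσ.eigenvalues_nonneg k) ?_
  rw [← h1]
  exact Finset.single_le_sum (fun k _ => hσ.eigenvalues_nonneg k) (Finset.mem_univ k)

theorem le_minOutEntropy {m k : Type*} [Fintype m] [DecidableEq m] [Nonempty m] [Fintype k]
    [DecidableEq k] {Ψ : Matrix m m ℂ → Matrix k k ℂ} {c : ℝ}
    (h : ∀ ρ : Matrix m m ℂ, ρ.PosSemidef → ρ.trace = 1 → c ≤ vnEntropy (Ψ ρ)) :
    c ≤ minOutEntropy Ψ := by
  refine le_csInf ⟨_, ((Fintype.card m : ℂ)⁻¹) • (1 : Matrix m m ℂ), ?_, ?_, rfl⟩ ?_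
  · refine Matrix.PosSemidef.one.smul ?_
    rw [← Complex.ofReal_natCast, ← Complex.ofReal_inv, Complex.zero_le_real]
    positivity
  · rw [Matrix.trace_smul, Matrix.trace_one, smul_eq_mul, inv_mul_cancel₀]
    exact_mod_cast Fintype.card_ne_zero
  · rintro x ⟨ρ, hρ, htr, rfl⟩
    exact h ρ hρ htr

theorem minOutEntropy_le {m k : Type*} [Fintype m] [DecidableEq m] [Fintype k]
    [DecidableEq k] {Ψ : Matrix m m ℂ → Matrix k k ℂ}
    (hpos : ∀ ρ : Matrix m m ℂ, ρ.PosSemidef → (Ψ ρ).PosSemidef)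
    (htr : ∀ ρ : Matrix m m ℂ, (Ψ ρ).trace = ρ.trace) {ρ : Matrix m m ℂ} (hρ : ρ.PosSemidef)
    (hρ1 : ρ.trace = 1) : minOutEntropy Ψ ≤ vnEntropy (Ψ ρ) := by
  refine csInf_le ⟨0, ?_⟩ ⟨ρ, hρ, hρ1, rfl⟩
  rintro x ⟨ρ, hρ, hρ1, rfl⟩
  exact vnEntropy_nonneg (hpos ρ hρ) (by rw [htr, hρ1])

variable {n d : ℕ} {U : Fin d → Matrix (Fin n) (Fin n) ℂ}

theorem conjRuChannel_eq_transpose (w : Fin d → ℝ) (U : Fin d → Matrix (Fin n) (Fin n) ℂ)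
    (ρ : Matrix (Fin n) (Fin n) ℂ) : conjRuChannel w U ρ = (ruChannel w U ρᵀ)ᵀ := by
  simp only [conjRuChannel, ruChannel, Matrix.transpose_sum, Matrix.transpose_smul,
    Matrix.transpose_mul, Matrix.transpose_transpose, Matrix.mul_assoc]
  rfl

theorem kronecker_map_star_mem_unitaryGroup {A B : Matrix (Fin n) (Fin n) ℂ}
    (hA : A ∈ Matrix.unitaryGroup (Fin n) ℂ) (hB : B ∈ Matrix.unitaryGroup (Fin n) ℂ) :
    Matrix.kronecker A (B.map star) ∈ Matrix.unitaryGroup (Fin n × Fin n) ℂ := by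
  refine Matrix.kronecker_mem_unitary hA ?_
  have : B.map star = (star B)ᵀ := rfl
  rw [this]
  exact Matrix.transpose_mem_unitaryGroup_iff.2 (Unitary.star_mem hB)

theorem prodChannel_posSemidef {w : Fin d → ℝ} (hw : ∀ i, 0 ≤ w i)
    {ρ : Matrix (Fin n × Fin n) (Fin n × Fin n) ℂ} (hρ : ρ.PosSemidef) :
    (prodChannel w U ρ).PosSemidef := by
  refine Matrix.posSemidef_sum _ fun i _ => Matrix.posSemidef_sum _ fun j _ => ?_
  exact (hρ.mul_mul_conjTranspose_same _).smul
    (Complex.zero_le_real.2 (mul_nonneg (hw i) (hw j)))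

theorem trace_prodChannel {w : Fin d → ℝ} (hw : ∑ i, w i = 1)
    (hU : ∀ i, U i ∈ Matrix.unitaryGroup (Fin n) ℂ)
    (ρ : Matrix (Fin n × Fin n) (Fin n × Fin n) ℂ) : (prodChannel w U ρ).trace = ρ.trace := by
  have h : ∀ i j, ((Matrix.kronecker (U i) ((U j).map star)) * ρ *
      (Matrix.kronecker (U i) ((U j).map star))ᴴ).trace = ρ.trace := fun i j => by
    have := Matrix.mem_unitaryGroup_iff'.1 (kronecker_map_star_mem_unitaryGroup (hU i) (hU j))
    rw [Matrix.trace_mul_comm, ← Matrix.mul_assoc, ← Matrix.star_eq_conjTranspose, this, one_mul]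
  simp only [prodChannel, Matrix.trace_sum, Matrix.trace_smul]
  simp only [Matrix.kronecker] at h
  simp only [h, smul_eq_mul, ← Finset.sum_mul, ← Complex.ofReal_sum, ← Finset.mul_sum, hw, mul_one]
  simp

end MinOutputEntropy

section ProductUpperBound

theorem Matrix.sum_norm_sq_mulVec {r : Type*} [Fintype r] [DecidableEq r] {N : Matrix r r ℂ}
    (hN : N ∈ Matrix.unitaryGroup r ℂ) (v : r → ℂ) :
    ∑ k, ‖(N *ᵥ v) k‖ ^ 2 = ∑ k, ‖v k‖ ^ 2 := by
  have key : ∀ u : r → ℂ, ((∑ k, ‖u k‖ ^ 2 : ℝ) : ℂ) = star u ⬝ᵥ u := fun u => by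
    rw [Complex.ofReal_sum, dotProduct]
    exact Finset.sum_congr rfl fun k _ => by
      rw [Complex.ofReal_norm_sq, Pi.star_apply, mul_comm]
  have h : ((∑ k, ‖(N *ᵥ v) k‖ ^ 2 : ℝ) : ℂ) = ((∑ k, ‖v k‖ ^ 2 : ℝ) : ℂ) := by
    have hN' : Nᴴ * N = 1 := Matrix.mem_unitaryGroup_iff'.1 hN
    rw [key, key, Matrix.star_mulVec, Matrix.dotProduct_mulVec, Matrix.vecMul_vecMul, hN',
      Matrix.vecMul_one]
  exact_mod_cast h

theorem Matrix.mul_vecMulVec_star_mul_conjTranspose {r : Type*} [Fintype r] (N : Matrix r r ℂ)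
    (v : r → ℂ) :
    N * Matrix.vecMulVec v (star v) * Nᴴ = Matrix.vecMulVec (N *ᵥ v) (star (N *ᵥ v)) := by
  rw [Matrix.mul_vecMulVec, Matrix.vecMulVec_mul, Matrix.star_mulVec]

/-- The maximally entangled unit vector of `ℂⁿ ⊗ ℂⁿ`. -/
noncomputable def maxEntangled (n : ℕ) (p : Fin n × Fin n) : ℂ :=
  if p.1 = p.2 then (((√n)⁻¹ : ℝ) : ℂ) else 0

theorem sum_norm_sq_maxEntangled {n : ℕ} (hn : 0 < n) : ∑ p, ‖maxEntangled n p‖ ^ 2 = 1 := by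
  have h : (0 : ℝ) < n := Nat.cast_pos.2 hn
  have h2 : ∀ a b, ‖maxEntangled n (a, b)‖ ^ 2 = if a = b then (n : ℝ)⁻¹ else 0 := fun a b => by
    by_cases hab : a = b
    · simp only [maxEntangled, hab, if_true, Complex.norm_real, Real.norm_eq_abs, sq_abs, inv_pow,
        Real.sq_sqrt h.le]
    · simp [maxEntangled, hab]
  simp only [Fintype.sum_prod_type, h2, Finset.sum_ite_eq, Finset.mem_univ, if_true,
    Finset.sum_const, Finset.card_univ, Fintype.card_fin, nsmul_eq_mul]
  field_simp

theorem kronecker_map_star_mulVec_maxEntangled {n : ℕ} {A : Matrix (Fin n) (Fin n) ℂ}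
    (hA : A ∈ Matrix.unitaryGroup (Fin n) ℂ) :
    Matrix.kronecker A (A.map star) *ᵥ maxEntangled n = maxEntangled n := by
  ext ⟨a, b⟩
  have h := congrFun (congrFun (Matrix.mem_unitaryGroup_iff.1 hA) a) b
  rw [Matrix.mul_apply] at h
  simp only [Matrix.mulVec, dotProduct, Fintype.sum_prod_type, Matrix.kronecker,
    Matrix.kroneckerMap_apply, Matrix.map_apply, maxEntangled, mul_ite, mul_zero,
    Finset.sum_ite_eq, Finset.mem_univ, if_true, ← Finset.sum_mul]
  simp only [Matrix.star_apply] at h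
  rw [h, Matrix.one_apply]
  split_ifs <;> simp

variable {n d : ℕ} {U : Fin d → Matrix (Fin n) (Fin n) ℂ}

/-- The rank-one decomposition of the output of `Φ ⊗ Φ̄` on the maximally entangled state: the
diagonal terms all coincide and are collected in a single column. -/
noncomputable def prodOutputFactor (U : Fin d → Matrix (Fin n) (Fin n) ℂ) :
    Matrix (Fin n × Fin n) (Unit ⊕ Fin d × Fin d) ℂ :=
  Matrix.of fun k => Sum.elim (fun _ => (((√d)⁻¹ : ℝ) : ℂ) * maxEntangled n k) fun p =>
    if p.1 = p.2 then 0 else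
      (((d : ℝ)⁻¹ : ℝ) : ℂ) *
        (Matrix.kronecker (U p.1) ((U p.2).map star) *ᵥ maxEntangled n) k

theorem prodOutputFactor_mul_conjTranspose (hd : 0 < d)
    (hU : ∀ i, U i ∈ Matrix.unitaryGroup (Fin n) ℂ) :
    prodOutputFactor U * (prodOutputFactor U)ᴴ = prodChannel (fun _ => (d : ℝ)⁻¹) U
      (Matrix.vecMulVec (maxEntangled n) (star (maxEntangled n))) := by
  have hd' : (0 : ℝ) < d := Nat.cast_pos.2 hd
  have hdc : (d : ℂ) ≠ 0 := by exact_mod_cast hd.ne'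
  have hsq : (((√d)⁻¹ : ℝ) : ℂ) * (((√d)⁻¹ : ℝ) : ℂ) = (d : ℂ)⁻¹ := by
    rw [← Complex.ofReal_mul, ← mul_inv, Real.mul_self_sqrt hd'.le]
    simp
  set v : Fin d → Fin d → Fin n × Fin n → ℂ := fun i j =>
    Matrix.kronecker (U i) ((U j).map star) *ᵥ maxEntangled n with hv
  have hvd : ∀ i, v i i = maxEntangled n := fun i => kronecker_map_star_mulVec_maxEntangled (hU i)
  have hR : prodChannel (fun _ => (d : ℝ)⁻¹) U
      (Matrix.vecMulVec (maxEntangled n) (star (maxEntangled n))) =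
      ∑ i, ∑ j, (((d : ℝ)⁻¹ * (d : ℝ)⁻¹ : ℝ) : ℂ) • Matrix.vecMulVec (v i j) (star (v i j)) := by
    unfold prodChannel
    refine Finset.sum_congr rfl fun i _ => Finset.sum_congr rfl fun j _ => ?_
    rw [Matrix.mul_vecMulVec_star_mul_conjTranspose]
    rfl
  rw [hR]
  ext k l
  have hsplit : ∀ i j : Fin d, ((d : ℂ)⁻¹ * (d : ℂ)⁻¹) * (v i j k * star (v i j l)) =
      (if i = j then ((d : ℂ)⁻¹ * (d : ℂ)⁻¹) * (maxEntangled n k * star (maxEntangled n l)) else 0)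
      + (if i = j then 0 else ((d : ℂ)⁻¹ * v i j k) * star ((d : ℂ)⁻¹ * v i j l)) := by
    intro i j
    by_cases hij : i = j
    · subst hij
      rw [if_pos rfl, if_pos rfl, hvd, add_zero]
    · rw [if_neg hij, if_neg hij, zero_add, star_mul']
      simp only [Complex.star_def, map_inv₀, Complex.conj_natCast]
      ring
  simp only [Matrix.sum_apply, Matrix.smul_apply, Matrix.vecMulVec_apply, smul_eq_mul,
    Pi.star_apply, Complex.ofReal_mul, Complex.ofReal_inv, Complex.ofReal_natCast, hsplit,
    Finset.sum_add_distrib, Finset.sum_ite_eq, Finset.mem_univ, if_true, Finset.sum_const,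
    Finset.card_univ, Fintype.card_fin, nsmul_eq_mul]
  rw [Matrix.mul_apply, Fintype.sum_sum_type, Fintype.sum_prod_type]
  congr 1
  · simp only [Finset.univ_unique, Finset.sum_singleton, prodOutputFactor, Matrix.of_apply,
      Matrix.conjTranspose_apply, Sum.elim_inl, star_mul']
    rw [Complex.star_def, Complex.conj_ofReal, mul_mul_mul_comm, hsq]
    field_simp
  · refine Finset.sum_congr rfl fun i _ => Finset.sum_congr rfl fun j _ => ?_
    simp only [prodOutputFactor, Matrix.of_apply, Matrix.conjTranspose_apply, Sum.elim_inr]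
    by_cases hij : i = j
    · simp [hij]
    · simp [hij, hv]

theorem sum_norm_sq_prodOutputFactor_inl (hn : 0 < n) (x : Unit) :
    ∑ k, ‖prodOutputFactor U k (Sum.inl x)‖ ^ 2 = (d : ℝ)⁻¹ := by
  simp only [prodOutputFactor, Matrix.of_apply, Sum.elim_inl, norm_mul, mul_pow,
    ← Finset.mul_sum, sum_norm_sq_maxEntangled hn, Complex.norm_real, Real.norm_eq_abs, sq_abs,
    inv_pow, Real.sq_sqrt (Nat.cast_nonneg d), mul_one]

theorem sum_norm_sq_prodOutputFactor_inr (hn : 0 < n)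
    (hU : ∀ i, U i ∈ Matrix.unitaryGroup (Fin n) ℂ) (i j : Fin d) :
    ∑ k, ‖prodOutputFactor U k (Sum.inr (i, j))‖ ^ 2 = if i = j then 0 else ((d : ℝ)⁻¹) ^ 2 := by
  by_cases hij : i = j
  · simp [prodOutputFactor, hij]
  · simp only [prodOutputFactor, Matrix.of_apply, Sum.elim_inr, if_neg hij, norm_mul, mul_pow,
      ← Finset.mul_sum, Complex.norm_real, Real.norm_eq_abs, sq_abs]
    rw [Matrix.sum_norm_sq_mulVec (kronecker_map_star_mem_unitaryGroup (hU i) (hU j)),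
      sum_norm_sq_maxEntangled hn, mul_one]

theorem minOutEntropy_prodChannel_le (hn : 0 < n) (hd : 0 < d)
    (hU : ∀ i, U i ∈ Matrix.unitaryGroup (Fin n) ℂ) :
    minOutEntropy (prodChannel (fun _ => (d : ℝ)⁻¹) U) ≤ 2 * Real.log d - Real.log d / d := by
  have hd' : (d : ℝ) ≠ 0 := Nat.cast_ne_zero.2 hd.ne'
  have hw : ∀ _ : Fin d, 0 ≤ (d : ℝ)⁻¹ := fun _ => by positivity
  have hw1 : ∑ _ : Fin d, (d : ℝ)⁻¹ = 1 := by simp [hd']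
  have hρ := Matrix.posSemidef_vecMulVec_self_star (maxEntangled n)
  have hρ1 : (Matrix.vecMulVec (maxEntangled n) (star (maxEntangled n))).trace = 1 := by
    rw [Matrix.trace_vecMulVec, dotProduct]
    simp only [Pi.star_apply, ← Complex.ofReal_norm_sq, ← Complex.ofReal_sum,
      sum_norm_sq_maxEntangled hn, Complex.ofReal_one]
  refine (minOutEntropy_le (fun ρ hρ => prodChannel_posSemidef hw hρ)
    (fun ρ => trace_prodChannel hw1 hU ρ) hρ hρ1).trans ?_
  have hσ := (prodChannel_posSemidef (U := U) hw hρ).1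
  have h := hσ.sum_col_mul_log_le (prodOutputFactor_mul_conjTranspose hd hU)
  rw [vnEntropy, dif_pos hσ]
  refine (neg_le_neg h).trans_eq ?_
  rw [Fintype.sum_sum_type, Fintype.sum_prod_type]
  simp only [sum_norm_sq_prodOutputFactor_inl hn, sum_norm_sq_prodOutputFactor_inr hn hU]
  have hsplit : ∀ i j : Fin d, (if i = j then 0 else ((d : ℝ)⁻¹) ^ 2) *
      Real.log (if i = j then 0 else ((d : ℝ)⁻¹) ^ 2) =
      ((d : ℝ)⁻¹) ^ 2 * Real.log (((d : ℝ)⁻¹) ^ 2) -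
        if i = j then ((d : ℝ)⁻¹) ^ 2 * Real.log (((d : ℝ)⁻¹) ^ 2) else 0 := fun i j => by
    split_ifs <;> simp
  simp only [hsplit, Finset.sum_sub_distrib, Finset.sum_ite_eq, Finset.mem_univ, if_true,
    Finset.sum_const, Finset.card_univ, Fintype.card_fin, nsmul_eq_mul, Fintype.card_unit,
    Real.log_pow, Real.log_inv]
  push_cast
  field_simp
  ring

end ProductUpperBound

theorem exists_unitary_matrices_sum_eigenvalues_gram_mul_log_le {d : ℕ} (hd : 0 < d) {δ : ℝ}
    (hδ : 0 < δ) (hδ' : Real.log 2 + δ < 2 - Real.log 3) :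
    ∃ n, 0 < n ∧ ∃ U : Fin d → Matrix (Fin n) (Fin n) ℂ,
      (∀ i, U i ∈ Matrix.unitaryGroup (Fin n) ℂ) ∧
      ∀ ψ : EuclideanSpace ℂ (Fin n), ‖ψ‖ = 1 → ∑ a,
        (isHermitian_gram ℂ fun i => WithLp.toLp 2 (U i *ᵥ ψ.ofLp)).eigenvalues a *
          Real.log ((isHermitian_gram ℂ fun i => WithLp.toLp 2 (U i *ᵥ ψ.ofLp)).eigenvalues a) ≤
        6 * (Real.log 2 + δ) := by
  have : Nonempty (Fin d) := ⟨⟨0, hd⟩⟩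
  obtain ⟨n, hn, V, hV⟩ := exists_unitaries_neg_log_det_gram_le (Fin d) hδ
  set e := Matrix.toEuclideanCLM (n := Fin n) (𝕜 := ℂ)
  have happ : ∀ i (ψ : EuclideanSpace ℂ (Fin n)), WithLp.toLp 2
      (e.symm (V i : EuclideanSpace ℂ (Fin n) →L[ℂ] EuclideanSpace ℂ (Fin n)) *ᵥ ψ.ofLp) =
      (V i : EuclideanSpace ℂ (Fin n) →L[ℂ] EuclideanSpace ℂ (Fin n)) ψ := fun i ψ => by
    rw [← Matrix.toEuclideanCLM_toLp]
    exact congrArg (fun T : EuclideanSpace ℂ (Fin n) →L[ℂ] EuclideanSpace ℂ (Fin n) => T ψ)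
      (e.apply_symm_apply _)
  refine ⟨n, hn, fun i => e.symm (V i : EuclideanSpace ℂ (Fin n) →L[ℂ] EuclideanSpace ℂ (Fin n)),
    fun i => Unitary.map_mem e.symm (V i).2, fun ψ hψ => ?_⟩
  refine (posSemidef_gram ℂ _).sum_mul_log_eigenvalues_le (fun i => ?_) hδ' ?_
  · rw [gram_apply, happ, inner_self_eq_norm_sq_to_K, unitary_norm_map, hψ]
    simp
  · simp only [happ]
    exact hV ψ hψ

/-- There is a random unitary channel whose additivity violation
`S_min(Φ) + S_min(Φ̄) − S_min(Φ ⊗ Φ̄)` exceeds `9.5 × 10⁻⁶`. -/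
theorem exists_channel_additivity_gap :
    ∃ (n d : ℕ) (w : Fin d → ℝ) (U : Fin d → Matrix (Fin n) (Fin n) ℂ),
      0 < n ∧ 0 < d ∧
      (∀ i, 0 ≤ w i) ∧ ∑ i, w i = 1 ∧
      (∀ i, U i ∈ Matrix.unitaryGroup (Fin n) ℂ) ∧
      (9.5e-6 : ℝ) < minOutEntropy (ruChannel w U) + minOutEntropy (conjRuChannel w U) -
        minOutEntropy (prodChannel w U) := by
  obtain ⟨d, hd⟩ : ∃ d : ℕ, d = 16384 := ⟨_, rfl⟩
  have hd0 : 0 < d := by omega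
  have hdr : (d : ℝ) = 16384 := by rw [hd]; norm_num
  have hlog : Real.log d = 14 * Real.log 2 := by
    rw [hdr, show (16384 : ℝ) = 2 ^ 14 by norm_num, Real.log_pow]
    norm_num
  have hlt : Real.log 2 + 1 / 100 < 2 - Real.log 3 := by
    have h3 : Real.log 3 = Real.log 2 + Real.log (3 / 2) := by
      rw [← Real.log_mul (by norm_num) (by norm_num)]
      norm_num
    have := Real.log_le_sub_one_of_pos (show (0 : ℝ) < 3 / 2 by norm_num)
    have := Real.log_two_lt_d9
    linarith
  obtain ⟨n, hn, U, hU, hK⟩ :=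
    exists_unitary_matrices_sum_eigenvalues_gram_mul_log_le hd0 (by norm_num) hlt
  have : Nonempty (Fin n) := ⟨⟨0, hn⟩⟩
  have h1 : Real.log d - 6 * (Real.log 2 + 1 / 100) / d ≤
      minOutEntropy (ruChannel (fun _ => (d : ℝ)⁻¹) U) :=
    le_minOutEntropy fun ρ hρ htr => vnEntropy_ruChannel_ge hd0 hU hK hρ htr
  have h2 : Real.log d - 6 * (Real.log 2 + 1 / 100) / d ≤
      minOutEntropy (conjRuChannel (fun _ => (d : ℝ)⁻¹) U) :=
    le_minOutEntropy fun ρ hρ htr => by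
      rw [conjRuChannel_eq_transpose, vnEntropy_transpose]
      exact vnEntropy_ruChannel_ge hd0 hU hK hρ.transpose (by rw [Matrix.trace_transpose, htr])
  have h3 := minOutEntropy_prodChannel_le hn hd0 hU
  refine ⟨n, d, fun _ => (d : ℝ)⁻¹, U, hn, hd0, fun _ => by positivity, ?_, hU, ?_⟩
  · simp [hd0.ne']
  · rw [hlog, hdr] at h1 h2 h3
    have := Real.log_two_gt_d9
    rw [hdr]
    linarith
end

section
/- Let 0 < γ < 1 and f(x) = x log x − x + 1 (with f(0) = 1). Then sup over x ≥ 0 and γ ≤ r ≤ 1 of f(x)/f(r x + 1 − r) equals 1/f(1−γ); that is, f(x)·f(1−γ) ≤ f(r x + 1 − r) for all x ≥ 0 and all r ∈ [γ, 1], and the value 1/f(1−γ) is attained at x = 0, r = γ. -/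
/-- `f(x) = x log x − x + 1`; since `Real.log 0 = 0`, this gives `f 0 = 1`. -/
noncomputable def flog (x : ℝ) : ℝ := x * Real.log x - x + 1

theorem flog_zero : flog 0 = 1 := by simp [flog]

/-- The tangent-line inequality for the convex function `x log x`. -/
theorem mul_log_sub_le {z y : ℝ} (hz : 0 ≤ z) (hy : 0 < y) :
    z * Real.log y - y ≤ z * Real.log z - z := by
  rcases hz.eq_or_lt with rfl | hz
  · simp [hy.le]
  · have h := mul_le_mul_of_nonneg_left (Real.log_le_sub_one_of_pos (div_pos hy hz)) hz.le
    rw [Real.log_div hy.ne' hz.ne', mul_sub, mul_sub, mul_div_cancel₀ _ hz.ne'] at h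
    linarith

theorem flog_nonneg {x : ℝ} (hx : 0 ≤ x) : 0 ≤ flog x := by
  have h := mul_log_sub_le hx one_pos
  simp only [Real.log_one] at h
  unfold flog
  linarith

theorem flog_pos {x : ℝ} (hx : 0 < x) (hx1 : x ≠ 1) : 0 < flog x := by
  have h := mul_lt_mul_of_pos_left
    (Real.log_lt_sub_one_of_pos (inv_pos.2 hx) (by simpa using hx1)) hx
  rw [Real.log_inv, mul_sub, mul_inv_cancel₀ hx.ne'] at h
  unfold flog
  linarith

theorem flog_antitoneOn : AntitoneOn flog (Set.Icc 0 1) := by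
  intro z hz y hy hzy
  rcases hy.1.eq_or_lt with rfl | hy0
  · rw [le_antisymm hzy hz.1]
  · have h := mul_log_sub_le hz.1 hy0
    have h' := mul_nonneg_of_nonpos_of_nonpos (sub_nonpos.2 hzy) (Real.log_nonpos hy.1 hy.2)
    unfold flog
    linarith

theorem flog_one_sub_le_sq {r : ℝ} (hr : r ≤ 1) : flog (1 - r) ≤ r ^ 2 := by
  rcases hr.eq_or_lt with rfl | hr
  · simp [flog]
  · have h := mul_le_mul_of_nonneg_left (Real.log_le_sub_one_of_pos (sub_pos.2 hr))
      (sub_pos.2 hr).le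
    unfold flog
    linarith

/-- A Chebyshev sum inequality for powers with nonnegative weights. -/
theorem sum_mul_pow_mul_sum_mul_pow_le (s : Finset ℕ) {a : ℕ → ℝ} (ha : ∀ n, 0 ≤ a n)
    {u r : ℝ} (hu : 0 ≤ u) (hu1 : u ≤ 1) (hr : 0 ≤ r) (hr1 : r ≤ 1) :
    (∑ n ∈ s, a n * u ^ n) * (∑ n ∈ s, a n * r ^ n) ≤
      (∑ n ∈ s, a n) * ∑ n ∈ s, a n * (u * r) ^ n := by
  have key : 0 ≤ ∑ i ∈ s, ∑ j ∈ s, a i * a j * ((u ^ i - u ^ j) * (r ^ i - r ^ j)) := by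
    refine Finset.sum_nonneg fun i _ => Finset.sum_nonneg fun j _ =>
      mul_nonneg (mul_nonneg (ha i) (ha j)) ?_
    rcases le_total i j with h | h
    · exact mul_nonneg (sub_nonneg.2 (pow_le_pow_of_le_one hu hu1 h))
        (sub_nonneg.2 (pow_le_pow_of_le_one hr hr1 h))
    · exact mul_nonneg_of_nonpos_of_nonpos (sub_nonpos.2 (pow_le_pow_of_le_one hu hu1 h))
        (sub_nonpos.2 (pow_le_pow_of_le_one hr hr1 h))
  have expand : ∑ i ∈ s, ∑ j ∈ s, a i * a j * ((u ^ i - u ^ j) * (r ^ i - r ^ j)) =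
      (∑ n ∈ s, a n * (u * r) ^ n) * (∑ n ∈ s, a n)
        - (∑ n ∈ s, a n * u ^ n) * (∑ n ∈ s, a n * r ^ n)
        - (∑ n ∈ s, a n * r ^ n) * (∑ n ∈ s, a n * u ^ n)
        + (∑ n ∈ s, a n) * ∑ n ∈ s, a n * (u * r) ^ n := by
    simp only [Finset.sum_mul_sum, ← Finset.sum_sub_distrib, ← Finset.sum_add_distrib]
    refine Finset.sum_congr rfl fun i _ => Finset.sum_congr rfl fun j _ => ?_
    ring
  rw [expand] at key
  linarith

theorem hasSum_flog_one_sub {u : ℝ} (hu : |u| < 1) :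
    HasSum (fun n : ℕ => (1 / ((n : ℝ) + 1) - 1 / ((n : ℝ) + 2)) * u ^ n * u ^ 2)
      (flog (1 - u)) := by
  have h := Real.hasSum_pow_div_log_of_abs_lt_one hu
  have h2 := (hasSum_nat_add_iff' 1).2 h
  have h3 := (h.mul_left u).sub h2
  have hv : u * -Real.log (1 - u) - (-Real.log (1 - u) -
      ∑ i ∈ Finset.range 1, u ^ (i + 1) / ((i : ℝ) + 1)) = flog (1 - u) := by
    simp [flog]
    ring
  rw [hv] at h3
  refine (congrArg (HasSum · (flog (1 - u))) (funext fun n => ?_)).mpr h3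
  push_cast
  field_simp
  ring

theorem sum_range_one_div_sub_le_one (N : ℕ) :
    ∑ n ∈ Finset.range N, (1 / ((n : ℝ) + 1) - 1 / ((n : ℝ) + 2)) ≤ 1 := by
  have h := Finset.sum_range_sub' (fun n : ℕ => 1 / ((n : ℝ) + 1)) N
  have e : ∀ n : ℕ, (((n + 1 : ℕ) : ℝ) + 1) = n + 2 := fun n => by push_cast; ring
  simp only [e] at h
  rw [h]
  have : 0 ≤ 1 / ((N : ℝ) + 1) := by positivity
  simpa using this

theorem flog_one_sub_mul_le {u r : ℝ} (hu : 0 ≤ u) (hu1 : u ≤ 1) (hr : 0 ≤ r) (hr1 : r ≤ 1) :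
    flog (1 - u) * flog (1 - r) ≤ flog (1 - u * r) := by
  rcases hu1.eq_or_lt with rfl | hu1
  · simp [flog_zero]
  rcases hr1.eq_or_lt with rfl | hr1
  · simp [flog_zero]
  have hur : u * r < 1 := mul_lt_one_of_nonneg_of_lt_one_left hu hu1 hr1.le
  have hsu := (hasSum_flog_one_sub (abs_lt.2 ⟨by linarith, hu1⟩)).tendsto_sum_nat
  have hsr := (hasSum_flog_one_sub (abs_lt.2 ⟨by linarith, hr1⟩)).tendsto_sum_nat
  have hsur := (hasSum_flog_one_sub
    (abs_lt.2 ⟨by linarith [mul_nonneg hu hr], hur⟩)).tendsto_sum_nat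
  refine le_of_tendsto_of_tendsto' (hsu.mul hsr) hsur fun N => ?_
  simp only [← Finset.sum_mul]
  have ha : ∀ n : ℕ, 0 ≤ 1 / ((n : ℝ) + 1) - 1 / ((n : ℝ) + 2) := fun n =>
    sub_nonneg.2 (one_div_le_one_div_of_le (by positivity) (by linarith))
  have hc := sum_mul_pow_mul_sum_mul_pow_le (Finset.range N) ha hu hu1.le hr hr1.le
  have hnn : 0 ≤ ∑ n ∈ Finset.range N,
      (1 / ((n : ℝ) + 1) - 1 / ((n : ℝ) + 2)) * (u * r) ^ n :=
    Finset.sum_nonneg fun n _ => mul_nonneg (ha n) (by positivity)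
  have hb := hc.trans (mul_le_of_le_one_left hnn (sum_range_one_div_sub_le_one N))
  calc _ = _ * (u * r) ^ 2 := by rw [mul_mul_mul_comm, ← mul_pow]
    _ ≤ _ := mul_le_mul_of_nonneg_right hb (sq_nonneg _)

theorem hasDerivAt_flog {x : ℝ} (hx : x ≠ 0) : HasDerivAt flog (Real.log x) x := by
  exact (((Real.hasDerivAt_mul_log hx).sub (hasDerivAt_id x)).add_const 1).congr_deriv (by ring)

theorem sq_mul_flog_one_add_le {v r : ℝ} (hv : 0 ≤ v) (hr : 0 ≤ r) (hr1 : r ≤ 1) :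
    r ^ 2 * flog (1 + v) ≤ flog (1 + r * v) := by
  have hd : ∀ w : ℝ, 0 ≤ w → HasDerivAt (fun w => flog (1 + r * w) - r ^ 2 * flog (1 + w))
      (r * (Real.log (1 + r * w) - r * Real.log (1 + w))) w := by
    intro w hw
    have hw1 : 1 + r * w ≠ 0 := by positivity
    have hw2 : 1 + w ≠ 0 := by positivity
    have e1 := (hasDerivAt_flog hw1).comp w (((hasDerivAt_id w).const_mul r).const_add 1)
    have e2 := (hasDerivAt_flog hw2).comp w ((hasDerivAt_id w).const_add 1)
    exact (e1.sub (e2.const_mul (r ^ 2))).congr_deriv (by ring)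
  have hm : MonotoneOn (fun w => flog (1 + r * w) - r ^ 2 * flog (1 + w)) (Set.Ici 0) := by
    refine monotoneOn_of_hasDerivWithinAt_nonneg (convex_Ici 0)
      (fun w hw => (hd w hw).continuousAt.continuousWithinAt)
      (fun w hw => (hd w (interior_subset hw)).hasDerivWithinAt) fun w hw => ?_
    have hw : 0 ≤ w := interior_subset hw
    have hlog := Real.log_le_log (by positivity)
      (rpow_one_add_le_one_add_mul_self (by linarith : -1 ≤ w) hr hr1)
    rw [Real.log_rpow (by positivity)] at hlog
    exact mul_nonneg hr (sub_nonneg.2 hlog)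
  have h := hm Set.self_mem_Ici hv hv
  simp only [mul_zero, add_zero, flog, Real.log_one] at h
  unfold flog
  linarith

theorem flog_mul_flog_one_sub_le {x r : ℝ} (hx : 0 ≤ x) (hr : 0 ≤ r) (hr1 : r ≤ 1) :
    flog x * flog (1 - r) ≤ flog (r * x + 1 - r) := by
  rcases le_total x 1 with hx1 | hx1
  · convert flog_one_sub_mul_le (sub_nonneg.2 hx1) (by linarith) hr hr1 using 2 <;> ring_nf
  · calc flog x * flog (1 - r) ≤ flog x * r ^ 2 :=
          mul_le_mul_of_nonneg_left (flog_one_sub_le_sq hr1) (flog_nonneg hx)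
      _ = r ^ 2 * flog (1 + (x - 1)) := by ring_nf
      _ ≤ flog (1 + r * (x - 1)) := sq_mul_flog_one_add_le (sub_nonneg.2 hx1) hr hr1
      _ = flog (r * x + 1 - r) := by ring_nf

/-- For `0 < γ < 1`, the supremum of `f(x)/f(rx + 1 − r)` over `x ≥ 0` and `r ∈ [γ, 1]`
equals `1/f(1−γ)` and is attained (at `x = 0`, `r = γ`); equivalently
`f(x) f(1−γ) ≤ f(rx + 1 − r)` for all such `x, r`. -/
theorem flog_ratio_isGreatest (γ : ℝ) (h0 : 0 < γ) (h1 : γ < 1) :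
    IsGreatest {y : ℝ | ∃ x : ℝ, 0 ≤ x ∧ ∃ r : ℝ, γ ≤ r ∧ r ≤ 1 ∧
        y = flog x / flog (r * x + 1 - r)} (1 / flog (1 - γ)) ∧
      (∀ x : ℝ, 0 ≤ x → ∀ r : ℝ, γ ≤ r → r ≤ 1 →
        flog x * flog (1 - γ) ≤ flog (r * x + 1 - r)) := by
  have main : ∀ x : ℝ, 0 ≤ x → ∀ r : ℝ, γ ≤ r → r ≤ 1 →
      flog x * flog (1 - γ) ≤ flog (r * x + 1 - r) := fun x hx r hr hr1 =>
    (mul_le_mul_of_nonneg_left (flog_antitoneOn ⟨by linarith, by linarith⟩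
      ⟨by linarith, by linarith⟩ (by linarith)) (flog_nonneg hx)).trans
      (flog_mul_flog_one_sub_le hx (h0.le.trans hr) hr1)
  have hpos : 0 < flog (1 - γ) := flog_pos (by linarith) (by linarith)
  refine ⟨⟨⟨0, le_rfl, γ, le_rfl, h1.le, by simp [flog_zero]⟩, ?_⟩, main⟩
  rintro _ ⟨x, hx, r, hr, hr1, rfl⟩
  have hnn : 0 ≤ flog (r * x + 1 - r) := flog_nonneg (by nlinarith)
  rcases hnn.eq_or_lt with h | h
  · rw [← h, div_zero]
    positivity
  · rw [div_le_div_iff₀ h hpos, one_mul]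
    exact main x hx r hr hr1
end

section
/- Let d ≥ 2, f(x) = x log x − x + 1, F(x) = −log x + x − 1, and for 0 < h < d log d let M_d(h) = inf{ ∑_{i=1}^d F(d q_i) : q ∈ Δ_d, ∑_{i=1}^d f(d q_i) ≥ h }. Then M_d(h) = inf over z ∈ (1, d) satisfying z log z + (d−z) log((d−z)/(d−1)) = h of the quantity −log z − (d−1) log((d−z)/(d−1)). -/
open scoped BigOperators

/-- `F(x) = −log x + x − 1`. -/
noncomputable def Ffun (x : ℝ) : ℝ := -Real.log x + x - 1

/-- `M_d(h) = inf { ∑ i, F (d q i) : q ∈ Δ_d, all q i > 0, ∑ i, f (d q i) ≥ h }`;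
the convention `F(0) = +∞` means points of `Δ_d` with a zero coordinate never contribute
to the infimum, so they are excluded. -/
noncomputable def Md (d : ℕ) (h : ℝ) : ℝ :=
  sInf {y : ℝ | ∃ q : Fin d → ℝ, (∀ i, 0 < q i) ∧ ∑ i, q i = 1 ∧
    h ≤ ∑ i, flog (d * q i) ∧ y = ∑ i, Ffun (d * q i)}

/-- The graph of `x log x` lies above its tangent lines. -/
lemma mul_log_tangent_le {x y : ℝ} (hx : 0 < x) (hy : 0 < y) :
    x * Real.log x + (y - x) * (Real.log x + 1) ≤ y * Real.log y := by
  have h := Real.log_le_sub_one_of_pos (div_pos hx hy)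
  rw [Real.log_div hx.ne' hy.ne'] at h
  have h2 := mul_le_mul_of_nonneg_left h hy.le
  have h3 : y * (x / y - 1) = x - y := by field_simp
  rw [h3] at h2
  nlinarith

/-- The graph of `log x` lies below its tangent lines. -/
lemma log_le_tangent {x y : ℝ} (hx : 0 < x) (hy : 0 < y) :
    Real.log y ≤ Real.log x + (y - x) / x := by
  have h := Real.log_le_sub_one_of_pos (div_pos hy hx)
  rw [Real.log_div hy.ne' hx.ne'] at h
  have h3 : y / x - 1 = (y - x) / x := by field_simp
  linarith

lemma two_mul_le_log_add_sub_log_sub {u t : ℝ} (h0 : 0 ≤ t) (h1 : t < u) :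
    2 * t / u ≤ Real.log (u + t) - Real.log (u - t) := by
  have hu : 0 < u := h0.trans_lt h1
  have htu : t / u < 1 := (div_lt_one hu).2 h1
  have htu0 : 0 ≤ t / u := div_nonneg h0 hu.le
  have hs := Real.hasSum_log_sub_log_of_abs_lt_one (x := t / u) (by rwa [abs_of_nonneg htu0])
  have h := hs.summable.sum_le_tsum (Finset.range 1) (fun i _ => by positivity)
  rw [hs.tsum_eq] at h
  have e1 : u + t = u * (1 + t / u) := by field_simp
  have e2 : u - t = u * (1 - t / u) := by field_simp
  rw [e1, e2, Real.log_mul hu.ne' (by positivity), Real.log_mul hu.ne' (by linarith)]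
  simp at h
  rw [mul_div_assoc]
  linarith

/-- Quantitative midpoint convexity of `x log x`. -/
lemma mul_log_midpoint {u e : ℝ} (h0 : 0 ≤ e) (h1 : e < u) :
    2 * (u * Real.log u) + e ^ 2 / u ≤
      (u - e) * Real.log (u - e) + (u + e) * Real.log (u + e) := by
  have hu : 0 < u := h0.trans_lt h1
  have hd : ∀ t ∈ Set.Ico (0 : ℝ) u, HasDerivAt
      (fun t => (u - t) * Real.log (u - t) + (u + t) * Real.log (u + t) - t ^ 2 / u)
      (Real.log (u + t) - Real.log (u - t) - 2 * t / u) t := by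
    rintro t ⟨ht0, ht1⟩
    have hm : u - t ≠ 0 := by linarith
    have hp : u + t ≠ 0 := by linarith
    have a := (Real.hasDerivAt_mul_log hm).comp t ((hasDerivAt_id t).const_sub u)
    have b := (Real.hasDerivAt_mul_log hp).comp t ((hasDerivAt_id t).const_add u)
    have c := ((hasDerivAt_id t).pow 2).div_const u
    refine ((a.add b).sub c).congr_deriv ?_
    simp
    ring
  have hmono : MonotoneOn
      (fun t => (u - t) * Real.log (u - t) + (u + t) * Real.log (u + t) - t ^ 2 / u)
      (Set.Ico 0 u) := by
    refine monotoneOn_of_deriv_nonneg (convex_Ico 0 u)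
      (fun t ht => (hd t ht).continuousAt.continuousWithinAt) ?_ ?_
    · intro t ht
      exact (hd t (interior_subset ht)).differentiableAt.differentiableWithinAt
    · intro t ht
      have ht' := interior_subset ht
      rw [(hd t ht').deriv]
      have := two_mul_le_log_add_sub_log_sub ht'.1 ht'.2
      linarith
  have := hmono ⟨le_rfl, hu⟩ ⟨h0, h1⟩ h0
  simp at this
  linarith

/-- A function with positive derivative at `0` exceeds its value at `0` at arbitrarily small
positive arguments. -/
lemma exists_gt_of_hasDerivAt_pos {P : ℝ → ℝ} {P' : ℝ} (h : HasDerivAt P P' 0) (hP : 0 < P')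
    {p : ℝ → Prop} (hp : ∀ᶠ t in nhds (0 : ℝ), p t) : ∃ t, 0 < t ∧ P 0 < P t ∧ p t := by
  have h1 := (hasDerivAt_iff_tendsto_slope.1 h).eventually (lt_mem_nhds hP)
  have h2 : ∀ᶠ t in nhdsWithin (0 : ℝ) (Set.Ioi 0), 0 < slope P 0 t :=
    h1.filter_mono (nhdsWithin_mono _ fun t ht => ne_of_gt ht)
  obtain ⟨t, ⟨ht1, ht2⟩, ht3⟩ :=
    ((h2.and (hp.filter_mono nhdsWithin_le_nhds)).and self_mem_nhdsWithin).exists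
  have ht3 : 0 < t := ht3
  refine ⟨t, ht3, ?_, ht2⟩
  rw [slope_def_field, sub_zero] at ht1
  have := (div_pos_iff_of_pos_right ht3).1 ht1
  linarith

/-- Smoothing of three distinct values. -/
lemma exists_improvement_of_lt {a b c : ℝ} (ha : 0 < a) (hab : a < b) (hbc : b < c) :
    ∃ a' b' c' : ℝ, 0 < a' ∧ 0 < b' ∧ 0 < c' ∧ a' + b' + c' = a + b + c ∧
      a * Real.log a + b * Real.log b + c * Real.log c ≤
        a' * Real.log a' + b' * Real.log b' + c' * Real.log c' ∧
      a * b * c < a' * b' * c' := by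
  have hb := ha.trans hab
  have hc := hb.trans hbc
  set A := Real.log a
  set B := Real.log b
  set C := Real.log c
  have hAB : A < B := Real.log_lt_log ha hab
  have hBC : B < C := Real.log_lt_log hb hbc
  have hder : HasDerivAt (fun t : ℝ => (a + t * (C - B)) * (b + t * (A - C)) * (c + t * (B - A)))
      ((C - B) * b * c + a * (A - C) * c + a * b * (B - A)) 0 := by
    have l : ∀ x v : ℝ, HasDerivAt (fun t : ℝ => x + t * v) v 0 := fun x v => by
      simpa using ((hasDerivAt_id (0 : ℝ)).mul_const v).const_add x
    refine (((l a (C - B)).mul (l b (A - C))).mul (l c (B - A))).congr_deriv ?_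
    simp
    ring
  have hpos : 0 < (C - B) * b * c + a * (A - C) * c + a * b * (B - A) := by
    have h1 : B - A < b / a - 1 := by
      have := Real.log_lt_sub_one_of_pos (div_pos hb ha) (by
        rw [Ne, div_eq_one_iff_eq ha.ne']; exact hab.ne')
      rwa [Real.log_div hb.ne' ha.ne'] at this
    have h1' : a * (B - A) < b - a := by
      have := mul_lt_mul_of_pos_left h1 ha
      rwa [mul_sub, mul_sub, mul_div_cancel₀ _ ha.ne', mul_one, ← mul_sub] at this
    have h2 : B - C < b / c - 1 := by
      have := Real.log_lt_sub_one_of_pos (div_pos hb hc) (by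
        rw [Ne, div_eq_one_iff_eq hc.ne']; exact hbc.ne)
      rwa [Real.log_div hb.ne' hc.ne'] at this
    have h2' : c - b < c * (C - B) := by
      have := mul_lt_mul_of_pos_left h2 hc
      rw [mul_sub, mul_sub, mul_div_cancel₀ _ hc.ne', mul_one] at this
      linarith
    have e : (C - B) * b * c + a * (A - C) * c + a * b * (B - A)
        = (b - a) * (c * (C - B)) - (c - b) * (a * (B - A)) := by ring
    rw [e]
    have := mul_lt_mul_of_pos_left h2' (sub_pos.2 hab)
    have := mul_lt_mul_of_pos_left h1' (sub_pos.2 hbc)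
    linarith
  have hev : ∀ x v : ℝ, 0 < x → ∀ᶠ t in nhds (0 : ℝ), 0 < x + t * v := fun x v hx => by
    have : ContinuousAt (fun t : ℝ => x + t * v) 0 := by fun_prop
    exact this.eventually (lt_mem_nhds (by simpa using hx))
  obtain ⟨t, ht, hP, h1, h2, h3⟩ := exists_gt_of_hasDerivAt_pos hder hpos
    ((hev a (C - B) ha).and ((hev b (A - C) hb).and (hev c (B - A) hc)))
  refine ⟨_, _, _, h1, h2, h3, by ring, ?_, by simpa using hP⟩
  have t1 := mul_log_tangent_le ha h1
  have t2 := mul_log_tangent_le hb h2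
  have t3 := mul_log_tangent_le hc h3
  change _ * A + _ * (A + 1) ≤ _ at t1
  change _ * B + _ * (B + 1) ≤ _ at t2
  change _ * C + _ * (C + 1) ≤ _ at t3
  have e : (a + t * (C - B) - a) * (A + 1) + (b + t * (A - C) - b) * (B + 1)
    + (c + t * (B - A) - c) * (C + 1) = 0 := by ring
  linarith

/-- Smoothing of three values the larger two of which coincide. -/
lemma exists_improvement_of_eq {a c : ℝ} (ha : 0 < a) (hac : a < c) :
    ∃ a' b' c' : ℝ, 0 < a' ∧ 0 < b' ∧ 0 < c' ∧ a' + b' + c' = a + c + c ∧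
      a * Real.log a + c * Real.log c + c * Real.log c ≤
        a' * Real.log a' + b' * Real.log b' + c' * Real.log c' ∧
      a * c * c < a' * b' * c' := by
  have hc := ha.trans hac
  set L := Real.log c - Real.log a with hL
  have hL0 : 0 < L := sub_pos.2 (Real.log_lt_log ha hac)
  have hL1 : a * L < c - a := by
    have := Real.log_lt_sub_one_of_pos (div_pos hc ha) (by
      rw [Ne, div_eq_one_iff_eq ha.ne']; exact hac.ne')
    rw [Real.log_div hc.ne' ha.ne', ← hL] at this
    have := mul_lt_mul_of_pos_left this ha
    rwa [mul_sub a (c / a), mul_div_cancel₀ _ ha.ne', mul_one] at this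
  set k := 1 / (c * L) with hk
  have hk0 : 0 < k := by positivity
  have hkL : k * (c * L) = 1 := by rw [hk]; field_simp
  have hka : a < k * c * (c - a) := by
    have := mul_lt_mul_of_pos_left hL1 (mul_pos hk0 hc)
    calc a = k * c * (a * L) := by linear_combination -a * hkL
      _ < _ := this
  have hder : HasDerivAt (fun s : ℝ => (a + s * k) * ((c - s * k / 2) ^ 2 - s))
      (k * c ^ 2 - a * (k * c + 1)) 0 := by
    have l1 : HasDerivAt (fun s : ℝ => a + s * k) k 0 := by
      simpa using ((hasDerivAt_id (0 : ℝ)).mul_const k).const_add a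
    have l2 : HasDerivAt (fun s : ℝ => c - s * k / 2) (-(k / 2)) 0 := by
      simpa using (((hasDerivAt_id (0 : ℝ)).mul_const k).div_const 2).const_sub c
    refine (l1.mul ((l2.pow 2).sub (hasDerivAt_id 0))).congr_deriv ?_
    simp
    ring
  have hev1 : ∀ᶠ s in nhds (0 : ℝ), 0 < c - s * k / 2 := by
    have : ContinuousAt (fun s : ℝ => c - s * k / 2) 0 := by fun_prop
    exact this.eventually (lt_mem_nhds (by simpa using hc))
  have hev2 : ∀ᶠ s in nhds (0 : ℝ), 0 < (c - s * k / 2) ^ 2 - s := by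
    have : ContinuousAt (fun s : ℝ => (c - s * k / 2) ^ 2 - s) 0 := by fun_prop
    exact this.eventually (lt_mem_nhds (by simpa using pow_pos hc 2))
  obtain ⟨s, hs, hP, hu, hsu⟩ := exists_gt_of_hasDerivAt_pos hder (by linarith) (hev1.and hev2)
  set u := c - s * k / 2 with hudef
  have hsq : Real.sqrt s ^ 2 = s := Real.sq_sqrt hs.le
  have he0 : 0 < Real.sqrt s := Real.sqrt_pos.2 hs
  have he1 : Real.sqrt s < u := (Real.sqrt_lt' hu).2 (by linarith)
  have ha' : 0 < a + s * k := by positivity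
  refine ⟨a + s * k, u - Real.sqrt s, u + Real.sqrt s, ha', by linarith, by linarith,
    by rw [hudef]; ring, ?_, ?_⟩
  · have t1 := mul_log_tangent_le ha ha'
    have t2 := mul_log_tangent_le hc hu
    have t3 := mul_log_midpoint he0.le he1
    rw [hsq] at t3
    have t4 : s / c ≤ s / u := by
      have : u ≤ c := by rw [hudef]; linarith [mul_pos hs hk0]
      gcongr
    have t5 : s / c = s * k * L := by rw [hk]; field_simp
    have e1 : (a + s * k - a) * (Real.log a + 1) = s * k * (Real.log a + 1) := by ring
    have e2 : (u - c) * (Real.log c + 1) = -(s * k / 2) * (Real.log c + 1) := by rw [hudef]; ring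
    rw [e1] at t1
    rw [e2] at t2
    rw [t5, hL] at t4
    linarith
  · have e1 : (a + s * k) * (u - Real.sqrt s) * (u + Real.sqrt s) = (a + s * k) * (u ^ 2 - s) := by
      linear_combination -(a + s * k) * hsq
    rw [e1]
    have : (a + 0 * k) * ((c - 0 * k / 2) ^ 2 - 0) = a * c * c := by ring
    linarith

/-- Three positive values `a < b ≤ c` can be replaced by three of the same sum, no smaller entropy
sum and larger product. -/
lemma exists_improvement {a b c : ℝ} (ha : 0 < a) (hab : a < b) (hbc : b ≤ c) :
    ∃ a' b' c' : ℝ, 0 < a' ∧ 0 < b' ∧ 0 < c' ∧ a' + b' + c' = a + b + c ∧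
      a * Real.log a + b * Real.log b + c * Real.log c ≤
        a' * Real.log a' + b' * Real.log b' + c' * Real.log c' ∧
      a * b * c < a' * b' * c' := by
  rcases hbc.lt_or_eq with h | rfl
  · exact exists_improvement_of_lt ha hab h
  · exact exists_improvement_of_eq ha hab

/-- A maximizer of the product, under a fixed sum and a lower bound on the entropy sum, takes
a common value away from any maximal coordinate. -/
lemma eq_of_prod_maximal {n : Type*} [Fintype n] [DecidableEq n] {x : n → ℝ} {h : ℝ}
    (hx : ∀ i, 0 < x i) (hH : h ≤ ∑ i, x i * Real.log (x i))
    (hmax : ∀ y : n → ℝ, (∀ i, 0 < y i) → ∑ i, y i = ∑ i, x i →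
      h ≤ ∑ i, y i * Real.log (y i) → ∏ i, y i ≤ ∏ i, x i)
    {k : n} (hk : ∀ i, x i ≤ x k) {i j : n} (hi : i ≠ k) (hj : j ≠ k) : x i = x j := by
  wlog hij : x i < x j generalizing i j with H
  · rcases lt_trichotomy (x i) (x j) with h1 | h1 | h1
    · exact H hi hj h1
    · exact h1
    · exact (H hj hi h1).symm
  exfalso
  have hne : i ≠ j := by rintro rfl; exact lt_irrefl _ hij
  obtain ⟨a, b, c, ha, hb, hc, hsum, hlog, hprod⟩ := exists_improvement (hx i) hij (hk j)
  let y : n → ℝ := fun m => if m = i then a else if m = j then b else if m = k then c else x m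
  have yi : y i = a := by simp [y]
  have yj : y j = b := by simp [y, hne.symm]
  have yk : y k = c := by simp [y, hi.symm, hj.symm]
  have yo : ∀ m ∈ ({i, j, k} : Finset n)ᶜ, y m = x m := by
    intro m hm
    simp only [Finset.mem_compl, Finset.mem_insert, Finset.mem_singleton, not_or] at hm
    simp [y, hm.1, hm.2.1, hm.2.2]
  have hmem1 : i ∉ ({j, k} : Finset n) := by simp [hne, hi]
  have hmem2 : j ∉ ({k} : Finset n) := by simp [hj]
  have split : ∀ g : n → ℝ, ∑ m, g m = g i + (g j + g k) + ∑ m ∈ ({i, j, k} : Finset n)ᶜ, g m := by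
    intro g
    rw [← Finset.sum_add_sum_compl {i, j, k}, Finset.sum_insert hmem1, Finset.sum_insert hmem2,
      Finset.sum_singleton]
  have splitP : ∀ g : n → ℝ, ∏ m, g m = g i * (g j * g k) * ∏ m ∈ ({i, j, k} : Finset n)ᶜ, g m := by
    intro g
    rw [← Finset.prod_mul_prod_compl {i, j, k}, Finset.prod_insert hmem1, Finset.prod_insert hmem2,
      Finset.prod_singleton]
  have hy : ∀ m, 0 < y m := by
    intro m
    simp only [y]
    split_ifs <;> first | assumption | exact hx m
  have key := hmax y hy (by
    rw [split y, split x, Finset.sum_congr rfl yo, yi, yj, yk]; linarith) (by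
    refine hH.trans ?_
    rw [split (fun m => x m * Real.log (x m)), split (fun m => y m * Real.log (y m)),
      Finset.sum_congr rfl (fun m hm => show y m * Real.log (y m) = x m * Real.log (x m) by
        rw [yo m hm]), yi, yj, yk]
    linarith)
  rw [splitP y, splitP x, Finset.prod_congr rfl yo, yi, yj, yk] at key
  have := le_of_mul_le_mul_right key (Finset.prod_pos fun m _ => hx m)
  linarith

/-- The product attains its maximum on the simplex of mass `s` cut by an entropy constraint. -/
lemma exists_prod_maximal {n : Type*} [Fintype n] {s h : ℝ} {p : n → ℝ}
    (hp : ∀ i, 0 < p i) (hps : ∑ i, p i = s) (hpH : h ≤ ∑ i, p i * Real.log (p i)) :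
    ∃ x : n → ℝ, (∀ i, 0 < x i) ∧ ∑ i, x i = s ∧ h ≤ ∑ i, x i * Real.log (x i) ∧
      ∀ y : n → ℝ, (∀ i, 0 < y i) → ∑ i, y i = s →
        h ≤ ∑ i, y i * Real.log (y i) → ∏ i, y i ≤ ∏ i, x i := by
  let K : Set (n → ℝ) := {x | (∀ i, 0 ≤ x i) ∧ ∑ i, x i = s ∧ h ≤ ∑ i, x i * Real.log (x i)}
  have hK : IsCompact K := by
    refine (isCompact_univ_pi fun _ : n => isCompact_Icc (a := (0 : ℝ)) (b := s)).of_isClosed_subset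
      ?_ ?_
    · refine (isClosed_le continuous_const continuous_id).inter
        ((isClosed_eq (by fun_prop) continuous_const).inter
          (isClosed_le continuous_const (continuous_finsetSum _ fun i _ =>
            Real.continuous_mul_log.comp (continuous_apply i))))
    · rintro x ⟨h1, h2, -⟩ i -
      exact ⟨h1 i, h2 ▸ Finset.single_le_sum (f := x) (fun j _ => h1 j) (Finset.mem_univ i)⟩
  obtain ⟨x, ⟨hx0, hxs, hxH⟩, hxm⟩ := hK.exists_isMaxOn ⟨p, fun i => (hp i).le, hps, hpH⟩
    (f := fun x : n → ℝ => ∏ i, x i) (by fun_prop)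
  have hpos : 0 < ∏ i, x i := (Finset.prod_pos fun i _ => hp i).trans_le
    (hxm (show p ∈ K from ⟨fun i => (hp i).le, hps, hpH⟩))
  refine ⟨x, fun i => (hx0 i).lt_of_ne fun h0 => hpos.ne' ?_, hxs, hxH, fun y h1 h2 h3 =>
    hxm (show y ∈ K from ⟨fun i => (h1 i).le, h2, h3⟩)⟩
  exact Finset.prod_eq_zero (Finset.mem_univ i) h0.symm

/-- If the entropy sum at `(z, w, …, w)` is at least that at `(z₀, w₀, …, w₀)`, where
`w = (d - z) / (d - 1)`, then `z₀ ≤ z`. -/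
lemma le_of_entropy_le {d z z₀ : ℝ} (hd : 1 < d) (hz : 1 < z) (hz₀ : z₀ < d)
    (hle : z₀ * Real.log z₀ + (d - z₀) * Real.log ((d - z₀) / (d - 1)) ≤
      z * Real.log z + (d - z) * Real.log ((d - z) / (d - 1))) : z₀ ≤ z := by
  by_contra! hlt
  have hd1 : 0 < d - 1 := by linarith
  have hw : 0 < (d - z) / (d - 1) := div_pos (by linarith) hd1
  have hw₀ : 0 < (d - z₀) / (d - 1) := div_pos (by linarith) hd1
  have hwz : (d - z) / (d - 1) < z := by
    rw [div_lt_iff₀ hd1]; nlinarith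
  have t1 := mul_log_tangent_le (by linarith : 0 < z) (by linarith : 0 < z₀)
  have t2 := mul_le_mul_of_nonneg_left (mul_log_tangent_le hw hw₀) hd1.le
  have e1 : (d - 1) * ((d - z) / (d - 1)) = d - z := mul_div_cancel₀ _ hd1.ne'
  have e2 : (d - 1) * ((d - z₀) / (d - 1)) = d - z₀ := mul_div_cancel₀ _ hd1.ne'
  rw [mul_add, ← mul_assoc, ← mul_assoc, ← mul_assoc, mul_sub, e1, e2] at t2
  have := mul_pos (sub_pos.2 hlt) (sub_pos.2 (Real.log_lt_log hw hwz))
  linarith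

lemma objective_mono {d z z₀ : ℝ} (hz₀ : 1 < z₀) (h : z₀ ≤ z) (hz : z < d) :
    -Real.log z₀ - (d - 1) * Real.log ((d - z₀) / (d - 1)) ≤
      -Real.log z - (d - 1) * Real.log ((d - z) / (d - 1)) := by
  have hd1 : 0 < d - 1 := by linarith
  have hw : 0 < (d - z) / (d - 1) := div_pos (by linarith) hd1
  have hw₀ : 0 < (d - z₀) / (d - 1) := div_pos (by linarith) hd1
  have hwz : (d - z₀) / (d - 1) ≤ z₀ := by
    rw [div_le_iff₀ hd1]; nlinarith
  have t1 := log_le_tangent (by linarith : 0 < z₀) (by linarith : 0 < z)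
  have t2 := mul_le_mul_of_nonneg_left (log_le_tangent hw₀ hw) hd1.le
  have e : (d - 1) * (((d - z) / (d - 1) - (d - z₀) / (d - 1)) / ((d - z₀) / (d - 1)))
      = -((z - z₀) / ((d - z₀) / (d - 1))) := by field_simp; ring
  rw [mul_add, e] at t2
  have := div_le_div_of_nonneg_left (sub_nonneg.2 h) hw₀ hwz
  linarith

/-- The one-variable entropy constraint is solvable. -/
lemma exists_entropy_eq {d h : ℝ} (hd : 1 < d) (h0 : 0 < h) (hdl : h < d * Real.log d) :
    ∃ z, 1 < z ∧ z < d ∧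
      z * Real.log z + (d - z) * Real.log ((d - z) / (d - 1)) = h := by
  have hd1 : d - 1 ≠ 0 := by linarith
  have hc : Continuous fun z : ℝ =>
      z * Real.log z + (d - z) * Real.log ((d - z) / (d - 1)) := by
    have : (fun z : ℝ => z * Real.log z + (d - z) * Real.log ((d - z) / (d - 1))) = fun z =>
        z * Real.log z + (d - 1) * ((d - z) / (d - 1) * Real.log ((d - z) / (d - 1))) := by
      funext z
      rw [← mul_assoc, mul_div_cancel₀ _ hd1]
    rw [this]
    exact Real.continuous_mul_log.add (continuous_const.mul
      (Real.continuous_mul_log.comp (by fun_prop)))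
  obtain ⟨z, ⟨h1, h2⟩, h3⟩ := intermediate_value_Ioo hd.le hc.continuousOn
    (show h ∈ Set.Ioo _ _ from ⟨by simpa [div_self hd1] using h0, by simpa using hdl⟩)
  exact ⟨z, h1, h2, h3⟩

/-- Sums over a family that is constant away from one index. -/
lemma sum_comp_of_eq_off {d : ℕ} {k : Fin d} {x : Fin d → ℝ} {w : ℝ} (hx : ∀ i ≠ k, x i = w)
    (g : ℝ → ℝ) : ∑ i, g (x i) = g (x k) + ((d : ℝ) - 1) * g w := by
  have hd : 1 ≤ d := k.pos
  rw [← Finset.add_sum_erase _ _ (Finset.mem_univ k),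
    Finset.sum_congr rfl (fun i hi => by rw [hx i (Finset.ne_of_mem_erase hi)]),
    Finset.sum_const, Finset.card_erase_of_mem (Finset.mem_univ k), Finset.card_univ,
    Fintype.card_fin, nsmul_eq_mul, Nat.cast_sub hd, Nat.cast_one]

/-- The lower bound in normalized coordinates. -/
lemma objective_le_neg_sum_log {d : ℕ} (hd : 2 ≤ d) {h z₀ : ℝ} (h0 : 0 < h) (hz1 : 1 < z₀)
    (hz2 : z₀ < d)
    (hz3 : z₀ * Real.log z₀ + ((d : ℝ) - z₀) * Real.log (((d : ℝ) - z₀) / ((d : ℝ) - 1)) = h)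
    {p : Fin d → ℝ} (hp : ∀ i, 0 < p i) (hps : ∑ i, p i = d)
    (hpH : h ≤ ∑ i, p i * Real.log (p i)) :
    -Real.log z₀ - ((d : ℝ) - 1) * Real.log (((d : ℝ) - z₀) / ((d : ℝ) - 1)) ≤
      -∑ i, Real.log (p i) := by
  have hdR : (1 : ℝ) < d := by exact_mod_cast hd
  have hd1 : (0 : ℝ) < d - 1 := by linarith
  obtain ⟨x, hx, hxs, hxH, hxm⟩ := exists_prod_maximal hp hps hpH
  have : Nonempty (Fin d) := ⟨⟨0, by omega⟩⟩
  obtain ⟨k, hk⟩ := Finite.exists_max x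
  set w := ((d : ℝ) - x k) / (d - 1) with hw
  have hoff : ∀ i ≠ k, x i = w := by
    intro i hi
    have hs := sum_comp_of_eq_off (k := k) (x := x) (w := x i)
      (fun j hj => eq_of_prod_maximal hx hxH (by rwa [hxs]) hk hj hi) id
    simp only [id] at hs
    rw [hw, eq_div_iff hd1.ne']
    linarith
  have hkd : x k < d := by
    have : Nontrivial (Fin d) := Fin.nontrivial_iff_two_le.2 hd
    obtain ⟨i, hi⟩ := exists_ne k
    have := hx i
    rw [hoff i hi, hw, div_pos_iff_of_pos_right hd1] at this
    linarith
  have hH := sum_comp_of_eq_off hoff (fun t => t * Real.log t)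
  have hwd : ((d : ℝ) - 1) * w = d - x k := mul_div_cancel₀ _ hd1.ne'
  simp only [← mul_assoc, hwd] at hH
  have hk1 : 1 < x k := by
    by_contra! hle
    have : ∑ i, x i * Real.log (x i) ≤ 0 := Finset.sum_nonpos fun i _ =>
      mul_nonpos_of_nonneg_of_nonpos (hx i).le
        (Real.log_nonpos (hx i).le ((hk i).trans hle))
    linarith
  have hle : z₀ ≤ x k := le_of_entropy_le hdR hk1 hz2 (by linarith)
  have h1 := objective_mono hz1 hle hkd
  have h2 := sum_comp_of_eq_off hoff Real.log
  have h3 := Real.log_le_log (Finset.prod_pos fun i _ => hp i) (hxm p hp hps hpH)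
  rw [Real.log_prod fun i _ => (hp i).ne', Real.log_prod fun i _ => (hx i).ne'] at h3
  linarith

lemma sum_flog_of_sum_eq {d : ℕ} {x : Fin d → ℝ} (hx : ∑ i, x i = d) :
    ∑ i, flog (x i) = ∑ i, x i * Real.log (x i) := by
  simp [flog, Finset.sum_add_distrib, Finset.sum_sub_distrib, hx]

lemma sum_Ffun_of_sum_eq {d : ℕ} {x : Fin d → ℝ} (hx : ∑ i, x i = d) :
    ∑ i, Ffun (x i) = -∑ i, Real.log (x i) := by
  simp [Ffun, Finset.sum_add_distrib, Finset.sum_sub_distrib, hx]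

/-- Reduction of `M_d(h)` to a one-variable optimization:
`M_d(h) = inf over z ∈ (1,d)` with `z log z + (d−z) log((d−z)/(d−1)) = h`
of `−log z − (d−1) log((d−z)/(d−1))`. -/
theorem Md_eq_one_variable_inf (d : ℕ) (hd : 2 ≤ d) (h : ℝ) (h0 : 0 < h)
    (hdl : h < (d : ℝ) * Real.log d) :
    Md d h = sInf {y : ℝ | ∃ z : ℝ, 1 < z ∧ z < d ∧
      z * Real.log z + ((d : ℝ) - z) * Real.log (((d : ℝ) - z) / ((d : ℝ) - 1)) = h ∧
      y = -Real.log z - ((d : ℝ) - 1) * Real.log (((d : ℝ) - z) / ((d : ℝ) - 1))} := by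
  have hdR : (1 : ℝ) < d := by exact_mod_cast hd
  have hd0 : (0 : ℝ) < d := by linarith
  have hd1 : (0 : ℝ) < d - 1 := by linarith
  obtain ⟨z, hz1, hz2, hz3⟩ := exists_entropy_eq hdR h0 hdl
  have hR : IsLeast {y : ℝ | ∃ z : ℝ, 1 < z ∧ z < d ∧
      z * Real.log z + ((d : ℝ) - z) * Real.log (((d : ℝ) - z) / ((d : ℝ) - 1)) = h ∧
      y = -Real.log z - ((d : ℝ) - 1) * Real.log (((d : ℝ) - z) / ((d : ℝ) - 1))}
      (-Real.log z - ((d : ℝ) - 1) * Real.log (((d : ℝ) - z) / ((d : ℝ) - 1))) := by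
    refine ⟨⟨z, hz1, hz2, hz3, rfl⟩, ?_⟩
    rintro _ ⟨z', h1, h2, h3, rfl⟩
    exact objective_mono hz1 (le_of_entropy_le hdR h1 hz2 (by linarith)) h2
  have hL : IsLeast {y : ℝ | ∃ q : Fin d → ℝ, (∀ i, 0 < q i) ∧ ∑ i, q i = 1 ∧
      h ≤ ∑ i, flog (d * q i) ∧ y = ∑ i, Ffun (d * q i)}
      (-Real.log z - ((d : ℝ) - 1) * Real.log (((d : ℝ) - z) / ((d : ℝ) - 1))) := by
    constructor
    · let k : Fin d := ⟨0, by omega⟩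
      set w := ((d : ℝ) - z) / (d - 1) with hw
      have hw0 : 0 < w := div_pos (by linarith) hd1
      have hwd : ((d : ℝ) - 1) * w = d - z := mul_div_cancel₀ _ hd1.ne'
      let x : Fin d → ℝ := fun i => if i = k then z else w
      have hoff : ∀ i ≠ k, x i = w := fun i hi => by simp [x, hi]
      have hxk : x k = z := by simp [x]
      have hxs : ∑ i, x i = d := by
        have := sum_comp_of_eq_off hoff id
        simp only [id, hxk, hwd] at this
        linarith
      have e : ∀ i, (d : ℝ) * (x i / d) = x i := fun i => mul_div_cancel₀ _ hd0.ne'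
      refine ⟨fun i => x i / d, fun i => div_pos ?_ hd0, ?_, ?_, ?_⟩
      · simp only [x]
        split_ifs <;> linarith
      · rw [← Finset.sum_div, hxs, div_self hd0.ne']
      · simp only [e]
        rw [sum_flog_of_sum_eq hxs, sum_comp_of_eq_off hoff (fun t => t * Real.log t), ← mul_assoc,
          hwd, hxk, hz3]
      · simp only [e]
        rw [sum_Ffun_of_sum_eq hxs, sum_comp_of_eq_off hoff Real.log, hxk]
        ring
    · rintro _ ⟨q, hq, hqs, hqH, rfl⟩
      have hs : ∑ i, (d : ℝ) * q i = d := by rw [← Finset.mul_sum, hqs, mul_one]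
      rw [sum_flog_of_sum_eq hs] at hqH
      rw [sum_Ffun_of_sum_eq hs]
      exact objective_le_neg_sum_log hd h0 hz1 hz2 hz3 (fun i => mul_pos hd0 (hq i)) hs hqH
  rw [Md, hL.csInf_eq, hR.csInf_eq]
end
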